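/- Let r > 2, 1 < q ≤ 2, and let Ξ ⊂ ℝ⁺ be a finite set. Given real coefficients a_ω for each dyadic interval ω, let D_k(ξ) = Σ_{|ω|=2^k, ω∩Ξ≠∅} a_ω 1_ω(ξ) for k ∈ ℤ. Suppose Υ is a finite collection of pairwise disjoint subintervals of ℝ⁺ and {b_υ}_{υ∈Υ} ⊂ ℝ is a collection of coefficients. Then ‖ (D_k · Σ_{υ∈Υ} b_υ 1_υ)_{k∈ℤ} ‖_{M^{q,*}} ≤ C_{q,r} (1 + log(|Ξ| + |Υ|)) (|Ξ| + |Υ|)^{1/q − 1/r} · sup_{ξ∈Ξ} ‖ (Σ_{|ω|=2^k} a_ω 1_ω(ξ))_{k∈ℤ} ‖_{V^r_k} · sup_{υ∈Υ} |b_υ|. -/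

import Mathlib

open MeasureTheory Set Filter
open scoped ENNReal NNReal Classical BigOperators RealInnerProductSpace

noncomputable section

/-- The binary digit of `x` in position `n+1` to the left of the point
(terminating expansion for dyadic rationals). -/
def digit (n : ℤ) (x : ℝ) : ℤ := ⌊x / 2 ^ n⌋ % 2

/-- Bitwise addition `⊕` on nonnegative reals. -/
def wXor (x y : ℝ) : ℝ := ∑' n : ℤ, (((digit n x + digit n y) % 2 : ℤ) : ℝ) * 2 ^ n

/-- The `n`-th digit of the bitwise product `x ⊗ y`. -/
def wMulDigit (n : ℤ) (x y : ℝ) : ℤ :=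
  ⌊∑' m : ℤ, ((digit (n - m) x * digit m y : ℤ) : ℝ)⌋ % 2

/-- Bitwise multiplication `⊗` on nonnegative reals. -/
def wMul (x y : ℝ) : ℝ := ∑' n : ℤ, ((wMulDigit n x y : ℤ) : ℝ) * 2 ^ n

/-- The Walsh character `e(x) = exp (i π d₋₁(x))`. -/
def walshe (x : ℝ) : ℝ := (-1 : ℝ) ^ (digit (-1) x)

/-- The Walsh–Fourier transform on `ℝ⁺`; it is involutive, so it also serves
as the inverse Walsh–Fourier transform `ˇ`. -/
def walshFT (f : ℝ → ℝ) (ξ : ℝ) : ℝ := ∫ x in Set.Ici (0 : ℝ), walshe (wMul ξ x) * f x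

/-- Lebesgue measure on `ℝ⁺`. -/
def μplus : Measure ℝ := volume.restrict (Set.Ici 0)

/-- `L^p` norm (real exponent `p`) of an `ℝ≥0∞`-valued function. -/
def lpNormE (p : ℝ) (μ : Measure ℝ) (F : ℝ → ℝ≥0∞) : ℝ≥0∞ := (∫⁻ x, F x ^ p ∂μ) ^ (1 / p)

/-- The `r`-variation norm of `m` on the domain `D`. -/
def vnorm {ι E : Type*} [LinearOrder ι] [NormedAddCommGroup E] (r : ℝ) (D : Set ι)
    (m : ι → E) : ℝ≥0∞ :=
  (⨆ ξ ∈ D, (‖m ξ‖₊ : ℝ≥0∞)) +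
    ⨆ (N : ℕ) (u : Fin (N + 1) → ι) (_ : StrictMono u) (_ : ∀ i, u i ∈ D),
      (∑ i : Fin N, (‖m (u i.succ) - m (u i.castSucc)‖₊ : ℝ≥0∞) ^ r) ^ (1 / r)

/-- The Walsh `L^q`-multiplier norm. -/
def Mq (q : ℝ) (m : ℝ → ℝ) : ℝ≥0∞ :=
  ⨆ (g : ℝ → ℝ) (_ : eLpNorm g (ENNReal.ofReal q) μplus = 1),
    eLpNorm (walshFT fun ξ => m ξ * walshFT g ξ) (ENNReal.ofReal q) μplus

/-- The Walsh `L^q`-maximal-multiplier norm of a sequence of multipliers. -/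
def Mqstar (q : ℝ) (m : ℤ → ℝ → ℝ) : ℝ≥0∞ :=
  ⨆ (g : ℝ → ℝ) (_ : eLpNorm g (ENNReal.ofReal q) μplus = 1),
    lpNormE q μplus fun x => ⨆ k : ℤ, (‖walshFT (fun ξ => m k ξ * walshFT g ξ) x‖₊ : ℝ≥0∞)

/-- The `s`-variation `L^q`-multiplier norm of a sequence of multipliers. -/
def Mqs (q s : ℝ) (m : ℤ → ℝ → ℝ) : ℝ≥0∞ :=
  ⨆ (g : ℝ → ℝ) (_ : eLpNorm g (ENNReal.ofReal q) μplus = 1),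
    lpNormE q μplus fun x =>
      vnorm s (Set.univ : Set ℤ) fun k => walshFT (fun ξ => m k ξ * walshFT g ξ) x

/-- Dyadic intervals `[n 2^k, (n+1) 2^k)`. -/
def IsDyadic (I : Set ℝ) : Prop :=
  ∃ n k : ℤ, I = Set.Ico ((n : ℝ) * 2 ^ k) (((n : ℝ) + 1) * 2 ^ k)

/-- Dyadic intervals of length `2^k`. -/
def IsDyadicLen (k : ℤ) (ω : Set ℝ) : Prop :=
  ∃ n : ℤ, ω = Set.Ico ((n : ℝ) * 2 ^ k) (((n : ℝ) + 1) * 2 ^ k)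

/-- The lower half of an interval. -/
def lowerHalf (ω : Set ℝ) : Set ℝ := ω ∩ Set.Iio ((sInf ω + sSup ω) / 2)

/-- The upper half of an interval. -/
def upperHalf (ω : Set ℝ) : Set ℝ := ω ∩ Set.Ici ((sInf ω + sSup ω) / 2)

/-- A bitile `I × ω ⊆ ℝ⁺ × ℝ⁺` : a rectangle of dyadic intervals of area `2`. -/
structure Bitile where
  I : Set ℝ
  ω : Set ℝ
  hI : IsDyadic I
  hω : IsDyadic ω
  hIsub : I ⊆ Set.Ici 0
  hωsub : ω ⊆ Set.Ici 0
  harea : volume I * volume ω = 2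

/-- The `L²`-normalized Walsh wave packet of the tile `I × ω`. -/
def wavePacket (I ω : Set ℝ) (x : ℝ) : ℝ :=
  Real.sqrt (volume I).toReal * walshFT (Set.indicator ω fun _ => (1 : ℝ)) (wXor x (sInf I))

/-- `⟨f, φ_{P_l}⟩`, the pairing of `f` with the wave packet of the lower tile of `P`. -/
def walshCoef (P : Bitile) (f : ℝ → ℝ) : ℝ :=
  ∫ y in Set.Ici (0 : ℝ), f y * wavePacket P.I (lowerHalf P.ω) y

/-- The partial order on bitiles. -/
def Bitile.le (P Q : Bitile) : Prop := P.I ⊆ Q.I ∧ Q.ω ⊆ P.ω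

/-- Convexity of a set of bitiles. -/
def ConvexBitiles (S : Set Bitile) : Prop :=
  ∀ P₁ P₂ P₃ : Bitile, P₁ ∈ S → P₃ ∈ S → Bitile.le P₁ P₂ → Bitile.le P₂ P₃ → P₂ ∈ S

/-- The truncated partial Walsh-sum operator attached to a collection `Ps` of bitiles. -/
def Sk (Ps : Set Bitile) (f : ℝ → ℝ) (k : ℤ) (ξ x : ℝ) : ℝ :=
  ∑ᶠ (P : Bitile) (_ : P ∈ Ps ∧ volume P.I < 2 ^ k),
    walshCoef P f * wavePacket P.I (lowerHalf P.ω) x *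
      Set.indicator (upperHalf P.ω) (fun _ => (1 : ℝ)) ξ

/-- The partial Walsh-sum operator `S[f](ξ,x) = (f̂ 1_{[0,ξ)})ˇ(x)`. -/
def Spartial (f : ℝ → ℝ) (ξ x : ℝ) : ℝ :=
  walshFT (fun η => Set.indicator (Set.Ico 0 ξ) (fun _ => (1 : ℝ)) η * walshFT f η) x

/-- A tree of bitiles with top data `(ξtop, Itop)`. -/
structure WTree where
  carrier : Set Bitile
  ξtop : ℝ
  Itop : Set ℝ

/-- The defining conditions of a tree. -/
def IsTree (T : WTree) : Prop :=
  IsDyadic T.Itop ∧ 0 ≤ T.ξtop ∧ ∀ P ∈ T.carrier, P.I ⊆ T.Itop ∧ T.ξtop ∈ P.ω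

/-- `u`-overlapping trees. -/
def UOverlapping (T : WTree) : Prop := ∀ P ∈ T.carrier, T.ξtop ∈ upperHalf P.ω

/-- `l`-overlapping trees. -/
def LOverlapping (T : WTree) : Prop := ∀ P ∈ T.carrier, T.ξtop ∈ lowerHalf P.ω

/-- `T` is td-maximal among the trees in `Cc` : maximal with respect to inclusion among
trees in `Cc` with the same top data. -/
def TdMaximalAmong (T : WTree) (Cc : Set WTree) : Prop :=
  T ∈ Cc ∧ ∀ T' ∈ Cc, T'.ξtop = T.ξtop → T'.Itop = T.Itop →
    T.carrier ⊆ T'.carrier → T'.carrier ⊆ T.carrier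

/-- Order on the lower tiles of two bitiles. -/
def lowerLE (P Q : Bitile) : Prop := P.I ⊆ Q.I ∧ lowerHalf Q.ω ⊆ lowerHalf P.ω

/-- Strict order on the lower tiles of two bitiles. -/
def lowerLT (P Q : Bitile) : Prop := lowerLE P Q ∧ ¬ lowerLE Q P

/-- `l`-convexity of a set of bitiles. -/
def LConvex (S : Set Bitile) : Prop :=
  ∀ P P' P'' : Bitile, P ∈ S → P'' ∈ S → lowerLT P P' → lowerLT P' P'' → P' ∈ S

/-- A properly-sorted collection of `l`-overlapping trees. -/
def ProperlySorted (Ts : Set WTree) : Prop :=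
  (∀ T ∈ Ts, IsTree T ∧ LOverlapping T ∧ LConvex T.carrier) ∧
  (∀ T ∈ Ts, ∀ T' ∈ Ts, T ≠ T' → T.carrier ∩ T'.carrier = ∅) ∧
  (∀ T ∈ Ts, ∀ P ∈ T.carrier, ∀ T' ∈ Ts, (T'.Itop ∩ P.I).Nonempty → T'.ξtop ∉ upperHalf P.ω)

/-- The multiplier `𝒟_k = Σ_{|ω| = 2^k, ω ∩ Ξ ≠ ∅} a_ω 1_ω`. -/
def Dk (a : Set ℝ → ℝ) (Ξ : Set ℝ) (k : ℤ) (ξ : ℝ) : ℝ :=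
  ∑ᶠ (ω : Set ℝ) (_ : IsDyadicLen k ω ∧ (ω ∩ Ξ).Nonempty),
    a ω * Set.indicator ω (fun _ => (1 : ℝ)) ξ

/-- The sequence `k ↦ Σ_{|ω| = 2^k} a_ω 1_ω(ξ)`. -/
def dyadicSum (a : Set ℝ → ℝ) (ξ : ℝ) (k : ℤ) : ℝ :=
  ∑ᶠ (ω : Set ℝ) (_ : IsDyadicLen k ω), a ω * Set.indicator ω (fun _ => (1 : ℝ)) ξ

/-- A tile `I × ω ⊆ ℝ⁺ × ℝ⁺` : a rectangle of dyadic intervals of area `1`. -/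
structure WTile where
  I : Set ℝ
  ω : Set ℝ
  hI : IsDyadic I
  hω : IsDyadic ω
  hIsub : I ⊆ Set.Ici 0
  hωsub : ω ⊆ Set.Ici 0
  harea : volume I * volume ω = 1

/-- The subset of the phase plane occupied by a tile. -/
def WTile.carrier (p : WTile) : Set (ℝ × ℝ) := p.I ×ˢ p.ω

/-- The phase-plane projection `Π_S` associated to a region `S` which can be written as a
finite disjoint union of tiles (it is independent of the chosen tiling). -/
def phaseProj (S : Set (ℝ × ℝ)) (f : ℝ → ℝ) : ℝ → ℝ :=
  if h : ∃ ps : Set WTile, ps.Finite ∧ ps.PairwiseDisjoint WTile.carrier ∧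
      (⋃ p ∈ ps, p.carrier) = S then
    fun x => ∑ᶠ p ∈ h.choose,
      (∫ y in Set.Ici (0 : ℝ), f y * wavePacket p.I p.ω y) * wavePacket p.I p.ω x
  else 0

/-- The region of the phase plane occupied by a tree. -/
def treeRegion (T : WTree) : Set (ℝ × ℝ) := ⋃ P ∈ T.carrier, P.I ×ˢ P.ω

/-- `size(Ps, f) = sup_{T ⊆ Ps convex tree} |I_T|^{-1/2} ‖Π_T f‖_{L²}`. -/
def size (Ps : Set Bitile) (f : ℝ → ℝ) : ℝ≥0∞ :=
  ⨆ (T : WTree) (_ : IsTree T ∧ ConvexBitiles T.carrier ∧ T.carrier ⊆ Ps),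
    (volume T.Itop ^ (1 / 2 : ℝ))⁻¹ * eLpNorm (phaseProj (treeRegion T) f) 2 μplus


namespace HI

/-- The finite Walsh group. -/
abbrev GG (M : ℕ) := Fin M → Bool

def sg (a b : Bool) : ℝ := if a && b then -1 else 1

def ww {M : ℕ} (η x : GG M) : ℝ := ∏ i, sg (η i) (x i)

def flip {M : ℕ} (k : ℕ) (x : GG M) : GG M := fun i => if (i : ℕ) = k then !(x i) else x i

def agree {M : ℕ} (k : ℕ) (η ξ : GG M) : Prop := ∀ i : Fin M, k ≤ (i : ℕ) → η i = ξ i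

def Dep {M : ℕ} {α : Type*} (k : ℕ) (f : GG M → α) : Prop :=
  ∀ x y : GG M, (∀ i : Fin M, (i : ℕ) < k → x i = y i) → f x = f y

def MD {M : ℕ} (k : ℕ) (d : GG M → ℝ) : Prop :=
  Dep (k + 1) d ∧ ∀ x, d (flip k x) = - d x

variable {M : ℕ}

lemma agree_refl (k : ℕ) (η : GG M) : agree k η η := fun _ _ => rfl
lemma agree.symm {k : ℕ} {η ξ : GG M} (h : agree k η ξ) : agree k ξ η := fun i hi => (h i hi).symm
lemma agree.trans {k : ℕ} {η ξ ζ : GG M} (h : agree k η ξ) (h' : agree k ξ ζ) : agree k η ζ :=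
  fun i hi => (h i hi).trans (h' i hi)
lemma agree.mono {k k' : ℕ} (hk : k ≤ k') {η ξ : GG M} (h : agree k η ξ) : agree k' η ξ :=
  fun i hi => h i (hk.trans hi)
lemma agree_top (η ξ : GG M) : agree M η ξ := fun i hi => absurd i.2 (by omega)
lemma agree_zero {η ξ : GG M} (h : agree 0 η ξ) : η = ξ := funext fun i => h i (Nat.zero_le _)

lemma flip_flip (k : ℕ) (x : GG M) : flip k (flip k x) = x := by
  funext i; by_cases h : (i : ℕ) = k <;> simp [flip, h]

lemma flip_same (i : Fin M) (x : GG M) : flip (i : ℕ) x i = !(x i) := by simp [flip]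
lemma flip_ne {k : ℕ} (i : Fin M) (h : (i : ℕ) ≠ k) (x : GG M) : flip k x i = x i := by simp [flip, h]

lemma sum_flip (k : ℕ) (f : GG M → ℝ) : ∑ x, f (flip k x) = ∑ x, f x :=
  Equiv.sum_comp (Function.Involutive.toPerm (flip k) (flip_flip k)) f

lemma sum_odd {k : ℕ} {f : GG M → ℝ} (h : ∀ x, f (flip k x) = - f x) : ∑ x, f x = 0 := by
  have h1 := sum_flip k f
  simp only [h, Finset.sum_neg_distrib] at h1
  linarith

lemma sg_mul_self (a b : Bool) : sg a b * sg a b = 1 := by cases a <;> cases b <;> simp [sg]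
lemma sg_comm (a b : Bool) : sg a b = sg b a := by cases a <;> cases b <;> simp [sg]
lemma sg_not (a b : Bool) : sg a (!b) = sg a true * sg a b := by cases a <;> cases b <;> simp [sg]
lemma sg_ne {a b : Bool} (h : a ≠ b) : sg a true * sg b true = -1 := by
  cases a <;> cases b <;> simp_all [sg]

lemma ww_comm (η x : GG M) : ww η x = ww x η := by
  unfold ww; exact Finset.prod_congr rfl fun i _ => sg_comm _ _

lemma ww_mul_self (η x : GG M) : ww η x * ww η x = 1 := by
  unfold ww; rw [← Finset.prod_mul_distrib]; exact Finset.prod_eq_one fun i _ => sg_mul_self _ _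

lemma ww_sq (η x : GG M) : ww η x ^ 2 = 1 := by rw [sq, ww_mul_self]

lemma abs_ww (η x : GG M) : |ww η x| = 1 := by
  have h := ww_sq η x
  rw [← sq_abs] at h
  have := abs_nonneg (ww η x)
  nlinarith

lemma ww_flip (η x : GG M) (i : Fin M) : ww η (flip (i : ℕ) x) = sg (η i) true * ww η x := by
  unfold ww
  rw [← Finset.mul_prod_erase Finset.univ _ (Finset.mem_univ i),
    ← Finset.mul_prod_erase Finset.univ (fun j => sg (η j) (x j)) (Finset.mem_univ i)]
  rw [flip_same, sg_not, mul_assoc]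
  congr 2
  apply Finset.prod_congr rfl
  intro j hj
  rw [flip_ne]
  intro h; exact (Finset.ne_of_mem_erase hj) (Fin.ext h)

lemma Dep.mono {α : Type*} {k k' : ℕ} (hk : k ≤ k') {f : GG M → α} (h : Dep k f) : Dep k' f :=
  fun x y hxy => h x y fun i hi => hxy i (by omega)

lemma Dep.flip {α : Type*} {k k' : ℕ} (hk : k ≤ k') {f : GG M → α} (h : Dep k f) (x : GG M) :
    f (flip k' x) = f x :=
  h _ _ fun i hi => flip_ne i (by omega) x

lemma Dep.comp {α β : Type*} {k : ℕ} {f : GG M → α} (h : Dep k f) (g : α → β) :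
    Dep k (fun x => g (f x)) := fun x y hxy => by simp only [h x y hxy]

lemma Dep.comp2 {α β γ : Type*} {k : ℕ} {f : GG M → α} {f' : GG M → β} (h : Dep k f)
    (h' : Dep k f') (g : α → β → γ) : Dep k (fun x => g (f x) (f' x)) :=
  fun x y hxy => by simp only [h x y hxy, h' x y hxy]

lemma Dep.const {α : Type*} (k : ℕ) (c : α) : Dep (M := M) k (fun _ => c) := fun _ _ _ => rfl

lemma Dep.sum {ι : Type*} {k : ℕ} (s : Finset ι) {f : ι → GG M → ℝ} (h : ∀ i ∈ s, Dep k (f i)) :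
    Dep k (fun x => ∑ i ∈ s, f i x) :=
  fun x y hxy => Finset.sum_congr rfl fun i hi => h i hi x y hxy

lemma MD.mul {k : ℕ} {h d : GG M → ℝ} (hh : Dep k h) (hd : MD k d) : MD k (fun x => h x * d x) := by
  refine ⟨(hh.mono (Nat.le_succ k)).comp2 hd.1 _, fun x => ?_⟩
  simp only [hh.flip le_rfl, hd.2]; ring

lemma MD.const_mul {k : ℕ} (c : ℝ) {d : GG M → ℝ} (hd : MD k d) : MD k (fun x => c * d x) :=
  MD.mul (h := fun _ => c) (Dep.const k c) hd

lemma sum_dep_md {k : ℕ} {h d : GG M → ℝ} (hh : Dep k h) (hd : MD k d) : ∑ x, h x * d x = 0 :=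
  sum_odd (MD.mul hh hd).2

lemma sum_md_md {k k' : ℕ} (hk : k ≠ k') {d d' : GG M → ℝ} (hd : MD k d) (hd' : MD k' d') :
    ∑ x, d x * d' x = 0 := by
  rcases lt_or_gt_of_ne hk with h | h
  · exact sum_dep_md (hd.1.mono h) hd'
  · simp_rw [mul_comm (d _)]; exact sum_dep_md (hd'.1.mono h) hd

lemma sum_sq_orth {ι : Type*} (s : Finset ι) (f : ι → GG M → ℝ)
    (h : ∀ i ∈ s, ∀ j ∈ s, i ≠ j → ∑ x, f i x * f j x = 0) :
    ∑ x, (∑ i ∈ s, f i x) ^ 2 = ∑ i ∈ s, ∑ x, f i x ^ 2 := by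
  simp_rw [sq, Finset.sum_mul_sum]
  rw [Finset.sum_comm]
  apply Finset.sum_congr rfl
  intro i hi
  rw [Finset.sum_comm]
  rw [Finset.sum_eq_single_of_mem i hi]
  intro j hj hji
  exact h i hi j hj hji.symm

lemma ww_orth {η ξ : GG M} (i : Fin M) (h : η i ≠ ξ i) (f : GG M → ℝ)
    (hf : ∀ x, f (flip (i : ℕ) x) = f x) : ∑ x, f x * (ww η x * ww ξ x) = 0 := by
  apply sum_odd (k := i)
  intro x
  rw [hf, ww_flip, ww_flip]
  have := sg_ne h
  linear_combination (f x * ww η x * ww ξ x) * this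

lemma card_GG : (Fintype.card (GG M) : ℝ) = 2 ^ M := by simp [GG]

lemma plancherel (φ : GG M → ℝ) :
    ∑ x, (∑ η, φ η * ww η x) ^ 2 = 2 ^ M * ∑ η, φ η ^ 2 := by
  rw [sum_sq_orth Finset.univ (fun η x => φ η * ww η x)]
  · rw [Finset.mul_sum]
    apply Finset.sum_congr rfl
    intro η _
    simp_rw [mul_pow, ww_sq]
    simp [GG]
  · intro η _ ξ _ hne
    obtain ⟨i, hi⟩ := Function.ne_iff.mp hne
    have := ww_orth i hi (fun _ => φ η * φ ξ) (fun _ => rfl)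
    rw [← this]; apply Finset.sum_congr rfl; intros; ring

lemma exists_of_not_agree {k : ℕ} {η ξ : GG M} (h : ¬ agree k η ξ) :
    ∃ i : Fin M, k ≤ (i : ℕ) ∧ η i ≠ ξ i := by
  simpa [agree] using h

lemma vec_orth {K : ℕ} (R : Finset (GG M)) (hR : ∀ ρ ∈ R, ∀ ρ' ∈ R, ρ ≠ ρ' → ¬ agree K ρ ρ')
    (V : GG M → GG M → ℝ) (hV : ∀ ρ ∈ R, Dep K (V ρ)) :
    ∑ x, (∑ ρ ∈ R, V ρ x * ww ρ x) ^ 2 = ∑ x, ∑ ρ ∈ R, V ρ x ^ 2 := by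
  rw [sum_sq_orth R (fun ρ x => V ρ x * ww ρ x)]
  · rw [Finset.sum_comm]
    apply Finset.sum_congr rfl; intro x _; apply Finset.sum_congr rfl; intro ρ _
    rw [mul_pow, ww_sq, mul_one]
  · intro ρ hρ ρ' hρ' hne
    obtain ⟨i, hi, hi'⟩ := exists_of_not_agree (hR ρ hρ ρ' hρ' hne)
    have := ww_orth i hi' (fun x => V ρ x * V ρ' x) (fun x => by
      rw [(hV ρ hρ).flip hi, (hV ρ' hρ').flip hi])
    rw [← this]; apply Finset.sum_congr rfl; intros; ring

/-- Frequency-localised pieces. -/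
def PP (φ : GG M → ℝ) (ξ : GG M) (k : ℕ) (x : GG M) : ℝ :=
  ∑ η, (if agree k η ξ then φ η else 0) * ww η x

def FF (φ : GG M → ℝ) (ξ : GG M) (k : ℕ) (x : GG M) : ℝ :=
  ∑ η, (if agree k η ξ then φ η else 0) * (ww η x * ww ξ x)

lemma FF_eq (φ : GG M → ℝ) (ξ : GG M) (k : ℕ) (x : GG M) : FF φ ξ k x = PP φ ξ k x * ww ξ x := by
  unfold FF PP; rw [Finset.sum_mul]; apply Finset.sum_congr rfl; intros; ring

lemma PP_eq (φ : GG M → ℝ) (ξ : GG M) (k : ℕ) (x : GG M) : PP φ ξ k x = FF φ ξ k x * ww ξ x := by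
  rw [FF_eq, mul_assoc, ww_mul_self, mul_one]

lemma PP_sq (φ : GG M → ℝ) (ξ : GG M) (k : ℕ) (x : GG M) : PP φ ξ k x ^ 2 = FF φ ξ k x ^ 2 := by
  rw [PP_eq, mul_pow, ww_sq, mul_one]

lemma ww_mul_dep {k : ℕ} {η ξ : GG M} (h : agree k η ξ) : Dep k (fun x => ww η x * ww ξ x) := by
  intro x y hxy
  simp only [ww, ← Finset.prod_mul_distrib]
  apply Finset.prod_congr rfl
  intro i _
  by_cases hi : (i : ℕ) < k
  · rw [hxy i hi]
  · rw [h i (by omega), sg_mul_self, sg_mul_self]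

lemma FF_dep (φ : GG M → ℝ) (ξ : GG M) (k : ℕ) : Dep k (FF φ ξ k) := by
  unfold FF
  apply Dep.sum
  intro η _
  by_cases h : agree k η ξ
  · simp only [h, if_true]; exact (ww_mul_dep h).comp (fun t => φ η * t)
  · simp only [h, if_false, zero_mul]; exact Dep.const k 0

lemma FF_md (φ : GG M → ℝ) (ξ : GG M) (k : ℕ) (hk : k < M) :
    MD k (fun x => FF φ ξ (k + 1) x - FF φ ξ k x) := by
  refine ⟨(FF_dep φ ξ (k + 1)).comp2 ((FF_dep φ ξ k).mono (Nat.le_succ k)) _, fun x => ?_⟩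
  simp only [FF, ← Finset.sum_sub_distrib, ← Finset.sum_neg_distrib]
  apply Finset.sum_congr rfl
  intro η _
  by_cases h : agree k η ξ
  · simp [h, h.mono (Nat.le_succ k)]
  · by_cases h' : agree (k + 1) η ξ
    · have hne : η ⟨k, hk⟩ ≠ ξ ⟨k, hk⟩ := by
        intro he; apply h; intro i hi
        rcases Nat.lt_or_ge k i with h2 | h2
        · exact h' i h2
        · have : i = ⟨k, hk⟩ := Fin.ext (by simp; omega)
          rw [this, he]
      have h1 := ww_flip η x ⟨k, hk⟩
      have h2 := ww_flip ξ x ⟨k, hk⟩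
      simp only at h1 h2
      simp only [h, h', if_true, if_false, h1, h2]
      have := sg_ne hne
      linear_combination (φ η * ww η x * ww ξ x) * this
    · simp [h, h']

lemma FF_energy (φ : GG M → ℝ) (ξ : GG M) (k : ℕ) :
    ∑ x, FF φ ξ k x ^ 2 = 2 ^ M * ∑ η, if agree k η ξ then φ η ^ 2 else 0 := by
  simp_rw [← PP_sq]
  unfold PP
  rw [plancherel]
  congr 1; apply Finset.sum_congr rfl; intro η _; split_ifs <;> simp

end HI

namespace HI
variable {M : ℕ}

def sgnR (y : ℝ) : ℝ := if 0 ≤ y then 1 else -1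

lemma sgnR_mul_self (y : ℝ) : sgnR y * y = |y| := by
  unfold sgnR; split_ifs with h
  · rw [abs_of_nonneg h, one_mul]
  · rw [abs_of_neg (by linarith)]; ring

lemma sgnR_mul_le (y z : ℝ) : sgnR y * z ≤ |z| := by
  unfold sgnR; split_ifs with h
  · rw [one_mul]; exact le_abs_self z
  · rw [neg_one_mul]; exact neg_le_abs z

def rmax (S : ℕ → ℝ) : ℕ → ℝ
  | 0 => |S 0|
  | n + 1 => max (rmax S n) |S (n + 1)|

lemma rmax_nonneg (S : ℕ → ℝ) (n : ℕ) : 0 ≤ rmax S n := by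
  cases n with
  | zero => exact abs_nonneg _
  | succ n => exact le_max_of_le_right (abs_nonneg _)

lemma abs_le_rmax (S : ℕ → ℝ) {t n : ℕ} (h : t ≤ n) : |S t| ≤ rmax S n := by
  induction n with
  | zero => obtain rfl : t = 0 := by omega
            exact le_rfl
  | succ n ih =>
    rcases Nat.lt_or_ge t (n + 1) with h1 | h1
    · exact le_max_of_le_left (ih (by omega))
    · obtain rfl : t = n + 1 := by omega
      exact le_max_right _ _

lemma rmax_path (S : ℕ → ℝ) (n : ℕ) :
    rmax S n ^ 2 ≤ 2 * |S n| * rmax S n -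
      2 * ∑ k ∈ Finset.range n, rmax S k * sgnR (S k) * (S (k + 1) - S k) := by
  induction n with
  | zero => simp [rmax]; nlinarith [sq_abs (S 0)]
  | succ n ih =>
    rw [Finset.sum_range_succ]
    have h1 : |S n| + sgnR (S n) * (S (n + 1) - S n) ≤ |S (n + 1)| := by
      have := sgnR_mul_self (S n)
      have := sgnR_mul_le (S n) (S (n + 1))
      linarith
    have h0 := rmax_nonneg S n
    set s := ∑ k ∈ Finset.range n, rmax S k * sgnR (S k) * (S (k + 1) - S k)
    have h2 := mul_le_mul_of_nonneg_left h1 h0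
    simp only [rmax]
    rcases le_total (|S (n + 1)|) (rmax S n) with h | h
    · rw [max_eq_left h]; nlinarith
    · rw [max_eq_right h]; nlinarith [sq_nonneg (|S (n + 1)| - rmax S n)]

lemma rmax_path' (S : ℕ → ℝ) (n : ℕ) :
    rmax S n ^ 2 ≤ 4 * S n ^ 2 -
      4 * ∑ k ∈ Finset.range n, rmax S k * sgnR (S k) * (S (k + 1) - S k) := by
  have := rmax_path S n
  nlinarith [sq_nonneg (rmax S n - 2 * |S n|), sq_abs (S n)]

lemma adapt {k0 T : ℕ} {S : ℕ → GG M → ℝ} (h0 : Dep k0 (S 0))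
    (hd : ∀ t < T, MD (k0 + t) (fun x => S (t + 1) x - S t x)) {t : ℕ} (ht : t ≤ T) :
    Dep (k0 + t) (S t) := by
  induction t with
  | zero => exact h0
  | succ t ih =>
    have h1 := ((ih (by omega)).mono (show k0 + t ≤ k0 + t + 1 by omega)).comp2 (hd t (by omega)).1
      (fun a b => a + b)
    have : (fun x => S t x + (S (t + 1) x - S t x)) = S (t + 1) := by funext x; ring
    rw [this] at h1; exact h1

lemma rmax_dep {k0 T : ℕ} {S : ℕ → GG M → ℝ} (h0 : Dep k0 (S 0))
    (hd : ∀ t < T, MD (k0 + t) (fun x => S (t + 1) x - S t x)) {t : ℕ} (ht : t ≤ T) :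
    Dep (k0 + t) (fun x => rmax (fun u => S u x) t) := by
  induction t with
  | zero => exact h0.comp abs
  | succ t ih =>
    have h1 := ((ih (by omega)).mono (show k0 + t ≤ k0 + (t + 1) by omega)).comp2
      (adapt h0 hd ht) (fun a b => max a |b|)
    exact h1

lemma doob {k0 T : ℕ} {S : ℕ → GG M → ℝ} (h0 : Dep k0 (S 0))
    (hd : ∀ t < T, MD (k0 + t) (fun x => S (t + 1) x - S t x)) :
    ∑ x, rmax (fun u => S u x) T ^ 2 ≤ 4 * ∑ x, S T x ^ 2 := by
  have h1 : ∑ x, rmax (fun u => S u x) T ^ 2 ≤ ∑ x, (4 * S T x ^ 2 -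
      4 * ∑ k ∈ Finset.range T, rmax (fun u => S u x) k * sgnR (S k x) * (S (k + 1) x - S k x)) :=
    Finset.sum_le_sum fun x _ => rmax_path' (fun u => S u x) T
  refine h1.trans (le_of_eq ?_)
  rw [Finset.sum_sub_distrib, ← Finset.mul_sum, ← Finset.mul_sum, Finset.sum_comm]
  rw [Finset.sum_eq_zero (s := Finset.range T), mul_zero, sub_zero]
  intro t ht
  have ht' := Finset.mem_range.mp ht
  exact sum_dep_md ((rmax_dep h0 hd ht'.le).comp2 (adapt h0 hd ht'.le) (fun a b => a * sgnR b))
    (hd t ht')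

/-- Energy of a martingale. -/
lemma mart_energy {k0 T : ℕ} {d : ℕ → GG M → ℝ} (hd : ∀ t < T, MD (k0 + t) (d t)) :
    ∑ x, (∑ t ∈ Finset.range T, d t x) ^ 2 = ∑ t ∈ Finset.range T, ∑ x, d t x ^ 2 := by
  apply sum_sq_orth
  intro i hi j hj hij
  exact sum_md_md (by omega) (hd i (Finset.mem_range.mp hi)) (hd j (Finset.mem_range.mp hj))

end HI

namespace HI

lemma rm_sqrt (L : ℕ) : ∀ (X : ℕ → ℝ) (b : ℕ), b ≤ 2 ^ L →
    |X b - X 0| ≤ ∑ l ∈ Finset.range (L + 1),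
      Real.sqrt (∑ j ∈ Finset.range (2 ^ (L - l)), (X ((j + 1) * 2 ^ l) - X (j * 2 ^ l)) ^ 2) := by
  induction L with
  | zero =>
    intro X b hb
    have : b = 0 ∨ b = 1 := by simp at hb; omega
    rcases this with rfl | rfl
    · simp
    · simp [Real.sqrt_sq_eq_abs]
  | succ L ih =>
    intro X b hb
    rw [Finset.sum_range_succ']
    have h1 := ih (fun i => X (2 * i)) (b / 2) (by rw [pow_succ] at hb; omega)
    have e1 : ∑ l ∈ Finset.range (L + 1),
      Real.sqrt (∑ j ∈ Finset.range (2 ^ (L - l)),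
        ((fun i => X (2 * i)) ((j + 1) * 2 ^ l) - (fun i => X (2 * i)) (j * 2 ^ l)) ^ 2)
        = ∑ l ∈ Finset.range (L + 1), Real.sqrt (∑ j ∈ Finset.range (2 ^ (L + 1 - (l + 1))),
          (X ((j + 1) * 2 ^ (l + 1)) - X (j * 2 ^ (l + 1))) ^ 2) := by
      apply Finset.sum_congr rfl; intro l hl
      rw [show L + 1 - (l + 1) = L - l by omega]
      congr 1; apply Finset.sum_congr rfl; intro j _
      simp only
      rw [show 2 * ((j + 1) * 2 ^ l) = (j + 1) * 2 ^ (l + 1) by ring,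
        show 2 * (j * 2 ^ l) = j * 2 ^ (l + 1) by ring]
    rw [e1] at h1
    have h2 : |X b - X (2 * (b / 2))| ≤ Real.sqrt (∑ j ∈ Finset.range (2 ^ (L + 1 - 0)),
        (X ((j + 1) * 2 ^ 0) - X (j * 2 ^ 0)) ^ 2) := by
      rcases Nat.even_or_odd' b with ⟨c, rfl | rfl⟩
      · rw [show 2 * (2 * c / 2) = 2 * c by omega]; simp
      · rw [show 2 * ((2 * c + 1) / 2) = 2 * c by omega]
        apply Real.abs_le_sqrt
        have := Finset.single_le_sum (f := fun j => (X ((j + 1) * 2 ^ 0) - X (j * 2 ^ 0)) ^ 2)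
          (s := Finset.range (2 ^ (L + 1 - 0))) (fun i _ => sq_nonneg _)
          (a := 2 * c) (by simp only [Finset.mem_range]; simp; omega)
        simpa using this
    have h3 : |X b - X 0| ≤ |X b - X (2 * (b / 2))| + |X (2 * (b / 2)) - X 0| := abs_sub_le _ _ _
    simp only [mul_zero] at h1
    exact h3.trans ((add_comm _ _).le.trans (add_le_add h1 h2))

lemma rm_sq (L : ℕ) (X : ℕ → ℝ) (b : ℕ) (hb : b ≤ 2 ^ L) :
    (X b - X 0) ^ 2 ≤ (L + 1 : ℝ) * ∑ l ∈ Finset.range (L + 1),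
      ∑ j ∈ Finset.range (2 ^ (L - l)), (X ((j + 1) * 2 ^ l) - X (j * 2 ^ l)) ^ 2 := by
  have h := rm_sqrt L X b hb
  have h1 := sq_le_sq' (by linarith [abs_nonneg (X b - X 0)]) h
  rw [sq_abs] at h1
  refine h1.trans ?_
  have h2 := sq_sum_le_card_mul_sum_sq (s := Finset.range (L + 1)) (f := fun l =>
    Real.sqrt (∑ j ∈ Finset.range (2 ^ (L - l)), (X ((j + 1) * 2 ^ l) - X (j * 2 ^ l)) ^ 2))
  refine h2.trans (le_of_eq ?_)
  simp only [Finset.card_range]; push_cast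
  congr 1; apply Finset.sum_congr rfl; intro l _
  exact Real.sq_sqrt (Finset.sum_nonneg fun _ _ => sq_nonneg _)

end HI

namespace HI
variable {M : ℕ}

/-- Partial sums along a path. -/
def Fp (p : ℕ → GG M → ℝ) (t : ℕ) (ρ : GG M) : ℝ := ∑ u ∈ Finset.range t, p u ρ

/-- Greedy sampling along a path. -/
def grd (R : Finset (GG M)) (θ2 : ℝ) (p : ℕ → GG M → ℝ) : ℕ → (GG M → ℝ) × ℕ
  | 0 => (fun _ => 0, 0)
  | t + 1 => if θ2 < ∑ ρ ∈ R, (Fp p (t + 1) ρ - (grd R θ2 p t).1 ρ) ^ 2 then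
      (Fp p (t + 1), (grd R θ2 p t).2 + 1) else grd R θ2 p t

lemma grd_congr (R : Finset (GG M)) (θ2 : ℝ) (p p' : ℕ → GG M → ℝ) (t : ℕ)
    (h : ∀ u < t, p u = p' u) : grd R θ2 p t = grd R θ2 p' t := by
  induction t with
  | zero => rfl
  | succ t ih =>
    have h1 : Fp p (t + 1) = Fp p' (t + 1) := by
      funext ρ; unfold Fp
      exact Finset.sum_congr rfl fun u hu => by rw [h u (Finset.mem_range.mp hu)]
    simp only [grd, h1, ih (fun u hu => h u (by omega))]

section path
variable (R : Finset (GG M)) (θ2 : ℝ) (p : ℕ → GG M → ℝ)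

def gc (t : ℕ) : ℕ := (grd R θ2 p t).2

def YY (T b : ℕ) (ρ : GG M) : ℝ := ∑ u ∈ Finset.range T, if gc R θ2 p u < b then p u ρ else 0

lemma gc_succ (t : ℕ) : gc R θ2 p t ≤ gc R θ2 p (t + 1) := by
  unfold gc; simp only [grd]; split_ifs <;> simp

lemma gc_mono : Monotone (gc R θ2 p) := monotone_nat_of_le_succ (gc_succ R θ2 p)

lemma gc_le (t : ℕ) : gc R θ2 p t ≤ t := by
  induction t with
  | zero => simp [gc, grd]
  | succ t ih => unfold gc at *; simp only [grd]; split_ifs <;> (try simp only) <;> omega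

lemma grd_eq (t : ℕ) (ρ : GG M) : (grd R θ2 p t).1 ρ =
    ∑ u ∈ Finset.range t, if gc R θ2 p u < gc R θ2 p t then p u ρ else 0 := by
  induction t with
  | zero => simp [grd]
  | succ t ih =>
    by_cases h : θ2 < ∑ ρ ∈ R, (Fp p (t + 1) ρ - (grd R θ2 p t).1 ρ) ^ 2
    · have h1 : grd R θ2 p (t + 1) = (Fp p (t + 1), (grd R θ2 p t).2 + 1) := by
        simp only [grd, h, if_true]
      have h2 : gc R θ2 p (t + 1) = gc R θ2 p t + 1 := by unfold gc; rw [h1]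
      rw [h1, h2]; simp only [Fp]
      apply Finset.sum_congr rfl; intro u hu
      have := gc_mono R θ2 p (show u ≤ t by have := Finset.mem_range.mp hu; omega)
      rw [if_pos (by omega)]
    · have h1 : grd R θ2 p (t + 1) = grd R θ2 p t := by
        simp only [grd, h, if_false]
      have h2 : gc R θ2 p (t + 1) = gc R θ2 p t := by unfold gc; rw [h1]
      rw [h1, h2, Finset.sum_range_succ, ih]; simp

lemma grd_YY {t T : ℕ} (ht : t ≤ T) (ρ : GG M) : (grd R θ2 p t).1 ρ =
    YY R θ2 p T (gc R θ2 p t) ρ := by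
  rw [grd_eq, YY]
  apply Finset.sum_subset (Finset.range_mono ht)
  intro u _ hu
  have := gc_mono R θ2 p (show t ≤ u by simpa using hu)
  rw [if_neg (by omega)]

lemma grd_close (h0 : 0 ≤ θ2) (t : ℕ) : ∑ ρ ∈ R, (Fp p t ρ - (grd R θ2 p t).1 ρ) ^ 2 ≤ θ2 := by
  cases t with
  | zero => simpa [Fp, grd] using h0
  | succ t =>
    by_cases h : θ2 < ∑ ρ ∈ R, (Fp p (t + 1) ρ - (grd R θ2 p t).1 ρ) ^ 2
    · have h1 : grd R θ2 p (t + 1) = (Fp p (t + 1), (grd R θ2 p t).2 + 1) := by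
        simp only [grd, h, if_true]
      rw [h1]; simpa using h0
    · have h1 : grd R θ2 p (t + 1) = grd R θ2 p t := by
        simp only [grd, h, if_false]
      rw [h1]; linarith

lemma gc_count {t T : ℕ} (ht : t ≤ T) : θ2 * gc R θ2 p t ≤
    ∑ b ∈ Finset.range (gc R θ2 p t), ∑ ρ ∈ R, (YY R θ2 p T (b + 1) ρ - YY R θ2 p T b ρ) ^ 2 := by
  induction t with
  | zero => simp [gc, grd]
  | succ t ih =>
    have ih := ih (by omega)
    by_cases h : θ2 < ∑ ρ ∈ R, (Fp p (t + 1) ρ - (grd R θ2 p t).1 ρ) ^ 2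
    · have h1 : grd R θ2 p (t + 1) = (Fp p (t + 1), (grd R θ2 p t).2 + 1) := by
        simp only [grd, h, if_true]
      have h2 : gc R θ2 p (t + 1) = gc R θ2 p t + 1 := by unfold gc; rw [h1]
      have h3 : ∀ ρ, Fp p (t + 1) ρ = YY R θ2 p T (gc R θ2 p t + 1) ρ := fun ρ => by
        have := grd_YY R θ2 p ht ρ
        rw [h1, h2] at this; exact this
      simp_rw [h3, grd_YY R θ2 p (show t ≤ T by omega)] at h
      rw [h2, Finset.sum_range_succ]; push_cast
      linarith
    · have h1 : grd R θ2 p (t + 1) = grd R θ2 p t := by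
        simp only [grd, h, if_false]
      have h2 : gc R θ2 p (t + 1) = gc R θ2 p t := by unfold gc; rw [h1]
      rw [h2]; exact ih

end path

lemma cs_ww (R : Finset (GG M)) (f : GG M → ℝ) (x : GG M) :
    (∑ ρ ∈ R, f ρ * ww ρ x) ^ 2 ≤ R.card * ∑ ρ ∈ R, f ρ ^ 2 := by
  have := sq_sum_le_card_mul_sum_sq (s := R) (f := fun ρ => f ρ * ww ρ x)
  simpa only [mul_pow, ww_sq, mul_one] using this

lemma step_sum (R : Finset (GG M)) (θ2 : ℝ) (k0 T : ℕ) (d : ℕ → GG M → GG M → ℝ)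
    (hd : ∀ t < T, ∀ ρ, MD (k0 + t) (d t ρ)) (s J : ℕ) :
    ∑ x, ∑ j ∈ Finset.range J, ∑ ρ ∈ R, (YY R θ2 (fun t ρ => d t ρ x) T ((j + 1) * s) ρ -
      YY R θ2 (fun t ρ => d t ρ x) T (j * s) ρ) ^ 2 ≤
      ∑ x, ∑ t ∈ Finset.range T, ∑ ρ ∈ R, d t ρ x ^ 2 := by
  have hgc : ∀ t ≤ T, Dep (k0 + t) (fun x => gc R θ2 (fun t ρ => d t ρ x) t) := by
    intro t ht x y hxy
    simp only [gc]
    rw [grd_congr]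
    intro u hu; funext ρ
    exact (hd u (by omega) ρ).1 x y fun i hi => hxy i (by omega)
  set c : ℕ → GG M → ℕ := fun t x => gc R θ2 (fun t ρ => d t ρ x) t with hc
  have e1 : ∀ x j ρ, (YY R θ2 (fun t ρ => d t ρ x) T ((j + 1) * s) ρ -
      YY R θ2 (fun t ρ => d t ρ x) T (j * s) ρ) =
      ∑ t ∈ Finset.range T, (if c t x < (j + 1) * s ∧ j * s ≤ c t x then 1 else 0) * d t ρ x := by
    intro x j ρ
    unfold YY
    rw [← Finset.sum_sub_distrib]
    apply Finset.sum_congr rfl; intro t _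
    have hjs : j * s ≤ (j + 1) * s := Nat.mul_le_mul_right s (by omega)
    change (if c t x < (j + 1) * s then d t ρ x else 0) - (if c t x < j * s then d t ρ x else 0) = _
    by_cases h1 : c t x < j * s
    · rw [if_pos (by omega), if_pos h1, if_neg (by omega)]; ring
    · by_cases h2 : c t x < (j + 1) * s
      · rw [if_pos h2, if_neg h1, if_pos (by omega)]; ring
      · rw [if_neg h2, if_neg h1, if_neg (by omega)]; ring
  simp_rw [e1]
  calc _ = ∑ j ∈ Finset.range J, ∑ ρ ∈ R, ∑ x, (∑ t ∈ Finset.range T,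
        (if c t x < (j + 1) * s ∧ j * s ≤ c t x then 1 else 0) * d t ρ x) ^ 2 := by
        rw [Finset.sum_comm]; apply Finset.sum_congr rfl; intro j _; rw [Finset.sum_comm]
    _ = ∑ j ∈ Finset.range J, ∑ ρ ∈ R, ∑ t ∈ Finset.range T, ∑ x,
        ((if c t x < (j + 1) * s ∧ j * s ≤ c t x then 1 else 0) * d t ρ x) ^ 2 := by
        apply Finset.sum_congr rfl; intro j _; apply Finset.sum_congr rfl; intro ρ _
        apply mart_energy (k0 := k0)
        intro t ht
        exact MD.mul ((hgc t ht.le).comp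
          (fun n => if n < (j + 1) * s ∧ j * s ≤ n then (1 : ℝ) else 0)) (hd t ht ρ)
    _ = ∑ x, ∑ t ∈ Finset.range T, ∑ ρ ∈ R, ∑ j ∈ Finset.range J,
        ((if c t x < (j + 1) * s ∧ j * s ≤ c t x then 1 else 0) * d t ρ x) ^ 2 := by
        simp_rw [Finset.sum_comm (s := Finset.range T) (t := (Finset.univ : Finset (GG M)))]
        simp_rw [Finset.sum_comm (s := R) (t := (Finset.univ : Finset (GG M)))]
        rw [Finset.sum_comm]
        apply Finset.sum_congr rfl; intro x _
        rw [Finset.sum_comm]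
        simp_rw [Finset.sum_comm (s := Finset.range J) (t := Finset.range T)]
        rw [Finset.sum_comm]
    _ ≤ _ := by
        apply Finset.sum_le_sum; intro x _; apply Finset.sum_le_sum; intro t _
        apply Finset.sum_le_sum; intro ρ _
        simp_rw [mul_pow]
        rw [← Finset.sum_mul]
        have : ∑ j ∈ Finset.range J, (if c t x < (j + 1) * s ∧ j * s ≤ c t x then (1:ℝ) else 0) ^ 2
            ≤ 1 := by
          have e : ∀ j, (if c t x < (j + 1) * s ∧ j * s ≤ c t x then (1:ℝ) else 0) ^ 2 =
            if c t x < (j + 1) * s ∧ j * s ≤ c t x then (1:ℝ) else 0 := by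
              intro j; split_ifs <;> simp
          simp_rw [e]
          rw [← Finset.sum_filter, Finset.sum_const, nsmul_eq_mul, mul_one]
          norm_cast
          rw [Finset.card_le_one]
          intro i hi j hj
          simp only [Finset.mem_filter] at hi hj
          rcases lt_trichotomy i j with h | h | h
          · have := Nat.mul_le_mul_right s (show i + 1 ≤ j by omega); omega
          · exact h
          · have := Nat.mul_le_mul_right s (show j + 1 ≤ i by omega); omega
        nlinarith [sq_nonneg (d t ρ x)]

lemma S0 (R : Finset (GG M)) (k0 T L : ℕ)
    (hR : ∀ ρ ∈ R, ∀ ρ' ∈ R, ρ ≠ ρ' → ¬ agree (k0 + T) ρ ρ') (d : ℕ → GG M → GG M → ℝ)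
    (hd : ∀ t < T, ∀ ρ, MD (k0 + t) (d t ρ)) (θ2 : ℝ) (hθ : 0 < θ2) :
    ∃ Rf Q : GG M → ℝ, (∀ x, 0 ≤ Rf x) ∧ (∀ x, 0 ≤ Q x) ∧
      (∀ x, ∀ t ≤ T, (∑ ρ ∈ R, Fp (fun t ρ => d t ρ x) t ρ * ww ρ x) ^ 2 ≤
        2 * R.card * θ2 + 2 * Rf x +
          R.card * (∑ ρ ∈ R, Fp (fun t ρ => d t ρ x) t ρ ^ 2) / (2 ^ L * θ2) * Q x) ∧
      ∑ x, Rf x ≤ (L + 1 : ℝ) ^ 2 * ∑ x, ∑ t ∈ Finset.range T, ∑ ρ ∈ R, d t ρ x ^ 2 ∧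
      ∑ x, Q x ≤ ∑ x, ∑ t ∈ Finset.range T, ∑ ρ ∈ R, d t ρ x ^ 2 := by
  set p : GG M → ℕ → GG M → ℝ := fun x t ρ => d t ρ x with hp
  set E := ∑ x, ∑ t ∈ Finset.range T, ∑ ρ ∈ R, d t ρ x ^ 2 with hE
  set X : GG M → ℕ → ℝ := fun x b => ∑ ρ ∈ R, YY R θ2 (p x) T b ρ * ww ρ x with hX
  refine ⟨fun x => (L + 1 : ℝ) * ∑ l ∈ Finset.range (L + 1),
      ∑ j ∈ Finset.range (2 ^ (L - l)), (X x ((j + 1) * 2 ^ l) - X x (j * 2 ^ l)) ^ 2,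
    fun x => ∑ b ∈ Finset.range T, ∑ ρ ∈ R, (YY R θ2 (p x) T ((b + 1) * 1) ρ -
      YY R θ2 (p x) T (b * 1) ρ) ^ 2, ?_, ?_, ?_, ?_, ?_⟩
  · intro x; positivity
  · intro x; positivity
  · intro x t ht
    have hR0 : 0 ≤ (L + 1 : ℝ) * ∑ l ∈ Finset.range (L + 1),
      ∑ j ∈ Finset.range (2 ^ (L - l)), (X x ((j + 1) * 2 ^ l) - X x (j * 2 ^ l)) ^ 2 := by positivity
    have hQ : θ2 * gc R θ2 (p x) t ≤ ∑ b ∈ Finset.range T, ∑ ρ ∈ R,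
        (YY R θ2 (p x) T ((b + 1) * 1) ρ - YY R θ2 (p x) T (b * 1) ρ) ^ 2 := by
      simp only [mul_one]
      refine (gc_count R θ2 (p x) ht).trans ?_
      apply Finset.sum_le_sum_of_subset_of_nonneg
      · exact Finset.range_mono ((gc_le _ _ _ _).trans ht)
      · intros; positivity
    set Q := ∑ b ∈ Finset.range T, ∑ ρ ∈ R,
        (YY R θ2 (p x) T ((b + 1) * 1) ρ - YY R θ2 (p x) T (b * 1) ρ) ^ 2
    have hQ0 : 0 ≤ Q := by positivity
    have hF0 : 0 ≤ ∑ ρ ∈ R, Fp (p x) t ρ ^ 2 := by positivity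
    rcases Nat.lt_or_ge (2 ^ L) (gc R θ2 (p x) t) with hc | hc
    · have h1 := cs_ww R (Fp (p x) t) x
      have h2 : 1 ≤ Q / (2 ^ L * θ2) := by
        rw [le_div_iff₀ (by positivity)]
        have : ((2 : ℝ) ^ L) ≤ gc R θ2 (p x) t := by exact_mod_cast hc.le
        nlinarith
      have h3 : (R.card : ℝ) * (∑ ρ ∈ R, Fp (p x) t ρ ^ 2) / (2 ^ L * θ2) * Q =
        R.card * (∑ ρ ∈ R, Fp (p x) t ρ ^ 2) * (Q / (2 ^ L * θ2)) := by ring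
      rw [h3]
      have h4 : 0 ≤ (R.card : ℝ) * (∑ ρ ∈ R, Fp (p x) t ρ ^ 2) := by positivity
      have h5 := mul_le_mul_of_nonneg_left h2 h4
      have h6 : 0 ≤ 2 * (R.card : ℝ) * θ2 := by positivity
      linarith
    · have h1 := rm_sq L (X x) _ hc
      have h0 : X x 0 = 0 := by simp [hX, YY]
      rw [h0, sub_zero] at h1
      have h2 : ∑ ρ ∈ R, Fp (p x) t ρ * ww ρ x =
          ∑ ρ ∈ R, (Fp (p x) t ρ - (grd R θ2 (p x) t).1 ρ) * ww ρ x + X x (gc R θ2 (p x) t) := by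
        simp only [hX]
        rw [← Finset.sum_add_distrib]; apply Finset.sum_congr rfl; intro ρ _
        rw [grd_YY R θ2 (p x) ht]; ring
      have h3 := cs_ww R (fun ρ => Fp (p x) t ρ - (grd R θ2 (p x) t).1 ρ) x
      have h4 := grd_close R θ2 (p x) hθ.le t
      have h5 : (R.card : ℝ) * ∑ ρ ∈ R, (Fp (p x) t ρ - (grd R θ2 (p x) t).1 ρ) ^ 2 ≤ R.card * θ2 :=
        mul_le_mul_of_nonneg_left h4 (by positivity)
      rw [h2]
      have h6 : 0 ≤ (R.card : ℝ) * (∑ ρ ∈ R, Fp (p x) t ρ ^ 2) / (2 ^ L * θ2) * Q := by positivity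
      have h7 := add_sq_le (a := ∑ ρ ∈ R, (Fp (p x) t ρ - (grd R θ2 (p x) t).1 ρ) * ww ρ x)
        (b := X x (gc R θ2 (p x) t))
      linarith
  · rw [← Finset.mul_sum, sq, mul_assoc]
    apply mul_le_mul_of_nonneg_left _ (by positivity)
    rw [Finset.sum_comm]
    have : (L + 1 : ℝ) * E = ∑ l ∈ Finset.range (L + 1), E := by simp
    rw [this]
    apply Finset.sum_le_sum
    intro l _
    refine le_trans (le_of_eq ?_) (step_sum R θ2 k0 T d hd (2 ^ l) (2 ^ (L - l)))
    rw [Finset.sum_comm]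
    rw [Finset.sum_comm (s := Finset.univ)]
    apply Finset.sum_congr rfl
    intro j _
    have hY : ∀ b ρ, Dep (k0 + T) (fun x => YY R θ2 (p x) T b ρ) := by
      intro b ρ x y hxy
      have h1 : ∀ u < T, p x u = p y u := by
        intro u hu; funext ρ
        exact (hd u hu ρ).1 x y fun i hi => hxy i (by omega)
      simp only [YY]
      apply Finset.sum_congr rfl; intro u hu
      have hu' := Finset.mem_range.mp hu
      rw [h1 u hu']
      have h2 : gc R θ2 (p x) u = gc R θ2 (p y) u := by
        unfold gc
        rw [grd_congr R θ2 (p x) (p y) u (fun v hv => h1 v (by omega))]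
      rw [h2]
    rw [← vec_orth R hR (fun ρ x => YY R θ2 (p x) T ((j + 1) * 2 ^ l) ρ - YY R θ2 (p x) T (j * 2 ^ l) ρ)
      (fun ρ _ => (hY _ ρ).comp2 (hY _ ρ) (fun a b => a - b))]
    apply Finset.sum_congr rfl; intro x _
    simp only [hX]
    rw [← Finset.sum_sub_distrib]; congr 1
    apply Finset.sum_congr rfl; intros; ring
  · exact step_sum R θ2 k0 T d hd 1 T

end HI

namespace HI
variable {M : ℕ}

def lev (κ2 v : ℝ) : ℕ := sInf {l : ℕ | v ≤ κ2 * 4 ^ l}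

lemma lev_ne {κ2 : ℝ} (h : 0 < κ2) (v : ℝ) : {l : ℕ | v ≤ κ2 * 4 ^ l}.Nonempty := by
  obtain ⟨n, hn⟩ := pow_unbounded_of_one_lt (v / κ2) (show (1:ℝ) < 4 by norm_num)
  refine ⟨n, ?_⟩
  rw [div_lt_iff₀ h] at hn
  simp only [Set.mem_ofPred_eq]; linarith

lemma le_lev {κ2 : ℝ} (h : 0 < κ2) (v : ℝ) : v ≤ κ2 * 4 ^ lev κ2 v := Nat.sInf_mem (lev_ne h v)

lemma lev_zero {κ2 : ℝ} (h : 0 < κ2) : lev κ2 0 = 0 := by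
  have : lev κ2 0 ≤ 0 := Nat.sInf_le (by simp; exact h.le)
  omega

lemma lev_lt {κ2 : ℝ} (h : 0 < κ2) {v : ℝ} (hv : 0 ≤ v) : κ2 * 4 ^ lev κ2 v ≤ κ2 + 4 * v := by
  rcases Nat.eq_zero_or_pos (lev κ2 v) with h1 | h1
  · rw [h1]; simp; exact hv
  · have h2 : lev κ2 v - 1 ∉ {l : ℕ | v ≤ κ2 * 4 ^ l} := Nat.notMem_of_lt_sInf (by
      change _ < lev κ2 v; omega)
    simp only [Set.mem_ofPred_eq, not_le] at h2
    have : (4:ℝ) ^ lev κ2 v = 4 * 4 ^ (lev κ2 v - 1) := by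
      rw [← pow_succ']; congr 1; omega
    rw [this]; linarith

def lam (κ2 : ℝ) (v : ℕ → ℝ) : ℕ → ℕ
  | 0 => lev κ2 (v 0)
  | t + 1 => max (lam κ2 v t) (lev κ2 (v (t + 1)))

lemma lam_mono (κ2 : ℝ) (v : ℕ → ℝ) : Monotone (lam κ2 v) :=
  monotone_nat_of_le_succ fun _ => le_max_left _ _

lemma le_lam {κ2 : ℝ} (h : 0 < κ2) (v : ℕ → ℝ) (t : ℕ) : v t ≤ κ2 * 4 ^ lam κ2 v t := by
  refine (le_lev h (v t)).trans ?_
  apply mul_le_mul_of_nonneg_left _ h.le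
  apply pow_le_pow_right₀ (by norm_num)
  cases t with
  | zero => exact le_rfl
  | succ t => exact le_max_right _ _

lemma lam_le {κ2 : ℝ} (h : 0 < κ2) (v : ℕ → ℝ) (m : ℝ) (t : ℕ) (hv : ∀ u, 0 ≤ v u)
    (hm : ∀ u ≤ t, v u ≤ m) : κ2 * 4 ^ lam κ2 v t ≤ κ2 + 4 * m := by
  induction t with
  | zero => exact (lev_lt h (hv 0)).trans (by linarith [hm 0 le_rfl])
  | succ t ih =>
    simp only [lam]
    rcases le_total (lam κ2 v t) (lev κ2 (v (t + 1))) with h1 | h1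
    · rw [max_eq_right h1]; exact (lev_lt h (hv _)).trans (by linarith [hm (t + 1) le_rfl])
    · rw [max_eq_left h1]; exact ih fun u hu => hm u (by omega)

lemma lam_congr (κ2 : ℝ) (v v' : ℕ → ℝ) (t : ℕ) (h : ∀ u ≤ t, v u = v' u) :
    lam κ2 v t = lam κ2 v' t := by
  induction t with
  | zero => simp [lam, h 0 le_rfl]
  | succ t ih => simp only [lam]; rw [ih fun u hu => h u (by omega), h (t + 1) le_rfl]

lemma lam_jump_sum (lm : ℕ → ℕ) (hm : Monotone lm) (t : ℕ) :
    ∑ u ∈ Finset.range t, (if lm (u + 1) ≠ lm u then (4:ℝ) ^ lm (u + 1) else 0) ≤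
      4 / 3 * 4 ^ lm t := by
  induction t with
  | zero => simp
  | succ t ih =>
    rw [Finset.sum_range_succ]
    split_ifs with h
    · have h1 : lm t + 1 ≤ lm (t + 1) := by have := hm (Nat.le_succ t); simp at this; omega
      have h2 : (4:ℝ) ^ (lm t + 1) ≤ 4 ^ lm (t + 1) := pow_le_pow_right₀ (by norm_num) h1
      rw [pow_succ] at h2
      linarith
    · push Not at h
      rw [h]; linarith

lemma block (lm : ℕ → ℕ) (hm : Monotone lm) (p : ℕ → GG M → ℝ) (t : ℕ) :
    ∃ σ ≤ t, lm σ = lm t ∧ (∀ ρ, Fp p t ρ = Fp p σ ρ +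
      Fp (fun u ρ => (if lm u = lm t then 1 else 0) * p u ρ) t ρ) ∧
      (σ = 0 ∨ ∃ u, σ = u + 1 ∧ lm (u + 1) ≠ lm u) := by
  induction t with
  | zero => exact ⟨0, le_rfl, rfl, fun ρ => by simp [Fp], Or.inl rfl⟩
  | succ t ih =>
    by_cases h : lm (t + 1) = lm t
    · obtain ⟨σ, h1, h2, h3, h4⟩ := ih
      refine ⟨σ, by omega, by omega, fun ρ => ?_, h4⟩
      have := h3 ρ
      unfold Fp at *
      rw [Finset.sum_range_succ, Finset.sum_range_succ, h]
      simp only [if_true, one_mul]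
      linarith
    · refine ⟨t + 1, le_rfl, rfl, fun ρ => ?_, Or.inr ⟨t, rfl, h⟩⟩
      have : Fp (fun u ρ => (if lm u = lm (t + 1) then 1 else 0) * p u ρ) (t + 1) ρ = 0 := by
        unfold Fp
        apply Finset.sum_eq_zero; intro u hu
        have hu' := Finset.mem_range.mp hu
        have h1 := hm (show u ≤ t by omega)
        have h2 := hm (Nat.le_succ t)
        simp only [Nat.succ_eq_add_one] at h2
        change (if lm u = lm (t + 1) then (1:ℝ) else 0) * p u ρ = 0
        rw [if_neg (by omega), zero_mul]
      rw [this, add_zero]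

lemma lemS (R : Finset (GG M)) (k0 T L : ℕ) (hL : R.card ^ 2 ≤ 2 ^ L)
    (hR : ∀ ρ ∈ R, ∀ ρ' ∈ R, ρ ≠ ρ' → ¬ agree (k0 + T) ρ ρ') 
    (d : ℕ → GG M → GG M → ℝ)
    (hd : ∀ t < T, ∀ ρ, MD (k0 + t) (d t ρ)) :
    ∃ Mx : GG M → ℝ, 
      (∀ x, ∀ t ≤ T, (∑ ρ ∈ R, Fp (fun t ρ => d t ρ x) t ρ * ww ρ x) ^ 2 ≤ Mx x) ∧
      ∑ x, Mx x ≤ 131 * (L + 1 : ℝ) ^ 2 * ∑ x, ∑ ρ ∈ R, Fp (fun t ρ => d t ρ x) T ρ ^ 2 := by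
  have hR' : ∀ t ≤ T, ∀ ρ ∈ R, ∀ ρ' ∈ R, ρ ≠ ρ' → ¬ agree (k0 + t) ρ ρ' := fun t ht ρ h1 ρ' h2 h3 h4 =>
    hR ρ h1 ρ' h2 h3 (h4.mono (by omega))
  set p : GG M → ℕ → GG M → ℝ := fun x t ρ => d t ρ x with hp
  set S := ∑ x, ∑ ρ ∈ R, Fp (p x) T ρ ^ 2 with hS
  have hS0 : 0 ≤ S := by positivity
  have hE : ∑ x, ∑ t ∈ Finset.range T, ∑ ρ ∈ R, d t ρ x ^ 2 = S := by
    rw [hS, Finset.sum_comm]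
    simp_rw [Finset.sum_comm (s := Finset.univ) (t := R)]
    rw [Finset.sum_comm]
    apply Finset.sum_congr rfl; intro ρ _
    exact (mart_energy (k0 := k0) (d := fun t => d t ρ) fun t ht => hd t ht ρ).symm
  rcases hS0.eq_or_lt with hz | hpos
  · refine ⟨fun _ => 0, fun x t ht => ?_, by rw [← hz]; simp⟩
    have h1 : ∀ ρ ∈ R, ∀ u < T, d u ρ x = 0 := by
      intro ρ hρ u hu
      rw [← hz] at hE
      have h1 := (Finset.sum_eq_zero_iff_of_nonneg (fun x _ => by positivity)).mp hE x
        (Finset.mem_univ x)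
      have h2 := (Finset.sum_eq_zero_iff_of_nonneg (fun x _ => by positivity)).mp h1 u
        (Finset.mem_range.mpr hu)
      have h3 := (Finset.sum_eq_zero_iff_of_nonneg (fun x _ => by positivity)).mp h2 ρ hρ
      simpa using h3
    rw [Finset.sum_eq_zero]
    · simp
    · intro ρ hρ
      have : Fp (p x) t ρ = 0 := Finset.sum_eq_zero fun u hu =>
        h1 ρ hρ u (by have := Finset.mem_range.mp hu; omega)
      rw [this, zero_mul]
  have hRne : 0 < R.card := by
    rw [Finset.card_pos]
    by_contra h
    rw [Finset.not_nonempty_iff_eq_empty] at h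
    rw [hS, h] at hpos; simp at hpos
  set κ2 : ℝ := S / 2 ^ M with hκ
  have hκ0 : 0 < κ2 := by positivity
  set lm : GG M → ℕ → ℕ := fun x => lam κ2 (fun t => ∑ ρ ∈ R, Fp (p x) t ρ ^ 2) with hlm
  have hmono : ∀ x, Monotone (lm x) := fun x => lam_mono _ _
  have hFdep : ∀ ρ t, t ≤ T → Dep (k0 + t) (fun x => Fp (p x) t ρ) := by
    intro ρ t ht
    apply Dep.sum
    intro u hu
    have := Finset.mem_range.mp hu
    exact (hd u (by omega) ρ).1.mono (by omega)
  have hldep : ∀ t ≤ T, Dep (k0 + t) (fun x => lm x t) := by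
    intro t ht x y hxy
    simp only [hlm]
    apply lam_congr
    intro u hu
    apply Finset.sum_congr rfl; intro ρ _
    have h9 : Fp (p x) u ρ = Fp (p y) u ρ :=
      ((hFdep ρ u (by omega)).mono (show k0 + u ≤ k0 + t by omega)) x y hxy
    rw [h9]
  set dl : ℕ → ℕ → GG M → GG M → ℝ := fun l t ρ x => (if lm x t = l then 1 else 0) * d t ρ x with hdl
  have hdlMD : ∀ l, ∀ t < T, ∀ ρ, MD (k0 + t) (dl l t ρ) := fun l t ht ρ =>
    MD.mul ((hldep t ht.le).comp (fun n => if n = l then (1:ℝ) else 0)) (hd t ht ρ)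
  have hS0' := fun l : ℕ => S0 R k0 T L hR (dl l) (hdlMD l) (κ2 * 4 ^ l / R.card) (by positivity)
  choose Rf Q hRf hQ hW hRs hQs using hS0'
  set Λ := Finset.univ.sup (fun x => lm x T) with hΛ
  have hΛ' : ∀ x, ∀ t ≤ T, lm x t ≤ Λ := fun x t ht =>
    (hmono x ht).trans (Finset.le_sup (f := fun x => lm x T) (Finset.mem_univ x))
  set Z : GG M → ℝ := fun x => ∑ u ∈ Finset.range T,
    (if lm x (u + 1) ≠ lm x u then (∑ ρ ∈ R, Fp (p x) (u + 1) ρ * ww ρ x) ^ 2 else 0) with hZ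
  refine ⟨fun x => 2 * Z x + 4 * (κ2 * 4 ^ lm x T) + 4 * ∑ l ∈ Finset.range (Λ + 1), Rf l x +
    8 * ∑ l ∈ Finset.range (Λ + 1), Q l x, fun x t ht => ?_, ?_⟩
  · obtain ⟨σ, h1, h2, h3, h4⟩ := block (lm x) (hmono x) (p x) t
    set l := lm x t with hl
    have hF2 : ∀ u, ∑ ρ ∈ R, Fp (p x) u ρ ^ 2 ≤ κ2 * 4 ^ lm x u := fun u =>
      le_lam hκ0 (fun t => ∑ ρ ∈ R, Fp (p x) t ρ ^ 2) u
    have e1 : ∀ ρ, Fp (fun t ρ => dl l t ρ x) t ρ = Fp (p x) t ρ - Fp (p x) σ ρ := by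
      intro ρ; have := h3 ρ
      have h5 : Fp (fun t ρ => dl l t ρ x) t ρ =
        Fp (fun u ρ => (if lm x u = l then 1 else 0) * p x u ρ) t ρ := rfl
      linarith
    have h5 : ∑ ρ ∈ R, Fp (fun t ρ => dl l t ρ x) t ρ ^ 2 ≤ 4 * (κ2 * 4 ^ l) := by
      simp_rw [e1]
      have := hF2 t
      have h6 := hF2 σ
      rw [h2] at h6
      have h7 : ∑ ρ ∈ R, (Fp (p x) t ρ - Fp (p x) σ ρ) ^ 2 ≤
          ∑ ρ ∈ R, (2 * Fp (p x) t ρ ^ 2 + 2 * Fp (p x) σ ρ ^ 2) :=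
        Finset.sum_le_sum fun ρ _ => by nlinarith [sq_nonneg (Fp (p x) t ρ + Fp (p x) σ ρ)]
      rw [Finset.sum_add_distrib, ← Finset.mul_sum, ← Finset.mul_sum] at h7
      linarith
    have h6 := hW l x t ht
    have hcard : (0:ℝ) < R.card := by exact_mod_cast hRne
    have h4l : (0:ℝ) < κ2 * 4 ^ l := by positivity
    have h7 : 2 * (R.card : ℝ) * (κ2 * 4 ^ l / R.card) = 2 * (κ2 * 4 ^ l) := by
      rw [mul_assoc, mul_div_cancel₀ _ hcard.ne']
    have h8 : (R.card : ℝ) * (∑ ρ ∈ R, Fp (fun t ρ => dl l t ρ x) t ρ ^ 2) /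
        (2 ^ L * (κ2 * 4 ^ l / R.card)) ≤ 4 := by
      have hden : 0 < 2 ^ L * (κ2 * 4 ^ l / R.card) :=
        mul_pos (by positivity) (div_pos h4l hcard)
      rw [div_le_iff₀ hden]
      have h9 : ((R.card : ℝ)) ^ 2 ≤ 2 ^ L := by exact_mod_cast hL
      have h10 : 4 * (2 ^ L * (κ2 * 4 ^ l / R.card)) = 4 * 2 ^ L * (κ2 * 4 ^ l) / R.card := by ring
      rw [h10, le_div_iff₀ hcard]
      calc _ = (R.card : ℝ) ^ 2 * (∑ ρ ∈ R, Fp (fun t ρ => dl l t ρ x) t ρ ^ 2) := by ring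
        _ ≤ 2 ^ L * (4 * (κ2 * 4 ^ l)) := mul_le_mul h9 h5 (by positivity) (by positivity)
        _ = _ := by ring
    have h9 := mul_le_mul_of_nonneg_right h8 (hQ l x)
    have hlΛ : l ∈ Finset.range (Λ + 1) := by
      have := hΛ' x t ht; simp only [Finset.mem_range]; omega
    have h10 : Rf l x ≤ ∑ l ∈ Finset.range (Λ + 1), Rf l x :=
      Finset.single_le_sum (f := fun l => Rf l x) (fun l _ => hRf l x) hlΛ
    have h11 : Q l x ≤ ∑ l ∈ Finset.range (Λ + 1), Q l x :=
      Finset.single_le_sum (f := fun l => Q l x) (fun l _ => hQ l x) hlΛ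
    have h12 : (4:ℝ) ^ l ≤ 4 ^ lm x T := pow_le_pow_right₀ (by norm_num) (hmono x ht)
    have h13 := mul_le_mul_of_nonneg_left h12 hκ0.le
    have h14 : (∑ ρ ∈ R, Fp (p x) σ ρ * ww ρ x) ^ 2 ≤ Z x := by
      have hnn : ∀ u ∈ Finset.range T, 0 ≤ (if lm x (u + 1) ≠ lm x u then
        (∑ ρ ∈ R, Fp (p x) (u + 1) ρ * ww ρ x) ^ 2 else 0) := by
          intro u _; split_ifs <;> positivity
      rcases h4 with rfl | ⟨u, rfl, hu⟩
      · simp only [Fp, Finset.range_zero, Finset.sum_empty, zero_mul, Finset.sum_const_zero]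
        norm_num
        exact Finset.sum_nonneg hnn
      · have := Finset.single_le_sum hnn (a := u) (by simp only [Finset.mem_range]; omega)
        rw [if_pos hu] at this
        exact this
    have h15 : ∑ ρ ∈ R, Fp (p x) t ρ * ww ρ x = ∑ ρ ∈ R, Fp (p x) σ ρ * ww ρ x +
        ∑ ρ ∈ R, Fp (fun t ρ => dl l t ρ x) t ρ * ww ρ x := by
      rw [← Finset.sum_add_distrib]; apply Finset.sum_congr rfl; intro ρ _
      rw [e1]; ring
    have h16 := add_sq_le (a := ∑ ρ ∈ R, Fp (p x) σ ρ * ww ρ x)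
      (b := ∑ ρ ∈ R, Fp (fun t ρ => dl l t ρ x) t ρ * ww ρ x)
    rw [← h15] at h16
    linarith
  · have hP : ∑ x, κ2 * 4 ^ lm x T ≤ 17 * S := by
      have h1 : ∀ x, κ2 * 4 ^ lm x T ≤ κ2 + 4 * ∑ ρ ∈ R, rmax (fun t => Fp (p x) t ρ) T ^ 2 := by
        intro x
        apply lam_le hκ0
        · intro u; positivity
        · intro u hu
          apply Finset.sum_le_sum; intro ρ _
          rw [← sq_abs]
          exact pow_le_pow_left₀ (abs_nonneg _) (abs_le_rmax (fun t => Fp (p x) t ρ) hu) 2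
      refine (Finset.sum_le_sum fun x _ => h1 x).trans ?_
      rw [Finset.sum_add_distrib, ← Finset.mul_sum]
      have h2 : ∑ x : GG M, κ2 = S := by
        rw [Finset.sum_const, nsmul_eq_mul, Finset.card_univ, card_GG, hκ]; field_simp
      have h3 : ∑ x, ∑ ρ ∈ R, rmax (fun t => Fp (p x) t ρ) T ^ 2 ≤ 4 * S := by
        rw [hS, Finset.sum_comm, Finset.sum_comm (s := Finset.univ), Finset.mul_sum]
        apply Finset.sum_le_sum; intro ρ _
        apply doob (k0 := k0) (S := fun t x => Fp (p x) t ρ)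
        · intro x y _; simp [Fp]
        · intro t ht
          have : (fun x => Fp (p x) (t + 1) ρ - Fp (p x) t ρ) = d t ρ := by
            funext x; simp [Fp, Finset.sum_range_succ, hp]
          simp only [this]; exact hd t ht ρ
      linarith
    have hZs : ∑ x, Z x ≤ 4 / 3 * (17 * S) := by
      have h1 : ∑ x, Z x ≤ ∑ x, ∑ u ∈ Finset.range T,
          κ2 * (if lm x (u + 1) ≠ lm x u then (4:ℝ) ^ lm x (u + 1) else 0) := by
        simp only [hZ]
        rw [Finset.sum_comm, Finset.sum_comm (s := Finset.univ)]
        apply Finset.sum_le_sum; intro u hu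
        have hu' := Finset.mem_range.mp hu
        have hdep : Dep (k0 + (u + 1)) (fun x => if lm x (u + 1) ≠ lm x u then (1:ℝ) else 0) :=
          (hldep (u + 1) hu').comp2 ((hldep u hu'.le).mono (by omega))
            (fun a b => if a ≠ b then (1:ℝ) else 0)
        have h2 := vec_orth R (hR' (u + 1) hu')
          (fun ρ x => (if lm x (u + 1) ≠ lm x u then (1:ℝ) else 0) * Fp (p x) (u + 1) ρ)
          (fun ρ _ => hdep.comp2 (hFdep ρ (u + 1) hu') (fun a b => a * b))
        have h3 : ∑ x, (if lm x (u + 1) ≠ lm x u then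
            (∑ ρ ∈ R, Fp (p x) (u + 1) ρ * ww ρ x) ^ 2 else 0) =
            ∑ x, (∑ ρ ∈ R, (if lm x (u + 1) ≠ lm x u then (1:ℝ) else 0) * Fp (p x) (u + 1) ρ *
              ww ρ x) ^ 2 := by
          apply Finset.sum_congr rfl; intro x _
          split_ifs <;> simp
        rw [h3, h2]
        apply Finset.sum_le_sum; intro x _
        split_ifs
        · simp only [one_mul]
          exact le_lam hκ0 (fun t => ∑ ρ ∈ R, Fp (p x) t ρ ^ 2) (u + 1)
        · simp
      refine h1.trans (le_trans (Finset.sum_le_sum fun x _ => ?_)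
        (b := ∑ x, 4 / 3 * (κ2 * 4 ^ lm x T)) ?_)
      · rw [← Finset.mul_sum]
        have := mul_le_mul_of_nonneg_left (lam_jump_sum (lm x) (hmono x) T) hκ0.le
        linarith
      · rw [← Finset.mul_sum]; linarith
    have hEl : ∑ l ∈ Finset.range (Λ + 1), ∑ x, ∑ t ∈ Finset.range T, ∑ ρ ∈ R, dl l t ρ x ^ 2 = S := by
      rw [← hE, Finset.sum_comm]
      apply Finset.sum_congr rfl; intro x _
      rw [Finset.sum_comm]
      apply Finset.sum_congr rfl; intro t ht
      have ht' := Finset.mem_range.mp ht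
      rw [Finset.sum_comm]
      apply Finset.sum_congr rfl; intro ρ _
      rw [Finset.sum_eq_single (lm x t)]
      · simp [hdl]
      · intro l _ hne; simp only [hdl]; rw [if_neg (Ne.symm hne)]; simp
      · intro h; exact absurd (by have := hΛ' x t ht'.le; simp only [Finset.mem_range]; omega) h
    have hRsum : ∑ x, ∑ l ∈ Finset.range (Λ + 1), Rf l x ≤ (L + 1 : ℝ) ^ 2 * S := by
      rw [Finset.sum_comm, ← hEl, Finset.mul_sum]
      exact Finset.sum_le_sum fun l _ => hRs l
    have hQsum : ∑ x, ∑ l ∈ Finset.range (Λ + 1), Q l x ≤ S := by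
      rw [Finset.sum_comm, ← hEl]
      exact Finset.sum_le_sum fun l _ => hQs l
    simp only [Finset.sum_add_distrib, ← Finset.mul_sum]
    have hL1 : (1:ℝ) ≤ (L + 1 : ℝ) ^ 2 := by
      have : (0:ℝ) ≤ L := by positivity
      nlinarith
    have h1 := mul_le_mul_of_nonneg_right hL1 hS0
    have h2 : ∑ x, κ2 * 4 ^ lm x T = κ2 * ∑ x, (4:ℝ) ^ lm x T := by rw [Finset.mul_sum]
    rw [h2] at hP
    nlinarith

end HI

namespace HI
variable {M : ℕ}

/-- Size of the class of `ξ` in `X` at scale `k`. -/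
def nn (X : Finset (GG M)) (k : ℕ) (ξ : GG M) : ℕ := (X.filter (fun ξ' => agree k ξ ξ')).card

lemma nn_mono (X : Finset (GG M)) (ξ : GG M) {k k' : ℕ} (h : k ≤ k') : nn X k ξ ≤ nn X k' ξ := by
  apply Finset.card_le_card
  intro y hy
  simp only [Finset.mem_filter] at *
  exact ⟨hy.1, hy.2.mono h⟩

lemma nn_pos {X : Finset (GG M)} {ξ : GG M} (h : ξ ∈ X) (k : ℕ) : 1 ≤ nn X k ξ := by
  apply Finset.card_pos.mpr
  exact ⟨ξ, by simp [h, agree_refl]⟩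

lemma nn_le (X : Finset (GG M)) (ξ : GG M) (k : ℕ) : nn X k ξ ≤ X.card :=
  Finset.card_filter_le _ _

def k1 (X : Finset (GG M)) (ξ : GG M) (d : ℕ) : ℕ :=
  ((Finset.range (M + 1)).filter (fun k => Nat.log 2 (nn X k ξ) = d)).sup id

def ex1 (X : Finset (GG M)) (ξ : GG M) (d : ℕ) : Prop :=
  ((Finset.range (M + 1)).filter (fun k => Nat.log 2 (nn X k ξ) = d)).Nonempty

lemma k1_spec {X : Finset (GG M)} {ξ : GG M} {d : ℕ} (h : ex1 X ξ d) :
    k1 X ξ d ≤ M ∧ Nat.log 2 (nn X (k1 X ξ d) ξ) = d := by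
  obtain ⟨k, hk, he⟩ := Finset.exists_mem_eq_sup _ h id
  have : k1 X ξ d = k := he
  rw [this]
  simp only [Finset.mem_filter, Finset.mem_range] at hk
  exact ⟨by omega, hk.2⟩

lemma le_k1 {X : Finset (GG M)} {ξ : GG M} {k : ℕ} (hk : k ≤ M) :
    ex1 X ξ (Nat.log 2 (nn X k ξ)) ∧ k ≤ k1 X ξ (Nat.log 2 (nn X k ξ)) := by
  have : k ∈ (Finset.range (M + 1)).filter
      (fun k' => Nat.log 2 (nn X k' ξ) = Nat.log 2 (nn X k ξ)) := by
    simp; omega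
  exact ⟨⟨k, this⟩, Finset.le_sup (f := id) this⟩

lemma class_count (X : Finset (GG M)) (η : GG M) (d : ℕ) :
    (X.filter (fun ξ => ex1 X ξ d ∧ agree (k1 X ξ d) η ξ)).card ≤ 2 ^ (d + 1) := by
  set s := X.filter (fun ξ => ex1 X ξ d ∧ agree (k1 X ξ d) η ξ) with hs
  rcases s.eq_empty_or_nonempty with h | h
  · rw [h]; simp
  · obtain ⟨z, hz, hmax⟩ := Finset.exists_max_image s (fun ξ => k1 X ξ d) h
    have hz' := (Finset.mem_filter.mp hz).2
    have h1 : s.card ≤ nn X (k1 X z d) z := by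
      apply Finset.card_le_card
      intro ξ hξ
      have h2 := hmax ξ hξ
      have h3 := Finset.mem_filter.mp hξ
      simp only [Finset.mem_filter]
      exact ⟨h3.1, hz'.2.symm.trans (h3.2.2.mono h2)⟩
    have h2 := (k1_spec hz'.1).2
    have h3 := Nat.lt_pow_succ_log_self (b := 2) (by norm_num) (nn X (k1 X z d) z)
    rw [h2] at h3
    simp only [Nat.succ_eq_add_one] at h3
    omega

lemma classMax (X : Finset (GG M)) (L0 : ℕ) (hL : X.card ≤ 2 ^ L0) (φ : GG M → ℝ) :
    ∃ A : GG M → ℝ, (∀ x, ∀ k ≤ M, ∑ ξ ∈ X, (1 / (nn X k ξ : ℝ)) * PP φ ξ k x ^ 2 ≤ A x) ∧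
      ∑ x, A x ≤ 8 * (L0 + 1 : ℝ) * 2 ^ M * ∑ η, φ η ^ 2 := by
  refine ⟨fun x => ∑ ξ ∈ X, ∑ d ∈ Finset.range (L0 + 1), if ex1 X ξ d then
    (1 / (2:ℝ) ^ d) * rmax (fun t => FF φ ξ t x) (k1 X ξ d) ^ 2 else 0, ?_, ?_⟩
  · intro x k hk
    apply Finset.sum_le_sum
    intro ξ hξ
    obtain ⟨h1, h2⟩ := le_k1 (X := X) (ξ := ξ) hk
    set d := Nat.log 2 (nn X k ξ) with hd
    have hd' : d ∈ Finset.range (L0 + 1) := by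
      have : d ≤ Nat.log 2 (2 ^ L0) := Nat.log_mono_right ((nn_le X ξ k).trans hL)
      rw [Nat.log_pow (by norm_num)] at this
      simp only [Finset.mem_range]; omega
    have h3 := Finset.single_le_sum (f := fun d => if ex1 X ξ d then
      (1 / (2:ℝ) ^ d) * rmax (fun t => FF φ ξ t x) (k1 X ξ d) ^ 2 else 0)
      (fun d _ => by split_ifs <;> positivity) hd'
    refine le_trans ?_ h3
    simp only [h1, if_true]
    have h4 : (2:ℝ) ^ d ≤ nn X k ξ := by
      exact_mod_cast Nat.pow_log_le_self 2 (by have := nn_pos hξ k; omega)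
    have h5 : (1 / (nn X k ξ : ℝ)) ≤ 1 / 2 ^ d := one_div_le_one_div_of_le (by positivity) h4
    have h6 : PP φ ξ k x ^ 2 ≤ rmax (fun t => FF φ ξ t x) (k1 X ξ d) ^ 2 := by
      rw [PP_sq, ← sq_abs]
      exact pow_le_pow_left₀ (abs_nonneg _) (abs_le_rmax (fun t => FF φ ξ t x) h2) 2
    exact mul_le_mul h5 h6 (by positivity) (by positivity)
  · have h1 : ∀ ξ ∈ X, ∀ d ∈ Finset.range (L0 + 1), ∑ x, (if ex1 X ξ d then
        (1 / (2:ℝ) ^ d) * rmax (fun t => FF φ ξ t x) (k1 X ξ d) ^ 2 else 0) ≤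
        ∑ η, 4 * 2 ^ M * φ η ^ 2 * ((1 / (2:ℝ) ^ d) *
          (if ex1 X ξ d ∧ agree (k1 X ξ d) η ξ then 1 else 0)) := by
      intro ξ _ d _
      by_cases h : ex1 X ξ d
      · simp only [h, if_true, true_and]
        rw [← Finset.mul_sum]
        have h2 := doob (k0 := 0) (T := k1 X ξ d) (S := fun t x => FF φ ξ t x) (FF_dep φ ξ 0)
          (fun t ht => by
            have := FF_md φ ξ t (lt_of_lt_of_le ht (k1_spec h).1)
            rw [zero_add]; exact this)
        rw [FF_energy] at h2
        refine (mul_le_mul_of_nonneg_left h2 (by positivity)).trans (le_of_eq ?_)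
        rw [Finset.mul_sum, Finset.mul_sum, Finset.mul_sum]
        apply Finset.sum_congr rfl; intro η _
        split_ifs <;> ring
      · simp [h]
    rw [Finset.sum_comm]
    have h2 : ∑ ξ ∈ X, ∑ x, ∑ d ∈ Finset.range (L0 + 1), (if ex1 X ξ d then
        (1 / (2:ℝ) ^ d) * rmax (fun t => FF φ ξ t x) (k1 X ξ d) ^ 2 else 0) ≤
        ∑ ξ ∈ X, ∑ d ∈ Finset.range (L0 + 1), ∑ η, 4 * 2 ^ M * φ η ^ 2 * ((1 / (2:ℝ) ^ d) *
          (if ex1 X ξ d ∧ agree (k1 X ξ d) η ξ then 1 else 0)) := by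
      apply Finset.sum_le_sum; intro ξ hξ
      rw [Finset.sum_comm]
      exact Finset.sum_le_sum fun d hd => h1 ξ hξ d hd
    refine h2.trans ?_
    rw [Finset.sum_comm]
    have h3 : ∀ d ∈ Finset.range (L0 + 1), ∑ ξ ∈ X, ∑ η, 4 * 2 ^ M * φ η ^ 2 * ((1 / (2:ℝ) ^ d) *
          (if ex1 X ξ d ∧ agree (k1 X ξ d) η ξ then 1 else 0)) ≤ 8 * 2 ^ M * ∑ η, φ η ^ 2 := by
      intro d _
      rw [Finset.sum_comm, Finset.mul_sum]
      apply Finset.sum_le_sum; intro η _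
      rw [← Finset.mul_sum, ← Finset.mul_sum]
      rw [← Finset.sum_filter, Finset.sum_const, nsmul_eq_mul, mul_one]
      have h4 : ((X.filter (fun ξ => ex1 X ξ d ∧ agree (k1 X ξ d) η ξ)).card : ℝ) ≤ 2 ^ (d + 1) := by
        exact_mod_cast class_count X η d
      have h5 : (1 / (2:ℝ) ^ d) * (X.filter (fun ξ => ex1 X ξ d ∧ agree (k1 X ξ d) η ξ)).card ≤ 2 := by
        rw [one_div_mul_eq_div, div_le_iff₀ (by positivity)]
        rw [pow_succ] at h4; linarith
      have h6 : (0:ℝ) ≤ 4 * 2 ^ M * φ η ^ 2 := by positivity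
      nlinarith
    refine (Finset.sum_le_sum h3).trans (le_of_eq ?_)
    rw [Finset.sum_const, Finset.card_range, nsmul_eq_mul]; push_cast; ring

end HI

namespace HI
variable {M : ℕ}

/-- Greedy sampling of a scalar sequence: sampling index and number of jumps. -/
def gs (θ : ℝ) (s : ℕ → ℝ) : ℕ → ℕ × ℕ
  | 0 => (0, 0)
  | j + 1 => if θ < |s (j + 1) - s (gs θ s j).1| then (j + 1, (gs θ s j).2 + 1) else gs θ s j

section greedy
variable (θ : ℝ) (s : ℕ → ℝ)

lemma gs_le (j : ℕ) : (gs θ s j).1 ≤ j := by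
  induction j with
  | zero => simp [gs]
  | succ j ih => simp only [gs]; split_ifs <;> (try simp only) <;> omega

lemma gs_mono1 : Monotone (fun j => (gs θ s j).1) := monotone_nat_of_le_succ fun j => by
  have := gs_le θ s j
  simp only [gs]; split_ifs <;> (try simp only) <;> omega

lemma gs_mono2 : Monotone (fun j => (gs θ s j).2) := monotone_nat_of_le_succ fun j => by
  simp only [gs]; split_ifs <;> (try simp only) <;> omega

lemma gs_congr (s' : ℕ → ℝ) (j : ℕ) (h : ∀ i ≤ j, s i = s' i) : gs θ s j = gs θ s' j := by
  induction j with
  | zero => rfl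
  | succ j ih =>
    have ih := ih fun i hi => h i (by omega)
    simp only [gs]
    rw [ih, h (j + 1) le_rfl, h _ ((gs_le θ s' j).trans (Nat.le_succ j))]

lemma gs_close (h0 : 0 ≤ θ) (j : ℕ) : |s j - s (gs θ s j).1| ≤ θ := by
  cases j with
  | zero => simpa [gs] using h0
  | succ j =>
    simp only [gs]; split_ifs with h
    · simpa using h0
    · exact not_lt.mp h

lemma gs_const {j j' : ℕ} (h : j ≤ j') (hc : (gs θ s j).2 = (gs θ s j').2) :
    (gs θ s j).1 = (gs θ s j').1 := by
  induction j', h using Nat.le_induction with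
  | base => rfl
  | succ j' hj ih =>
    have h1 := gs_mono2 θ s hj
    have h2 := gs_mono2 θ s (Nat.le_succ j')
    simp only [Nat.succ_eq_add_one] at h1 h2
    have h3 : (gs θ s j').2 = (gs θ s (j' + 1)).2 := by omega
    rw [ih (by omega)]
    simp only [gs] at h3 ⊢
    split_ifs with h
    · rw [if_pos h] at h3; simp at h3
    · rfl

lemma gs_count (h0 : 0 ≤ θ) {r : ℝ} (hr : 0 < r) (j : ℕ) : θ ^ r * (gs θ s j).2 ≤
    ∑ i ∈ Finset.range j, |s (gs θ s (i + 1)).1 - s (gs θ s i).1| ^ r := by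
  induction j with
  | zero => simp [gs]
  | succ j ih =>
    rw [Finset.sum_range_succ]
    by_cases h : θ < |s (j + 1) - s (gs θ s j).1|
    · have h1 : gs θ s (j + 1) = (j + 1, (gs θ s j).2 + 1) := by simp only [gs, h, if_true]
      rw [h1]; simp only; push_cast
      have := Real.rpow_le_rpow h0 h.le hr.le
      linarith
    · have h1 : gs θ s (j + 1) = gs θ s j := by simp only [gs, h, if_false]
      rw [h1]
      have : 0 ≤ |s (gs θ s j).1 - s (gs θ s j).1| ^ r := Real.rpow_nonneg (abs_nonneg _) _
      linarith

end greedy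

/-- Variation hypothesis in monotone form. -/
def VarLe (r V : ℝ) (J : ℕ) (s : ℕ → ℝ) : Prop :=
  (∀ j ≤ J, |s j| ≤ V) ∧ ∀ (n : ℕ) (u : ℕ → ℕ), Monotone u → (∀ i, u i ≤ J) →
    ∑ i ∈ Finset.range n, |s (u (i + 1)) - s (u i)| ^ r ≤ V ^ r

lemma gs_card {r V : ℝ} (hr : 2 < r) (hV : 0 < V) {J N : ℕ} (hN : 1 ≤ N) {s : ℕ → ℝ}
    (hs : VarLe r V J s) {θ : ℝ} (hθ : θ = (N : ℝ) ^ (-(1 / r)) * V) {j : ℕ} (hj : j ≤ J) :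
    (gs θ s j).2 ≤ N := by
  have hN0 : (0:ℝ) < N := by exact_mod_cast hN
  have hθ0 : 0 < θ := by rw [hθ]; positivity
  have h1 := gs_count θ s hθ0.le (show 0 < r by linarith) j
  have h2 := hs.2 j (fun i => (gs θ s (min i j)).1)
    (fun a b h => gs_mono1 θ s (min_le_min_right j h))
    (fun i => (gs_le θ s _).trans ((min_le_right _ _).trans hj))
  have h3 : ∑ i ∈ Finset.range j, |s (gs θ s (i + 1)).1 - s (gs θ s i).1| ^ r =
      ∑ i ∈ Finset.range j, |s (gs θ s (min (i + 1) j)).1 - s (gs θ s (min i j)).1| ^ r := by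
    apply Finset.sum_congr rfl; intro i hi
    have := Finset.mem_range.mp hi
    rw [min_eq_left (by omega), min_eq_left (by omega)]
  have h4 : θ ^ r = V ^ r / N := by
    rw [hθ, Real.mul_rpow (by positivity) hV.le, ← Real.rpow_mul hN0.le]
    rw [show -(1 / r) * r = -1 by field_simp, Real.rpow_neg_one]; ring
  rw [h3] at h1
  have h5 := h1.trans h2
  rw [h4, div_mul_eq_mul_div, div_le_iff₀ hN0] at h5
  have h6 : 0 < V ^ r := by positivity
  have h7 := le_of_mul_le_mul_left h5 h6
  exact_mod_cast h7

lemma gs_var {r V : ℝ} (hr : 2 < r) (hV : 0 < V) {J N : ℕ} (hN : 1 ≤ N) {s : ℕ → ℝ}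
    (hs : VarLe r V J s) {θ : ℝ} (hθ : θ = (N : ℝ) ^ (-(1 / r)) * V) (n : ℕ) (u : ℕ → ℕ)
    (hu : Monotone u) (huJ : ∀ i, u i ≤ J) :
    ∑ i ∈ Finset.range n, (s (gs θ s (u (i + 1))).1 - s (gs θ s (u i)).1) ^ 2 ≤
      (N : ℝ) ^ (1 - 2 / r) * V ^ 2 := by
  have hN0 : (0:ℝ) < N := by exact_mod_cast hN
  set y : ℕ → ℝ := fun i => |s (gs θ s (u (i + 1))).1 - s (gs θ s (u i)).1| with hy
  have hy0 : ∀ i, 0 ≤ y i := fun i => abs_nonneg _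
  set st := (Finset.range n).filter (fun i => (gs θ s (u (i + 1))).2 ≠ (gs θ s (u i)).2) with hst
  have hzero : ∀ i, (gs θ s (u (i + 1))).2 = (gs θ s (u i)).2 → y i = 0 := by
    intro i hi
    have := gs_const θ s (hu (Nat.le_succ i)) hi.symm
    simp only [Nat.succ_eq_add_one] at this
    simp [hy, this]
  have e1 : ∑ i ∈ Finset.range n, (s (gs θ s (u (i + 1))).1 - s (gs θ s (u i)).1) ^ 2 =
      ∑ i ∈ st, y i ^ 2 := by
    rw [hst, Finset.sum_filter]
    apply Finset.sum_congr rfl; intro i _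
    rw [← sq_abs]
    change y i ^ 2 = _
    split_ifs with h
    · rfl
    · rw [hzero i (not_not.mp h)]; simp
  have hcard : st.card ≤ N := by
    refine le_trans ?_ (gs_card hr hV hN hs hθ (huJ n))
    have h1 : ∀ m, ((Finset.range m).filter
        (fun i => (gs θ s (u (i + 1))).2 ≠ (gs θ s (u i)).2)).card ≤ (gs θ s (u m)).2 := by
      intro m
      induction m with
      | zero => simp
      | succ m ih =>
        rw [Finset.range_add_one, Finset.filter_insert]
        have h2 := gs_mono2 θ s (hu (Nat.le_succ m))
        simp only [Nat.succ_eq_add_one] at h2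
        split_ifs with h
        · rw [Finset.card_insert_of_notMem (by simp)]; omega
        · omega
    exact h1 n
  rw [e1]
  have hsum : ∑ i ∈ st, y i ^ r ≤ V ^ r := by
    refine le_trans ?_ (hs.2 n (fun i => (gs θ s (u i)).1)
      (fun a b h => gs_mono1 θ s (hu h)) (fun i => (gs_le θ s _).trans (huJ i)))
    apply Finset.sum_le_sum_of_subset_of_nonneg (Finset.filter_subset _ _)
    intro i _ _; exact Real.rpow_nonneg (abs_nonneg _) _
  have h1 := Real.rpow_sum_le_const_mul_sum_rpow_of_nonneg (s := st) (f := fun i => y i ^ 2)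
    (p := r / 2) (by linarith) (fun i _ => by positivity)
  have e2 : ∀ i, (y i ^ 2) ^ (r / 2) = y i ^ r := by
    intro i
    rw [← Real.rpow_natCast, ← Real.rpow_mul (hy0 i)]; congr 1; push_cast; ring
  simp only [e2] at h1
  have h2 : (∑ i ∈ st, y i ^ 2) ^ (r / 2) ≤ (N : ℝ) ^ (r / 2 - 1) * V ^ r := by
    refine h1.trans (mul_le_mul ?_ hsum ?_ (by positivity))
    · apply Real.rpow_le_rpow (by positivity) (by exact_mod_cast hcard) (by linarith)
    · exact Finset.sum_nonneg fun i _ => Real.rpow_nonneg (hy0 i) _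
  have h3 := Real.rpow_le_rpow (z := 2 / r) (by positivity) h2 (by positivity)
  rw [← Real.rpow_mul (by positivity), Real.mul_rpow (by positivity) (by positivity),
    ← Real.rpow_mul hN0.le, ← Real.rpow_mul hV.le] at h3
  rw [show r / 2 * (2 / r) = 1 by field_simp, Real.rpow_one,
    show (r / 2 - 1) * (2 / r) = 1 - 2 / r by field_simp,
    show r * (2 / r) = (2 : ℕ) by field_simp; norm_num, Real.rpow_natCast] at h3
  exact h3

lemma reps (X : Finset (GG M)) (k : ℕ) : ∃ R ⊆ X,
    (∀ ρ ∈ R, ∀ ρ' ∈ R, ρ ≠ ρ' → ¬ agree k ρ ρ') ∧ ∀ ξ ∈ X, ∃ ρ ∈ R, agree k ξ ρ := by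
  induction X using Finset.induction_on with
  | empty => exact ⟨∅, by simp, by simp, by simp⟩
  | insert ξ X hξ ih =>
    obtain ⟨R, h1, h2, h3⟩ := ih
    by_cases h : ∃ ρ ∈ R, agree k ξ ρ
    · refine ⟨R, h1.trans (Finset.subset_insert _ _), h2, ?_⟩
      intro ζ hζ
      rcases Finset.mem_insert.mp hζ with rfl | hζ
      · exact h
      · exact h3 ζ hζ
    · push Not at h
      refine ⟨insert ξ R, Finset.insert_subset_insert _ h1, ?_, ?_⟩
      · intro ρ hρ ρ' hρ' hne
        rcases Finset.mem_insert.mp hρ with e1 | e1 <;> rcases Finset.mem_insert.mp hρ' with e2 | e2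
        · exact absurd (e1.trans e2.symm) hne
        · rw [e1]; exact h ρ' e2
        · rw [e2]; exact fun hh => h ρ e1 hh.symm
        · exact h2 ρ e1 ρ' e2 hne
      · intro ζ hζ
        rcases Finset.mem_insert.mp hζ with rfl | hζ
        · exact ⟨ζ, Finset.mem_insert_self _ _, agree_refl _ _⟩
        · obtain ⟨ρ, hρ, hh⟩ := h3 ζ hζ
          exact ⟨ρ, Finset.mem_insert_of_mem hρ, hh⟩

lemma FF_sub (φ : GG M → ℝ) (ρ : GG M) {k K : ℕ} (hk : k ≤ K) (x : GG M) :
    FF φ ρ K x - FF φ ρ k x = FF (fun η => if agree k η ρ then 0 else φ η) ρ K x := by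
  unfold FF
  rw [← Finset.sum_sub_distrib]; apply Finset.sum_congr rfl; intro η _
  by_cases h : agree k η ρ
  · simp [h, h.mono hk]
  · simp [h]

lemma seg (X : Finset (GG M)) (k0 K : ℕ) (h0 : k0 ≤ K) (hK : K ≤ M) (Ls : ℕ)
    (hLs : X.card ^ 2 ≤ 2 ^ Ls) (α : GG M → ℝ) (V : ℝ) (hα : ∀ ξ ∈ X, |α ξ| ≤ V)
    (hcl : ∀ ξ ∈ X, ∀ ξ' ∈ X, agree K ξ ξ' → agree k0 ξ ξ') (Dt : ℕ → GG M → ℝ)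
    (hDt : ∀ k, k0 ≤ k → k ≤ K → ∀ η, ∀ ξ ∈ X, agree k η ξ → Dt k η = α ξ)
    (hDt0 : ∀ k, k0 ≤ k → k ≤ K → ∀ η, (∀ ξ ∈ X, ¬ agree k η ξ) → Dt k η = 0) (φ : GG M → ℝ) :
    ∃ Mx : GG M → ℝ,
      (∀ x k, k0 ≤ k → k ≤ K → (∑ η, (Dt k η - Dt k0 η) * φ η * ww η x) ^ 2 ≤ Mx x) ∧
      ∑ x, Mx x ≤ 131 * (Ls + 1 : ℝ) ^ 2 * V ^ 2 * 2 ^ M *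
        ∑ η, (if (∃ ξ ∈ X, agree K η ξ) ∧ (∀ ξ ∈ X, ¬ agree k0 η ξ) then φ η ^ 2 else 0) := by
  obtain ⟨R, hRX, hRd, hRc⟩ := reps X k0
  obtain ⟨T, rfl⟩ := Nat.exists_eq_add_of_le h0
  have hRd' : ∀ ρ ∈ R, ∀ ρ' ∈ R, ρ ≠ ρ' → ¬ agree (k0 + T) ρ ρ' := fun ρ h ρ' h' hne hh =>
    hRd ρ h ρ' h' hne (hcl ρ (hRX h) ρ' (hRX h') hh)
  have hcard : R.card ^ 2 ≤ 2 ^ Ls :=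
    (Nat.pow_le_pow_left (Finset.card_le_card hRX) 2).trans hLs
  obtain ⟨Mx, hM1, hM2⟩ := lemS R k0 T Ls hcard hRd'
    (fun t ρ x => α ρ * (FF φ ρ (k0 + t + 1) x - FF φ ρ (k0 + t) x))
    (fun t ht ρ => MD.const_mul (α ρ) (FF_md φ ρ (k0 + t) (by omega)))
  have hFp : ∀ x t ρ, Fp (fun t ρ => α ρ * (FF φ ρ (k0 + t + 1) x - FF φ ρ (k0 + t) x)) t ρ =
      α ρ * (FF φ ρ (k0 + t) x - FF φ ρ k0 x) := by
    intro x t ρ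
    unfold Fp
    rw [← Finset.mul_sum]
    have := Finset.sum_range_sub (fun t => FF φ ρ (k0 + t) x) t
    simp only [add_zero, ← add_assoc] at this
    rw [this]
  simp only [hFp] at hM1 hM2
  refine ⟨Mx, ?_, ?_⟩
  · intro x k hk hkK
    obtain ⟨t, rfl⟩ := Nat.exists_eq_add_of_le hk
    have h1 := hM1 x t (by omega)
    have hrep : ∀ k', k0 ≤ k' → k' ≤ k0 + T → ∀ η, Dt k' η =
        ∑ ρ ∈ R, if agree k' η ρ then α ρ else 0 := by
      intro k' h1 h2 η
      by_cases h : ∃ ξ ∈ X, agree k' η ξ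
      · obtain ⟨ξ, hξ, hag⟩ := h
        obtain ⟨ρ, hρ, hρ'⟩ := hRc ξ hξ
        have h3 : agree k' η ρ := hag.trans (hρ'.mono h1)
        rw [Finset.sum_eq_single ρ]
        · rw [if_pos h3]; exact hDt k' h1 h2 η ρ (hRX hρ) h3
        · intro ρ' hρ1 hne
          rw [if_neg]
          intro h4
          exact hRd' ρ' hρ1 ρ hρ hne ((h4.symm.trans h3).mono h2)
        · intro h; exact absurd hρ h
      · push Not at h
        rw [hDt0 k' h1 h2 η h]
        symm; apply Finset.sum_eq_zero; intro ρ hρ; rw [if_neg (h ρ (hRX hρ))]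
    have h2 : ∑ η, (Dt (k0 + t) η - Dt k0 η) * φ η * ww η x =
        ∑ ρ ∈ R, α ρ * (FF φ ρ (k0 + t) x - FF φ ρ k0 x) * ww ρ x := by
      have h3 : ∀ ρ, α ρ * (FF φ ρ (k0 + t) x - FF φ ρ k0 x) * ww ρ x =
          ∑ η, ((if agree (k0 + t) η ρ then α ρ else 0) - (if agree k0 η ρ then α ρ else 0))
            * φ η * ww η x := by
        intro ρ
        rw [FF_eq, FF_eq]
        have h4 := ww_mul_self ρ x
        have h5 : α ρ * (PP φ ρ (k0 + t) x * ww ρ x - PP φ ρ k0 x * ww ρ x) * ww ρ x =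
          α ρ * PP φ ρ (k0 + t) x - α ρ * PP φ ρ k0 x := by
            linear_combination (α ρ * PP φ ρ (k0 + t) x - α ρ * PP φ ρ k0 x) * h4
        rw [h5]; unfold PP
        rw [Finset.mul_sum, Finset.mul_sum, ← Finset.sum_sub_distrib]
        apply Finset.sum_congr rfl; intro η _
        split_ifs <;> ring
      simp_rw [h3]
      rw [Finset.sum_comm]
      apply Finset.sum_congr rfl; intro η _
      rw [hrep (k0 + t) hk hkK, hrep k0 le_rfl h0, ← Finset.sum_sub_distrib, Finset.sum_mul,
        Finset.sum_mul]
    rw [h2]; exact h1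
  · refine hM2.trans ?_
    have h1 : ∑ x, ∑ ρ ∈ R, (α ρ * (FF φ ρ (k0 + T) x - FF φ ρ k0 x)) ^ 2 ≤
        V ^ 2 * (2 ^ M * ∑ η, (if (∃ ξ ∈ X, agree (k0 + T) η ξ) ∧ (∀ ξ ∈ X, ¬ agree k0 η ξ)
          then φ η ^ 2 else 0)) := by
      rw [Finset.sum_comm]
      have h2 : ∀ ρ ∈ R, ∑ x, (α ρ * (FF φ ρ (k0 + T) x - FF φ ρ k0 x)) ^ 2 ≤ V ^ 2 *
          (2 ^ M * ∑ η, (if agree (k0 + T) η ρ ∧ ¬ agree k0 η ρ then φ η ^ 2 else 0)) := by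
        intro ρ hρ
        simp_rw [mul_pow, FF_sub φ ρ h0]
        rw [← Finset.mul_sum, FF_energy]
        have h3 : α ρ ^ 2 ≤ V ^ 2 := by
          rw [← sq_abs]; exact pow_le_pow_left₀ (abs_nonneg _) (hα ρ (hRX hρ)) 2
        have h4 : ∑ η, (if agree (k0 + T) η ρ then (if agree k0 η ρ then 0 else φ η) ^ 2 else 0) =
            ∑ η, (if agree (k0 + T) η ρ ∧ ¬ agree k0 η ρ then φ η ^ 2 else 0) := by
          apply Finset.sum_congr rfl; intro η _
          by_cases h5 : agree (k0 + T) η ρ <;> by_cases h6 : agree k0 η ρ <;> simp [h5, h6]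
        rw [h4]
        apply mul_le_mul_of_nonneg_right h3
        apply mul_nonneg (by positivity)
        apply Finset.sum_nonneg; intro η _; split_ifs <;> positivity
      refine (Finset.sum_le_sum h2).trans ?_
      rw [← Finset.mul_sum, ← Finset.mul_sum, Finset.sum_comm]
      apply mul_le_mul_of_nonneg_left _ (by positivity)
      apply mul_le_mul_of_nonneg_left _ (by positivity)
      apply Finset.sum_le_sum; intro η _
      by_cases h : ∃ ρ ∈ R, agree (k0 + T) η ρ ∧ ¬ agree k0 η ρ
      · obtain ⟨ρ, hρ, h3, h4⟩ := h
        rw [Finset.sum_eq_single ρ]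
        · rw [if_pos ⟨h3, h4⟩, if_pos]
          refine ⟨⟨ρ, hRX hρ, h3⟩, fun ξ hξ h5 => h4 ?_⟩
          exact h5.trans (hcl ξ hξ ρ (hRX hρ) ((h5.mono h0).symm.trans h3))
        · intro ρ' hρ' hne
          rw [if_neg]
          rintro ⟨h5, _⟩
          exact hRd' ρ' hρ' ρ hρ hne (h5.symm.trans h3)
        · intro h; exact absurd hρ h
      · push Not at h
        rw [Finset.sum_eq_zero]
        · split_ifs <;> positivity
        · intro ρ hρ
          rw [if_neg]
          rintro ⟨h5, h6⟩
          exact h6 (h ρ hρ h5)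
    calc _ ≤ 131 * (Ls + 1 : ℝ) ^ 2 * (V ^ 2 * (2 ^ M * ∑ η, (if (∃ ξ ∈ X, agree (k0 + T) η ξ) ∧
          (∀ ξ ∈ X, ¬ agree k0 η ξ) then φ η ^ 2 else 0))) :=
          mul_le_mul_of_nonneg_left h1 (by positivity)
      _ = _ := by ring

/-- Class decomposition of a multiplier supported near `X`. -/
lemma class_id (X : Finset (GG M)) (k : ℕ) (h : GG M → ℝ)
    (hh : ∀ η ξ, agree k η ξ → h η = h ξ) (φ : GG M → ℝ) (x : GG M) :
    ∑ η, (if ∃ ξ ∈ X, agree k ξ η then h η else 0) * φ η * ww η x =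
      ∑ ξ ∈ X, (1 / (nn X k ξ : ℝ)) * (h ξ * PP φ ξ k x) := by
  unfold PP
  simp_rw [Finset.mul_sum]
  rw [Finset.sum_comm]
  apply Finset.sum_congr rfl; intro η _
  have h1 : ∀ ξ ∈ X, 1 / (nn X k ξ : ℝ) * (h ξ * ((if agree k η ξ then φ η else 0) * ww η x)) =
      if agree k η ξ then (1 / (nn X k η : ℝ)) * (h η * φ η * ww η x) else 0 := by
    intro ξ _
    split_ifs with hag
    · rw [hh η ξ hag]
      have : nn X k ξ = nn X k η := by
        unfold nn; congr 1; ext ζ; simp only [Finset.mem_filter]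
        exact and_congr_right fun _ => ⟨fun h => hag.trans h, fun h => hag.symm.trans h⟩
      rw [this]; ring
    · ring
  rw [Finset.sum_congr rfl h1, ← Finset.sum_filter, Finset.sum_const, nsmul_eq_mul]
  change _ = (nn X k η : ℝ) * _
  by_cases hex : ∃ ξ ∈ X, agree k ξ η
  · have : (nn X k η : ℝ) ≠ 0 := by
      obtain ⟨ξ, h1, h2⟩ := hex
      have : 0 < nn X k η := Finset.card_pos.mpr ⟨ξ, by simp [h1, h2.symm]⟩
      positivity
    rw [if_pos hex]; field_simp
  · rw [if_neg hex]
    have : nn X k η = 0 := by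
      unfold nn; rw [Finset.card_eq_zero, Finset.filter_eq_empty_iff]
      intro ξ hξ h2; exact hex ⟨ξ, hξ, h2.symm⟩
    rw [this]; simp

end HI

namespace HI
variable {M : ℕ}

lemma jump_sum (g : ℕ → ℝ) (J : ℕ) (V : ℝ) (hg : ∀ j ≤ J, |g j| ≤ V) (u : ℕ → ℕ) (hu : Monotone u)
    (f : ℕ → ℝ) (hf : ∀ i, f i = if u i ≤ J then g (u i) else 0) (n : ℕ) :
    ∑ i ∈ Finset.range n, (f (i + 1) - f i) ^ 2 ≤
      ∑ i ∈ Finset.range n, (g (min (u (i + 1)) J) - g (min (u i) J)) ^ 2 +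
        (if u n ≤ J then 0 else V ^ 2) := by
  induction n with
  | zero => simp; split_ifs <;> positivity
  | succ n ih =>
    rw [Finset.sum_range_succ, Finset.sum_range_succ]
    have h1 := hu (Nat.le_succ n)
    simp only [Nat.succ_eq_add_one] at h1
    have hsq : 0 ≤ (g (min (u (n + 1)) J) - g (min (u n) J)) ^ 2 := sq_nonneg _
    by_cases h2 : u n ≤ J
    · rw [if_pos h2] at ih
      by_cases h3 : u (n + 1) ≤ J
      · rw [if_pos h3, hf, hf, if_pos h2, if_pos h3, min_eq_left h2, min_eq_left h3]; linarith
      · rw [if_neg h3, hf (n + 1), hf n, if_pos h2, if_neg h3]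
        have h4 : (0 - g (u n)) ^ 2 ≤ V ^ 2 := by
          rw [zero_sub, neg_sq, ← sq_abs]
          exact pow_le_pow_left₀ (abs_nonneg _) (hg _ h2) 2
        linarith
    · rw [if_neg h2] at ih
      have h3 : ¬ u (n + 1) ≤ J := by omega
      rw [if_neg h3, hf (n + 1), hf n, if_neg h2, if_neg h3]
      simp only [sub_zero]; linarith

/-- First scale at which `η` sees `X`. -/
def kap (X : Finset (GG M)) (η : GG M) : ℕ := sInf {k : ℕ | ∃ ξ ∈ X, agree k η ξ}

lemma kap_spec {X : Finset (GG M)} {η : GG M} {k : ℕ} (h : ∃ ξ ∈ X, agree k η ξ) :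
    (∃ ξ ∈ X, agree (kap X η) η ξ) ∧ kap X η ≤ k :=
  ⟨Nat.sInf_mem (s := {k : ℕ | ∃ ξ ∈ X, agree k η ξ}) ⟨k, h⟩, Nat.sInf_le h⟩

lemma nn_eq_agree {X : Finset (GG M)} {ξ ξ' : GG M} {k k' : ℕ} (hk : k ≤ k') (h : nn X k ξ = nn X k' ξ)
    (hξ' : ξ' ∈ X) (hag : agree k' ξ ξ') : agree k ξ ξ' := by
  have h1 : X.filter (fun ξ' => agree k ξ ξ') = X.filter (fun ξ' => agree k' ξ ξ') := by
    apply Finset.eq_of_subset_of_card_le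
    · intro y hy
      simp only [Finset.mem_filter] at *
      exact ⟨hy.1, hy.2.mono hk⟩
    · exact h.ge
  have h2 : ξ' ∈ X.filter (fun ξ' => agree k' ξ ξ') := by simp [hξ', hag]
  rw [← h1] at h2
  exact (Finset.mem_filter.mp h2).2

set_option maxHeartbeats 4000000 in
lemma L2max {r V : ℝ} (hr : 2 < r) (hV : 0 < V) (X : Finset (GG M)) (N L0 : ℕ) (hN : 1 ≤ N)
    (hXN : X.card ≤ N) (hNL : N ≤ 2 ^ L0) (a : ℕ → GG M → ℝ)
    (ha : ∀ k η ξ, agree k η ξ → a k η = a k ξ)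
    (hvar : ∀ ξ ∈ X, VarLe r V M (fun j => a (M - j) ξ)) (φ : GG M → ℝ) :
    ∃ Mx : GG M → ℝ, (∀ x, ∀ k ≤ M,
      (∑ η, (if ∃ ξ ∈ X, agree k ξ η then a k η else 0) * φ η * ww η x) ^ 2 ≤ Mx x) ∧
      ∑ x, Mx x ≤ 2184 * (L0 + 1 : ℝ) ^ 2 * ((N : ℝ) ^ (1 - 2 / r) * V ^ 2) *
        (2 ^ M * ∑ η, φ η ^ 2) := by
  have hN0 : (0:ℝ) < N := by exact_mod_cast hN
  have hN1 : (1:ℝ) ≤ N := by exact_mod_cast hN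
  set θ : ℝ := (N : ℝ) ^ (-(1 / r)) * V with hθ
  have hθ0 : 0 < θ := by rw [hθ]; positivity
  set H : ℝ := (N : ℝ) ^ (1 - 2 / r) * V ^ 2 with hH
  have hVH : V ^ 2 ≤ H := by
    have : 1 ≤ (N : ℝ) ^ (1 - 2 / r) := Real.one_le_rpow hN1 (by
      have : 2 / r ≤ 1 := by rw [div_le_one (by linarith)]; linarith
      linarith)
    nlinarith [sq_nonneg V]
  have hθH : N * θ ^ 2 = H := by
    rw [hθ, hH, mul_pow, ← Real.rpow_natCast ((N : ℝ) ^ (-(1 / r))) 2, ← Real.rpow_mul hN0.le]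
    rw [show (1 - 2 / r) = 1 + -(1 / r) * ((2 : ℕ) : ℝ) by push_cast; ring, Real.rpow_add hN0,
      Real.rpow_one]
    ring
  have hH0 : 0 ≤ H := le_trans (sq_nonneg V) hVH
  set s : GG M → ℕ → ℝ := fun η j => a (M - j) η with hs
  set at' : ℕ → GG M → ℝ := fun k η => s η (gs θ (s η) (M - k)).1 with hat
  set Dt : ℕ → GG M → ℝ := fun k η => if ∃ ξ ∈ X, agree k ξ η then at' k η else 0 with hDt
  set P : ℝ := 2 ^ M * ∑ η, φ η ^ 2 with hP
  have hP0 : 0 ≤ P := by positivity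
  have hscl : ∀ k ≤ M, ∀ η ξ, agree k η ξ → ∀ i ≤ M - k, s η i = s ξ i := by
    intro k hk η ξ hag i hi
    exact ha (M - i) η ξ (hag.mono (by omega))
  have hatcl : ∀ k ≤ M, ∀ η ξ, agree k η ξ → at' k η = at' k ξ := by
    intro k hk η ξ hag
    have h1 := hscl k hk η ξ hag
    simp only [hat]
    rw [gs_congr θ (s η) (s ξ) (M - k) h1]
    exact h1 _ (gs_le _ _ _)
  have hatV : ∀ k, ∀ ξ ∈ X, |at' k ξ| ≤ V := by
    intro k ξ hξ
    exact (hvar ξ hξ).1 _ ((gs_le _ _ _).trans (Nat.sub_le _ _))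
  -- the error term
  obtain ⟨A, hA1, hA2⟩ := classMax X L0 (hXN.trans hNL) φ
  have hA0 : ∀ x, 0 ≤ A x := fun x => le_trans
    (Finset.sum_nonneg fun ξ _ => by positivity) (hA1 x 0 (Nat.zero_le _))
  have herr : ∀ x, ∀ k ≤ M, (∑ η, (if ∃ ξ ∈ X, agree k ξ η then a k η else 0) * φ η * ww η x -
      ∑ η, Dt k η * φ η * ww η x) ^ 2 ≤ H * A x := by
    intro x k hk
    have h1 : ∑ η, (if ∃ ξ ∈ X, agree k ξ η then a k η else 0) * φ η * ww η x -
        ∑ η, Dt k η * φ η * ww η x =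
        ∑ η, (if ∃ ξ ∈ X, agree k ξ η then a k η - at' k η else 0) * φ η * ww η x := by
      rw [← Finset.sum_sub_distrib]; apply Finset.sum_congr rfl; intro η _
      simp only [hDt]; split_ifs <;> ring
    rw [h1, class_id X k (fun η => a k η - at' k η) (fun η ξ hag => by
      simp only [ha k η ξ hag, hatcl k hk η ξ hag])]
    have h2 := Finset.sum_sq_le_sum_mul_sum_of_sq_eq_mul X
      (r := fun ξ => (1 / (nn X k ξ : ℝ)) * ((a k ξ - at' k ξ) * PP φ ξ k x))
      (f := fun ξ => (1 / (nn X k ξ : ℝ)) * (a k ξ - at' k ξ) ^ 2)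
      (g := fun ξ => (1 / (nn X k ξ : ℝ)) * PP φ ξ k x ^ 2)
      (fun ξ _ => by positivity) (fun ξ _ => by positivity) (fun ξ _ => by ring)
    refine h2.trans (mul_le_mul ?_ (hA1 x k hk) (Finset.sum_nonneg fun ξ _ => by positivity) hH0)
    have h3 : ∀ ξ ∈ X, (1 / (nn X k ξ : ℝ)) * (a k ξ - at' k ξ) ^ 2 ≤ θ ^ 2 := by
      intro ξ hξ
      have h4 := gs_close θ (s ξ) hθ0.le (M - k)
      have h5 : s ξ (M - k) = a k ξ := by
        simp only [hs]; congr 1; omega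
      rw [h5] at h4
      have h6 : (a k ξ - at' k ξ) ^ 2 ≤ θ ^ 2 := by
        rw [← sq_abs]; exact pow_le_pow_left₀ (abs_nonneg _) h4 2
      have h7 : (1:ℝ) ≤ nn X k ξ := by exact_mod_cast nn_pos hξ k
      have h8 : 1 / (nn X k ξ : ℝ) ≤ 1 := by rw [div_le_one (by linarith)]; exact h7
      have h9 : 0 ≤ 1 / (nn X k ξ : ℝ) := by positivity
      nlinarith [sq_nonneg (a k ξ - at' k ξ)]
    refine (Finset.sum_le_sum h3).trans ?_
    rw [Finset.sum_const, nsmul_eq_mul, ← hθH]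
    have : (X.card : ℝ) ≤ N := by exact_mod_cast hXN
    exact mul_le_mul_of_nonneg_right this (sq_nonneg _)
  -- variation of Dt along monotone sequences
  have hDtvar : ∀ η (n : ℕ) (u : ℕ → ℕ), Monotone u → (∀ i, u i ≤ M) →
      ∑ i ∈ Finset.range n, (Dt (M - u (i + 1)) η - Dt (M - u i) η) ^ 2 ≤ 2 * H := by
    intro η n u hu huM
    by_cases hex : ∃ ξ ∈ X, agree M η ξ
    · obtain ⟨⟨ξ, hξ, hag⟩, hκ⟩ := kap_spec hex
      set κ := kap X η with hκdef
      have h1 := jump_sum (fun j => s ξ (gs θ (s ξ) j).1) (M - κ) V (fun j hj =>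
        (hvar ξ hξ).1 _ ((gs_le _ _ _).trans (hj.trans (Nat.sub_le _ _)))) u hu
        (fun i => Dt (M - u i) η) (fun i => by
          simp only [hDt]
          by_cases h2 : u i ≤ M - κ
          · rw [if_pos h2, if_pos ⟨ξ, hξ, (hag.mono (show κ ≤ M - u i by omega)).symm⟩]
            rw [hatcl (M - u i) (Nat.sub_le _ _) η ξ (hag.mono (by omega))]
            simp only [hat]
            rw [show M - (M - u i) = u i by have := huM i; omega]
          · rw [if_neg h2, if_neg]
            rintro ⟨ξ', h3, h4⟩
            have h5 := (kap_spec ⟨ξ', h3, h4.symm⟩).2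
            have h6 := huM i
            rw [← hκdef] at h5
            omega) n
      refine h1.trans ?_
      have h2 := gs_var hr hV hN (hvar ξ hξ) hθ n (fun i => min (u i) (M - κ))
        (fun i j h => min_le_min_right _ (hu h)) (fun i => (min_le_right _ _).trans (Nat.sub_le _ _))
      have h3 : (if u n ≤ M - κ then 0 else V ^ 2) ≤ H := by split_ifs <;> assumption
      linarith
    · rw [Finset.sum_eq_zero]
      · linarith
      · intro i _
        have h0 : ∀ k ≤ M, Dt k η = 0 := by
          intro k hk
          simp only [hDt]; rw [if_neg]
          rintro ⟨ξ', h3, h4⟩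
          exact hex ⟨ξ', h3, (h4.mono hk).symm⟩
        rw [h0 _ (Nat.sub_le _ _), h0 _ (Nat.sub_le _ _)]; simp
  -- the counter
  set Cn : ℕ → ℕ := fun j => ∑ ξ ∈ X, ((gs θ (s ξ) j).2 + (X.card - nn X (M - j) ξ)) with hCn
  have hterm : ∀ ξ, Monotone (fun j => (gs θ (s ξ) j).2 + (X.card - nn X (M - j) ξ)) := by
    intro ξ i j hij
    have h1 := gs_mono2 θ (s ξ) hij
    have h2 := nn_mono X ξ (show M - j ≤ M - i by omega)
    simp only at h1 ⊢
    omega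
  have hCmono : Monotone Cn := fun i j hij => Finset.sum_le_sum fun ξ _ => hterm ξ hij
  have hCeq : ∀ i j, i ≤ j → Cn i = Cn j → ∀ ξ ∈ X,
      (gs θ (s ξ) i).2 = (gs θ (s ξ) j).2 ∧ nn X (M - i) ξ = nn X (M - j) ξ := by
    intro i j hij he ξ hξ
    have h1 := (Finset.sum_eq_sum_iff_of_le (fun ξ _ => hterm ξ hij)).mp he ξ hξ
    have h2 := gs_mono2 θ (s ξ) hij
    have h3 := nn_mono X ξ (show M - j ≤ M - i by omega)
    have h4 := nn_le X ξ (M - i)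
    have h5 := nn_le X ξ (M - j)
    simp only at h1 h2
    omega
  have hC0 : Cn 0 = 0 := by
    simp only [hCn]; apply Finset.sum_eq_zero; intro ξ _
    have : nn X (M - 0) ξ = X.card := by
      unfold nn; congr 1; apply Finset.filter_true_of_mem; intro ζ _; exact agree_top _ _
    rw [this]; simp [gs]
  have hCb : ∀ j ≤ M, Cn j ≤ 2 ^ (2 * L0 + 1) := by
    intro j hj
    have h1 : Cn j ≤ ∑ ξ ∈ X, (N + N) := by
      apply Finset.sum_le_sum; intro ξ hξ
      have := gs_card hr hV hN (hvar ξ hξ) hθ hj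
      have h2 : (gs θ (s ξ) j).2 ≤ N := this
      omega
    rw [Finset.sum_const, smul_eq_mul] at h1
    have h2 : X.card * (N + N) ≤ 2 ^ L0 * (2 ^ L0 + 2 ^ L0) :=
      Nat.mul_le_mul (hXN.trans hNL) (by omega)
    refine h1.trans (h2.trans (le_of_eq ?_))
    rw [pow_add, pow_mul']; ring
  set jv : ℕ → ℕ := fun v => Nat.findGreatest (fun j => Cn j ≤ v) M with hjv
  have hjvM : ∀ v, jv v ≤ M := fun v => Nat.findGreatest_le _
  have hjvC : ∀ v, Cn (jv v) ≤ v := fun v =>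
    Nat.findGreatest_spec (P := fun j => Cn j ≤ v) (Nat.zero_le M) (by rw [hC0]; exact Nat.zero_le _)
  have hjvle : ∀ v j, j ≤ M → Cn j ≤ v → j ≤ jv v := fun v j h1 h2 =>
    Nat.le_findGreatest h1 h2
  have hjvmono : Monotone jv := fun v w hvw => hjvle w _ (hjvM v) ((hjvC v).trans hvw)
  -- segments
  have hseg : ∀ v : ℕ, ∃ Mx : GG M → ℝ, (∀ x, 0 ≤ Mx x) ∧ (∀ x, ∀ j ≤ M, Cn j = v →
      (∑ η, (Dt (M - j) η - Dt (M - jv v) η) * φ η * ww η x) ^ 2 ≤ Mx x) ∧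
      ∑ x, Mx x ≤ 131 * (2 * L0 + 1 : ℝ) ^ 2 * V ^ 2 * 2 ^ M *
        ∑ η, (if Cn (M - kap X η) = v then φ η ^ 2 else 0) := by
    intro v
    by_cases hv : ∃ j, j ≤ M ∧ Cn j = v
    · set j0 := Nat.find hv with hj0
      obtain ⟨hj0M, hj0C⟩ := Nat.find_spec hv
      have hj0min : ∀ j, j ≤ M → Cn j = v → j0 ≤ j := fun j h1 h2 => Nat.find_min' hv ⟨h1, h2⟩
      have hj0v : j0 ≤ jv v := hjvle v j0 hj0M hj0C.le
      have hCjv : Cn (jv v) = v := le_antisymm (hjvC v) (by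
        calc v = Cn j0 := hj0C.symm
          _ ≤ _ := hCmono hj0v)
      have hbetween : ∀ j, j0 ≤ j → j ≤ jv v → Cn j = v := fun j h1 h2 =>
        le_antisymm ((hCmono h2).trans hCjv.le) (by
          calc v = Cn j0 := hj0C.symm
            _ ≤ _ := hCmono h1)
      have hjvM' := hjvM v
      obtain ⟨Mx, h1, h2⟩ := seg X (M - jv v) (M - j0) (by omega) (Nat.sub_le _ _) (2 * L0)
        (by
          calc X.card ^ 2 ≤ (2 ^ L0) ^ 2 := Nat.pow_le_pow_left (hXN.trans hNL) 2
            _ = 2 ^ (2 * L0) := by rw [← pow_mul, mul_comm])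
        (at' (M - jv v)) V (hatV _)
        (fun ξ hξ ξ' hξ' hag => nn_eq_agree (by omega)
          ((hCeq j0 (jv v) hj0v (hj0C.trans hCjv.symm) ξ hξ).2.symm) hξ' hag) Dt
        (by
          intro k hk1 hk2 η ξ hξ hag
          have hkM : k ≤ M := by omega
          simp only [hDt]
          rw [if_pos ⟨ξ, hξ, hag.symm⟩, hatcl k hkM η ξ hag]
          simp only [hat]
          have h3 := hbetween (M - k) (by omega) (by omega)
          have h4 := (hCeq (M - k) (jv v) (by omega) (h3.trans hCjv.symm) ξ hξ).1
          rw [gs_const θ (s ξ) (show M - k ≤ jv v by omega) h4]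
          rw [show M - (M - jv v) = jv v by omega])
        (by
          intro k _ _ η h
          simp only [hDt]; rw [if_neg]
          rintro ⟨ξ, h3, h4⟩
          exact h ξ h3 h4.symm) φ
      refine ⟨Mx, fun x => le_trans (sq_nonneg _) (h1 x _ le_rfl (by omega)), ?_, ?_⟩
      · intro x j hj hjC
        have h3 := hj0min j hj hjC
        have h4 := hjvle v j hj hjC.le
        exact h1 x (M - j) (by omega) (by omega)
      · refine h2.trans ?_
        push_cast
        apply mul_le_mul_of_nonneg_left _ (by positivity)
        apply Finset.sum_le_sum; intro η _
        by_cases h3 : (∃ ξ ∈ X, agree (M - j0) η ξ) ∧ (∀ ξ ∈ X, ¬ agree (M - jv v) η ξ)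
        · rw [if_pos h3]
          obtain ⟨⟨ξ, hξ, h4⟩, h5⟩ := kap_spec h3.1
          have h6 : M - jv v < kap X η := by
            by_contra h7
            exact h3.2 ξ hξ (h4.mono (not_lt.mp h7))
          rw [if_pos (hbetween _ (by omega) (by omega))]
        · rw [if_neg h3]; split_ifs <;> positivity
    · refine ⟨fun _ => 0, fun _ => le_rfl, fun x j hj hjC => absurd ⟨j, hj, hjC⟩ hv, ?_⟩
      simp only [Finset.sum_const_zero]
      apply mul_nonneg (by positivity)
      apply Finset.sum_nonneg; intro η _; split_ifs <;> positivity
  choose Ms hMs0 hMs1 hMs2 using hseg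
  set L := 2 * L0 + 1 with hL
  set Xv : GG M → ℕ → ℝ := fun x v => ∑ η, Dt (M - jv v) η * φ η * ww η x with hXv
  set RM : GG M → ℝ := fun x => (L + 1 : ℝ) * ∑ l ∈ Finset.range (L + 1),
      ∑ j ∈ Finset.range (2 ^ (L - l)), (Xv x ((j + 1) * 2 ^ l) - Xv x (j * 2 ^ l)) ^ 2 with hRM
  refine ⟨fun x => 2 * (H * A x) + 8 * Xv x 0 ^ 2 + 8 * RM x +
    4 * ∑ v ∈ Finset.range (2 ^ L + 1), Ms v x, ?_, ?_⟩
  · intro x k hk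
    have h1 := herr x k hk
    set v := Cn (M - k) with hv
    have hvb : v ≤ 2 ^ L := hCb _ (Nat.sub_le _ _)
    have h2 := rm_sq L (Xv x) v hvb
    have h3 := hMs1 v x (M - k) (Nat.sub_le _ _) rfl
    rw [show M - (M - k) = k by omega] at h3
    have h4 : ∑ η, (Dt k η - Dt (M - jv v) η) * φ η * ww η x =
        ∑ η, Dt k η * φ η * ww η x - Xv x v := by
      simp only [hXv]; rw [← Finset.sum_sub_distrib]; apply Finset.sum_congr rfl; intros; ring
    rw [h4] at h3
    have h5 : Ms v x ≤ ∑ v ∈ Finset.range (2 ^ L + 1), Ms v x :=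
      Finset.single_le_sum (f := fun v => Ms v x) (fun v _ => hMs0 v x)
        (by simp only [Finset.mem_range]; omega)
    set a1 := ∑ η, (if ∃ ξ ∈ X, agree k ξ η then a k η else 0) * φ η * ww η x
    set a2 := ∑ η, Dt k η * φ η * ww η x
    change (Xv x v - Xv x 0) ^ 2 ≤ RM x at h2
    have e1 : a1 ^ 2 ≤ 2 * (a1 - a2) ^ 2 + 2 * a2 ^ 2 := by nlinarith [sq_nonneg (a1 - a2 - a2)]
    have e2 : a2 ^ 2 ≤ 2 * (a2 - Xv x v) ^ 2 + 2 * Xv x v ^ 2 := by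
      nlinarith [sq_nonneg (a2 - Xv x v - Xv x v)]
    have e3 : Xv x v ^ 2 ≤ 2 * (Xv x v - Xv x 0) ^ 2 + 2 * Xv x 0 ^ 2 := by
      nlinarith [sq_nonneg (Xv x v - Xv x 0 - Xv x 0)]
    linarith
  · have hkey : ∑ x, (2 * (H * A x) + 8 * Xv x 0 ^ 2 + 8 * RM x +
        4 * ∑ v ∈ Finset.range (2 ^ L + 1), Ms v x) = 2 * (H * ∑ x, A x) + 8 * ∑ x, Xv x 0 ^ 2 +
        8 * ∑ x, RM x + 4 * ∑ x, ∑ v ∈ Finset.range (2 ^ L + 1), Ms v x := by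
      rw [Finset.sum_add_distrib, Finset.sum_add_distrib, Finset.sum_add_distrib]
      congr 1
      · congr 1
        · congr 1
          · rw [Finset.mul_sum, Finset.mul_sum]
          · rw [Finset.mul_sum]
        · rw [Finset.mul_sum]
      · rw [Finset.mul_sum]
    rw [hkey]
    clear hkey
    have s1 : H * ∑ x, A x ≤ H * (8 * (L0 + 1 : ℝ) * P) := by
      apply mul_le_mul_of_nonneg_left _ hH0
      rw [hP]; linarith
    have s2 : ∑ x, Xv x 0 ^ 2 ≤ H * P := by
      simp only [hXv]
      rw [plancherel (fun η => Dt (M - jv 0) η * φ η), hP, ← mul_assoc, mul_comm H, mul_assoc]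
      apply mul_le_mul_of_nonneg_left _ (by positivity)
      rw [Finset.mul_sum]
      apply Finset.sum_le_sum; intro η _
      rw [mul_pow]
      apply mul_le_mul_of_nonneg_right _ (sq_nonneg _)
      refine le_trans ?_ hVH
      simp only [hDt]
      split_ifs with h
      · obtain ⟨ξ, hξ, hag⟩ := h
        rw [hatcl _ (Nat.sub_le _ _) η ξ hag.symm, ← sq_abs]
        exact pow_le_pow_left₀ (abs_nonneg _) (hatV _ ξ hξ) 2
      · simp; positivity
    have s3 : ∑ x, RM x ≤ (L + 1 : ℝ) ^ 2 * (2 * H * P) := by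
      simp only [hRM]
      rw [← Finset.mul_sum, sq, mul_assoc]
      apply mul_le_mul_of_nonneg_left _ (by positivity)
      rw [Finset.sum_comm]
      have : (L + 1 : ℝ) * (2 * H * P) = ∑ l ∈ Finset.range (L + 1), 2 * H * P := by simp
      rw [this]
      apply Finset.sum_le_sum
      intro l _
      rw [Finset.sum_comm]
      have h1 : ∀ j, ∑ x, (Xv x ((j + 1) * 2 ^ l) - Xv x (j * 2 ^ l)) ^ 2 =
          ∑ η, 2 ^ M * φ η ^ 2 *
            (Dt (M - jv ((j + 1) * 2 ^ l)) η - Dt (M - jv (j * 2 ^ l)) η) ^ 2 := by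
        intro j
        have h2 := plancherel (fun η =>
          (Dt (M - jv ((j + 1) * 2 ^ l)) η - Dt (M - jv (j * 2 ^ l)) η) * φ η)
        rw [Finset.mul_sum] at h2
        calc _ = _ := by
              apply Finset.sum_congr rfl; intro x _
              simp only [hXv]; rw [← Finset.sum_sub_distrib]; congr 1
              apply Finset.sum_congr rfl; intros; ring
            _ = _ := h2
            _ = _ := by apply Finset.sum_congr rfl; intros; ring
      simp_rw [h1]
      rw [Finset.sum_comm, hP, Finset.mul_sum, Finset.mul_sum]
      apply Finset.sum_le_sum; intro η _
      rw [← Finset.mul_sum]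
      have h2 := hDtvar η (2 ^ (L - l)) (fun j => jv (j * 2 ^ l))
        (fun i j h => hjvmono (Nat.mul_le_mul_right _ h)) (fun i => hjvM _)
      have h3 : (0:ℝ) ≤ 2 ^ M * φ η ^ 2 := by positivity
      have h4 := mul_le_mul_of_nonneg_left h2 h3
      linarith
    have s4 : ∑ x, ∑ v ∈ Finset.range (2 ^ L + 1), Ms v x ≤
        131 * (2 * L0 + 1 : ℝ) ^ 2 * (H * P) := by
      rw [Finset.sum_comm]
      refine (Finset.sum_le_sum fun v _ => hMs2 v).trans ?_
      rw [← Finset.mul_sum, Finset.sum_comm]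
      have h1 : ∑ η, ∑ v ∈ Finset.range (2 ^ L + 1),
          (if Cn (M - kap X η) = v then φ η ^ 2 else 0) ≤ ∑ η, φ η ^ 2 := by
        apply Finset.sum_le_sum; intro η _
        rw [Finset.sum_ite_eq]
        split_ifs
        · exact le_rfl
        · positivity
      have h0 : 0 ≤ ∑ η, φ η ^ 2 := by positivity
      have h3 : (0:ℝ) ≤ 131 * (2 * L0 + 1 : ℝ) ^ 2 * 2 ^ M := by positivity
      calc _ ≤ 131 * (2 * L0 + 1 : ℝ) ^ 2 * V ^ 2 * 2 ^ M * ∑ η, φ η ^ 2 :=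
            mul_le_mul_of_nonneg_left h1 (by positivity)
        _ = (131 * (2 * L0 + 1 : ℝ) ^ 2) * (V ^ 2 * P) := by rw [hP]; ring
        _ ≤ _ := by
          apply mul_le_mul_of_nonneg_left _ (by positivity)
          exact mul_le_mul_of_nonneg_right hVH hP0
    have hl0 : (0:ℝ) ≤ L0 := by positivity
    have hHP : 0 ≤ H * P := mul_nonneg hH0 hP0
    have hLL : (L + 1 : ℝ) = 2 * (L0 + 1) := by rw [hL]; push_cast; ring
    rw [hLL] at s3
    have t1 : (L0 + 1 : ℝ) * (H * P) ≤ (L0 + 1 : ℝ) ^ 2 * (H * P) := by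
      apply mul_le_mul_of_nonneg_right _ hHP; nlinarith
    have t2 : (H * P) ≤ (L0 + 1 : ℝ) ^ 2 * (H * P) := by nlinarith
    have t3 : (2 * L0 + 1 : ℝ) ^ 2 * (H * P) ≤ 4 * (L0 + 1 : ℝ) ^ 2 * (H * P) := by
      apply mul_le_mul_of_nonneg_right _ hHP; nlinarith
    have s1' : H * ∑ x, A x ≤ 8 * ((L0 + 1 : ℝ) * (H * P)) := by linarith
    have s3' : ∑ x, RM x ≤ 8 * ((L0 + 1 : ℝ) ^ 2 * (H * P)) := by linarith
    have s4' : ∑ x, ∑ v ∈ Finset.range (2 ^ L + 1), Ms v x ≤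
      524 * ((L0 + 1 : ℝ) ^ 2 * (H * P)) := by linarith
    calc _ ≤ 2184 * ((L0 + 1 : ℝ) ^ 2 * (H * P)) := by linarith
      _ = _ := by ring

end HI

namespace HI
variable {M : ℕ}

/-- time-side dyadic cubes -/
def cu (k : ℕ) (x : GG M) : Finset (GG M) :=
  Finset.univ.filter fun y => ∀ i : Fin M, (i : ℕ) < k → y i = x i

lemma mem_cu {k : ℕ} {x y : GG M} : y ∈ cu k x ↔ ∀ i : Fin M, (i : ℕ) < k → y i = x i := by
  simp [cu]

lemma self_mem_cu (k : ℕ) (x : GG M) : x ∈ cu k x := mem_cu.2 fun _ _ => rfl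

lemma cu_eq {k l : ℕ} (hl : l ≤ k) {x y : GG M} (h : y ∈ cu k x) : cu l y = cu l x := by
  rw [mem_cu] at h
  ext z
  rw [mem_cu, mem_cu]
  constructor
  · intro hz i hi; rw [hz i hi, h i (by omega)]
  · intro hz i hi; rw [hz i hi, h i (by omega)]

lemma cu_anti {k l : ℕ} (hl : l ≤ k) (x : GG M) : cu k x ⊆ cu l x := by
  intro y hy
  rw [mem_cu] at hy ⊢
  exact fun i hi => hy i (by omega)

lemma cu_zero (x : GG M) : cu 0 x = Finset.univ := by
  ext y; simp [mem_cu]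

lemma cu_top (x : GG M) : cu M x = {x} := by
  ext y; rw [mem_cu, Finset.mem_singleton]
  exact ⟨fun h => funext fun i => h i i.2, fun h i _ => by rw [h]⟩

lemma cu_card_pos (k : ℕ) (x : GG M) : 0 < ((cu k x).card : ℝ) := by
  exact_mod_cast Finset.card_pos.2 ⟨x, self_mem_cu k x⟩

lemma cu_double (k : ℕ) (x : GG M) : ((cu k x).card : ℝ) ≤ 2 * (cu (k + 1) x).card := by
  have h : cu k x ⊆ cu (k + 1) x ∪ (cu (k + 1) x).image (flip k) := by
    intro y hy
    rw [mem_cu] at hy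
    by_cases h : y ∈ cu (k + 1) x
    · exact Finset.mem_union_left _ h
    · apply Finset.mem_union_right
      rw [Finset.mem_image]
      refine ⟨flip k y, ?_, flip_flip k y⟩
      rw [mem_cu]
      rw [mem_cu] at h
      push Not at h
      obtain ⟨j, hj, hne⟩ := h
      have hjk : (j : ℕ) = k := by
        by_contra hh
        exact hne (hy j (by omega))
      intro i hi
      by_cases hik : (i : ℕ) = k
      · have : i = j := Fin.ext (by omega)
        subst this
        rw [← hik, flip_same]
        cases h1 : y i <;> cases h2 : x i <;> simp_all
      · rw [flip_ne i hik]; exact hy i (by omega)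
  have h1 := (Finset.card_le_card h).trans (Finset.card_union_le _ _)
  have h2 := Finset.card_image_le (s := cu (k + 1) x) (f := flip k)
  have : (cu k x).card ≤ 2 * (cu (k + 1) x).card := by omega
  exact_mod_cast this

lemma avg_id (Bd : GG M → Prop) (Q : GG M → Finset (GG M)) (hself : ∀ x, x ∈ Q x)
    (hQ : ∀ x, Bd x → ∀ y ∈ Q x, Bd y ∧ Q y = Q x) (F : GG M → ℝ) :
    ∑ x, (if Bd x then ((Q x).card : ℝ)⁻¹ * ∑ y ∈ Q x, F y else 0) =
      ∑ x, if Bd x then F x else 0 := by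
  have h1 : ∀ x, (if Bd x then ((Q x).card : ℝ)⁻¹ * ∑ y ∈ Q x, F y else 0) =
      ∑ y, if Bd x ∧ y ∈ Q x then ((Q x).card : ℝ)⁻¹ * F y else 0 := by
    intro x
    by_cases h : Bd x
    · simp only [h, if_true, true_and]
      rw [Finset.mul_sum, ← Finset.sum_filter]
      apply Finset.sum_congr _ fun _ _ => rfl
      ext; simp
    · simp [h]
  simp_rw [h1]
  rw [Finset.sum_comm]
  apply Finset.sum_congr rfl
  intro y _
  have h2 : ∀ x, (if Bd x ∧ y ∈ Q x then ((Q x).card : ℝ)⁻¹ * F y else 0) =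
      if Bd y ∧ x ∈ Q y then ((Q y).card : ℝ)⁻¹ * F y else 0 := by
    intro x
    by_cases h : Bd x ∧ y ∈ Q x
    · obtain ⟨h3, h4⟩ := hQ x h.1 y h.2
      rw [if_pos h, if_pos ⟨h3, by rw [h4]; exact hself x⟩, h4]
    · rw [if_neg h, if_neg]
      rintro ⟨h3, h4⟩
      obtain ⟨h5, h6⟩ := hQ y h3 x h4
      exact h ⟨h5, by rw [h6]; exact hself y⟩
  simp_rw [h2]
  by_cases h : Bd y
  · simp only [h, true_and, if_true]
    rw [← Finset.sum_filter]
    have : Finset.univ.filter (fun x => x ∈ Q y) = Q y := by ext; simp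
    rw [this, Finset.sum_const, nsmul_eq_mul, ← mul_assoc, mul_inv_cancel₀, one_mul]
    have := Finset.card_pos.2 ⟨y, hself y⟩
    positivity
  · simp [h]

/-- finite Walsh transform -/
def hat (g : GG M → ℝ) (η : GG M) : ℝ := ∑ y, g y * ww η y

/-- finite multiplier operator -/
def TT (m g : GG M → ℝ) (x : GG M) : ℝ := ((2:ℝ) ^ M)⁻¹ * ∑ η, m η * hat g η * ww η x

lemma hat_add (f g : GG M → ℝ) (η : GG M) : hat (fun x => f x + g x) η = hat f η + hat g η := by
  unfold hat; rw [← Finset.sum_add_distrib]; apply Finset.sum_congr rfl; intros; ring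

lemma TT_add (m f g : GG M → ℝ) (x : GG M) :
    TT m (fun x => f x + g x) x = TT m f x + TT m g x := by
  unfold TT; simp_rw [hat_add]; rw [← mul_add, ← Finset.sum_add_distrib]; congr 1
  apply Finset.sum_congr rfl; intros; ring

lemma ww_sum_cu {k : ℕ} {e e' : GG M} (h : ¬ agree k e e') (z : GG M) :
    ∑ y ∈ cu k z, ww e y * ww e' y = 0 := by
  obtain ⟨i, hi, hne⟩ := exists_of_not_agree h
  have h1 := ww_orth i hne (fun y => if y ∈ cu k z then (1:ℝ) else 0) (by
    intro x
    have : flip (i : ℕ) x ∈ cu k z ↔ x ∈ cu k z := by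
      rw [mem_cu, mem_cu]
      refine forall_congr' fun j => ?_
      constructor
      · intro h hj; rw [← h hj, flip_ne j (by omega)]
      · intro h hj; rw [← h hj, flip_ne j (by omega)]
    simp only [this])
  simp only [ite_mul, one_mul, zero_mul] at h1
  rw [← h1, ← Finset.sum_filter]
  apply Finset.sum_congr _ fun _ _ => rfl
  ext; simp

/-- projection onto the characters `R` on a cube -/
def proj (R : Finset (GG M)) (Q : Finset (GG M)) (g : GG M → ℝ) (x : GG M) : ℝ :=
  ∑ e ∈ R, (((Q.card : ℝ)⁻¹ * ∑ y ∈ Q, g y * ww e y) * ww e x)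

lemma proj_ip {k : ℕ} {R : Finset (GG M)} (hR : ∀ ρ ∈ R, ∀ ρ' ∈ R, ρ ≠ ρ' → ¬ agree k ρ ρ')
    (z : GG M) (g : GG M → ℝ) {e : GG M} (he : e ∈ R) :
    ∑ x ∈ cu k z, proj R (cu k z) g x * ww e x = ∑ y ∈ cu k z, g y * ww e y := by
  unfold proj
  simp_rw [Finset.sum_mul]
  rw [Finset.sum_comm, Finset.sum_eq_single e]
  · have : ∀ x, (((cu k z).card : ℝ)⁻¹ * ∑ y ∈ cu k z, g y * ww e y) * ww e x * ww e x =
        (((cu k z).card : ℝ)⁻¹ * ∑ y ∈ cu k z, g y * ww e y) := by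
      intro x; rw [mul_assoc, ww_mul_self, mul_one]
    simp_rw [this]
    rw [Finset.sum_const, nsmul_eq_mul, ← mul_assoc, mul_inv_cancel₀ (cu_card_pos k z).ne', one_mul]
  · intro e' he' hne
    simp_rw [mul_assoc]
    rw [← Finset.mul_sum, ← Finset.mul_sum, ww_sum_cu (hR e' he' e he hne), mul_zero, mul_zero]
  · exact fun h => absurd he h

lemma proj_sq {k : ℕ} {R : Finset (GG M)} (hR : ∀ ρ ∈ R, ∀ ρ' ∈ R, ρ ≠ ρ' → ¬ agree k ρ ρ')
    (z : GG M) (g : GG M → ℝ) :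
    ∑ x ∈ cu k z, proj R (cu k z) g x ^ 2 ≤
      R.card * (((cu k z).card : ℝ)⁻¹ * (∑ y ∈ cu k z, |g y|) ^ 2) := by
  have h1 : ∑ x ∈ cu k z, proj R (cu k z) g x ^ 2 =
      ∑ e ∈ R, ((cu k z).card : ℝ)⁻¹ * (∑ y ∈ cu k z, g y * ww e y) ^ 2 := by
    have : ∀ x, proj R (cu k z) g x ^ 2 = ∑ e ∈ R,
        (((cu k z).card : ℝ)⁻¹ * ∑ y ∈ cu k z, g y * ww e y) * (proj R (cu k z) g x * ww e x) := by
      intro x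
      rw [sq]
      nth_rewrite 2 [proj]
      rw [Finset.mul_sum]
      apply Finset.sum_congr rfl; intros; ring
    simp_rw [this]
    rw [Finset.sum_comm]
    apply Finset.sum_congr rfl
    intro e he
    rw [← Finset.mul_sum, proj_ip hR z g he]; ring
  rw [h1]
  have : (R.card : ℝ) * (((cu k z).card : ℝ)⁻¹ * (∑ y ∈ cu k z, |g y|) ^ 2) =
    ∑ e ∈ R, (((cu k z).card : ℝ)⁻¹ * (∑ y ∈ cu k z, |g y|) ^ 2) := by simp
  rw [this]
  apply Finset.sum_le_sum
  intro e _
  apply mul_le_mul_of_nonneg_left _ (inv_nonneg.2 (cu_card_pos k z).le)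
  rw [← sq_abs]
  apply pow_le_pow_left₀ (abs_nonneg _)
  refine (Finset.abs_sum_le_sum_abs _ _).trans (Finset.sum_le_sum fun y _ => ?_)
  rw [abs_mul, abs_ww, mul_one]

/-- vanishing of the bad part away from its cube -/
lemma bad_vanish {k : ℕ} (E : Finset (GG M)) (m : GG M → ℝ)
    (hm : ∀ η η', agree k η η' → (∀ e ∈ E, ¬ agree k e η) → m η = m η')
    (z x : GG M) (hx : x ∉ cu k z) (b : GG M → ℝ)
    (hb : ∀ e ∈ E, ∀ η, agree k e η → ∑ y ∈ cu k z, b y * ww η y = 0) :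
    ∑ η, m η * (∑ y ∈ cu k z, b y * ww η y) * ww η x = 0 := by
  rw [mem_cu] at hx
  push Not at hx
  obtain ⟨i, hi, hne⟩ := hx
  apply sum_odd (k := i)
  intro η
  have hag : agree k η (flip (i : ℕ) η) := by
    intro j hj; rw [flip_ne j (by omega)]
  by_cases hE : ∃ e ∈ E, agree k e η
  · obtain ⟨e, he, h1⟩ := hE
    rw [hb e he η h1, hb e he _ (h1.trans hag)]; simp
  · push Not at hE
    rw [← hm η _ hag hE, ww_comm (flip _ _), ww_flip, ww_comm x]
    have h2 : ∑ y ∈ cu k z, b y * ww (flip (i : ℕ) η) y =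
        sg (z i) true * ∑ y ∈ cu k z, b y * ww η y := by
      rw [Finset.mul_sum]
      apply Finset.sum_congr rfl
      intro y hy
      rw [ww_comm, ww_flip, ww_comm, (mem_cu.1 hy) i hi]; ring
    rw [h2]
    have h3 := sg_ne hne
    linear_combination (m η * (∑ y ∈ cu k z, b y * ww η y) * ww η x) * h3

end HI

namespace HI
variable {M : ℕ}

lemma cheb (m : ℕ → GG M → ℝ) {A : ℝ}
    (hL2 : ∀ g : GG M → ℝ, ∃ Mx : GG M → ℝ, (∀ x, ∀ k ≤ M, (TT (m k) g x) ^ 2 ≤ Mx x) ∧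
      ∑ x, Mx x ≤ A ^ 2 * ∑ x, g x ^ 2) (g : GG M → ℝ) {t : ℝ} (ht : 0 < t) :
    ((Finset.univ.filter fun x => ∃ k ≤ M, t < |TT (m k) g x|).card : ℝ) ≤
      A ^ 2 * (∑ x, g x ^ 2) / t ^ 2 := by
  obtain ⟨Mx, h1, h2⟩ := hL2 g
  rw [le_div_iff₀ (by positivity)]
  refine le_trans ?_ h2
  have h0 : ∀ x, 0 ≤ Mx x := fun x => (sq_nonneg _).trans (h1 x 0 (Nat.zero_le _))
  calc _ = ∑ x ∈ Finset.univ.filter (fun x => ∃ k ≤ M, t < |TT (m k) g x|), t ^ 2 := by simp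
    _ ≤ ∑ x ∈ Finset.univ.filter (fun x => ∃ k ≤ M, t < |TT (m k) g x|), Mx x := by
      apply Finset.sum_le_sum
      intro x hx
      simp only [Finset.mem_filter, Finset.mem_univ, true_and] at hx
      obtain ⟨k, hk, h3⟩ := hx
      refine le_trans ?_ (h1 x k hk)
      rw [← sq_abs (TT _ _ _)]
      exact pow_le_pow_left₀ ht.le h3.le 2
    _ ≤ _ := Finset.sum_le_sum_of_subset_of_nonneg (Finset.filter_subset _ _) fun x _ _ => h0 x

lemma cz (E : Finset (GG M)) (N : ℝ) (hN : 1 ≤ N) (hE : (E.card : ℝ) ≤ N) (m : ℕ → GG M → ℝ)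
    (hm : ∀ k ≤ M, ∀ k0 η η', agree k0 η η' → (∀ e ∈ E, ¬ agree k0 e η) → m k η = m k η')
    {A : ℝ}
    (hL2 : ∀ g : GG M → ℝ, ∃ Mx : GG M → ℝ, (∀ x, ∀ k ≤ M, (TT (m k) g x) ^ 2 ≤ Mx x) ∧
      ∑ x, Mx x ≤ A ^ 2 * ∑ x, g x ^ 2) (g : GG M → ℝ) {t l : ℝ} (ht : 0 < t) (hl : 0 < l) :
    ((Finset.univ.filter fun x => ∃ k ≤ M, t < |TT (m k) g x|).card : ℝ) ≤
      (∑ x, |g x|) / l + 2 * N * A ^ 2 * l * (∑ x, |g x|) / t ^ 2 := by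
  have hg0 : 0 ≤ ∑ x, |g x| := Finset.sum_nonneg fun _ _ => abs_nonneg _
  have hA0 : 0 ≤ 2 * N * A ^ 2 * l * (∑ x, |g x|) / t ^ 2 := by positivity
  by_cases htriv : l * 2 ^ M < ∑ x, |g x|
  · have h1 : ((Finset.univ.filter fun x => ∃ k ≤ M, t < |TT (m k) g x|).card : ℝ) ≤ 2 ^ M := by
      rw [← card_GG]
      exact_mod_cast Finset.card_le_univ _
    have h2 : (2:ℝ) ^ M ≤ (∑ x, |g x|) / l := by
      rw [le_div_iff₀ hl]; linarith
    linarith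
  set P : GG M → ℕ → Prop := fun x k => l * (cu k x).card < ∑ y ∈ cu k x, |g y| with hP
  set Bd : GG M → Prop := fun x => ∃ k, P x k with hBd
  set kk : GG M → ℕ := fun x => if h : ∃ k, P x k then Nat.find h else 0 with hkk
  have hkP : ∀ x, Bd x → P x (kk x) := by
    intro x hx
    simp only [hkk]; rw [dif_pos hx]; exact Nat.find_spec hx
  have hkmin : ∀ x, Bd x → ∀ j < kk x, ¬ P x j := by
    intro x hx j hj
    simp only [hkk] at hj; rw [dif_pos hx] at hj; exact Nat.find_min hx hj
  set Q : GG M → Finset (GG M) := fun x => cu (kk x) x with hQ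
  have hPeq : ∀ x y k, y ∈ cu k x → ∀ j ≤ k, (P y j ↔ P x j) := by
    intro x y k hy j hj
    simp only [hP, cu_eq hj hy]
  have hkeq : ∀ x, Bd x → ∀ y ∈ Q x, Bd y ∧ kk y = kk x := by
    intro x hx y hy
    have h1 : P y (kk x) := (hPeq x y _ hy _ le_rfl).2 (hkP x hx)
    have hy' : Bd y := ⟨_, h1⟩
    refine ⟨hy', le_antisymm ?_ ?_⟩
    · by_contra h; exact hkmin y hy' _ (not_le.1 h) h1
    · by_contra h
      push Not at h
      exact hkmin x hx _ h ((hPeq x y _ hy _ h.le).1 (hkP y hy'))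
  have hQself : ∀ x, x ∈ Q x := fun x => self_mem_cu _ _
  have hQQ : ∀ x, Bd x → ∀ y ∈ Q x, Bd y ∧ Q y = Q x := by
    intro x hx y hy
    obtain ⟨h1, h2⟩ := hkeq x hx y hy
    refine ⟨h1, ?_⟩
    simp only [hQ]; rw [h2]; exact cu_eq le_rfl hy
  have hkpos : ∀ x, Bd x → 1 ≤ kk x := by
    intro x hx
    by_contra h
    have h0 : kk x = 0 := by omega
    have h1 := hkP x hx
    simp only [hP, h0, cu_zero] at h1
    apply htriv
    have : ((Finset.univ : Finset (GG M)).card : ℝ) = 2 ^ M := by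
      rw [Finset.card_univ, card_GG]
    rwa [this] at h1
  have hup : ∀ x, Bd x → ∑ y ∈ Q x, |g y| ≤ 2 * l * (Q x).card := by
    intro x hx
    have h1 := hkmin x hx (kk x - 1) (by have := hkpos x hx; omega)
    simp only [hP, not_lt] at h1
    have h2 := cu_double (kk x - 1) x
    rw [show kk x - 1 + 1 = kk x by have := hkpos x hx; omega] at h2
    calc _ ≤ ∑ y ∈ cu (kk x - 1) x, |g y| :=
          Finset.sum_le_sum_of_subset_of_nonneg (cu_anti (by omega) x) fun _ _ _ => abs_nonneg _
      _ ≤ l * (cu (kk x - 1) x).card := h1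
      _ ≤ l * (2 * (cu (kk x) x).card) := mul_le_mul_of_nonneg_left h2 hl.le
      _ = _ := by simp only [hQ]; ring
  have hgood : ∀ x, ¬ Bd x → |g x| ≤ l := by
    intro x hx
    by_contra h
    apply hx
    refine ⟨M, ?_⟩
    simp only [hP, cu_top]; simp; linarith
  choose R hRE hRd hRc using fun k => reps E k
  set γ : GG M → ℝ := fun x => if Bd x then proj (R (kk x)) (Q x) g x else g x with hγ
  set β : GG M → ℝ := fun x => if Bd x then g x - γ x else 0 with hβ
  have hsplit : g = fun x => γ x + β x := by
    funext x
    simp only [hβ]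
    by_cases h : Bd x
    · simp [h]
    · simp [h, hγ]
  have hγQ : ∀ x, Bd x → ∀ y ∈ Q x, γ y = proj (R (kk x)) (cu (kk x) x) g y := by
    intro x hx y hy
    have h1 := hkeq x hx y hy
    have h2 := hQQ x hx y hy
    simp only [hγ]
    rw [if_pos h1.1, h1.2, h2.2]
  -- size of the good part
  have hγ2 : ∑ x, γ x ^ 2 ≤ 2 * N * l * ∑ x, |g x| := by
    have e1 : ∑ x, γ x ^ 2 = (∑ x, if Bd x then γ x ^ 2 else 0) +
        ∑ x, if Bd x then 0 else g x ^ 2 := by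
      rw [← Finset.sum_add_distrib]
      apply Finset.sum_congr rfl
      intro x _
      by_cases h : Bd x <;> simp [h, hγ]
    have e2 : ∑ x, |g x| = (∑ x, if Bd x then |g x| else 0) +
        ∑ x, if Bd x then 0 else |g x| := by
      rw [← Finset.sum_add_distrib]
      apply Finset.sum_congr rfl
      intro x _
      by_cases h : Bd x <;> simp [h]
    rw [e1, e2, mul_add]
    apply add_le_add
    · rw [← avg_id Bd Q hQself hQQ (fun x => γ x ^ 2), ← avg_id Bd Q hQself hQQ (fun x => |g x|),
        Finset.mul_sum]
      apply Finset.sum_le_sum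
      intro x _
      by_cases hx : Bd x
      · rw [if_pos hx, if_pos hx]
        have hc : 0 < ((Q x).card : ℝ) := cu_card_pos _ _
        have h1 : ∑ y ∈ Q x, γ y ^ 2 =
            ∑ y ∈ cu (kk x) x, proj (R (kk x)) (cu (kk x) x) g y ^ 2 := by
          apply Finset.sum_congr rfl
          intro y hy; rw [hγQ x hx y hy]
        have h2 := proj_sq (hRd (kk x)) x g
        have h3 : ((R (kk x)).card : ℝ) ≤ N :=
          le_trans (by exact_mod_cast Finset.card_le_card (hRE (kk x))) hE
        have hs0 : 0 ≤ ∑ y ∈ Q x, |g y| := Finset.sum_nonneg fun _ _ => abs_nonneg _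
        have h4 : (∑ y ∈ Q x, |g y|) ^ 2 ≤ 2 * l * (Q x).card * ∑ y ∈ Q x, |g y| := by
          rw [sq]; exact mul_le_mul_of_nonneg_right (hup x hx) hs0
        have h5 : ((Q x).card : ℝ)⁻¹ * (∑ y ∈ Q x, |g y|) ^ 2 ≤ 2 * l * ∑ y ∈ Q x, |g y| := by
          rw [inv_mul_le_iff₀ hc]; linarith
        have h6 : ∑ y ∈ Q x, γ y ^ 2 ≤ N * (2 * l * ∑ y ∈ Q x, |g y|) := by
          rw [h1]
          refine h2.trans ?_
          exact mul_le_mul h3 h5 (mul_nonneg (inv_nonneg.2 hc.le) (sq_nonneg _)) (by linarith)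
        have h7 := mul_le_mul_of_nonneg_left h6 (inv_nonneg.2 hc.le)
        linarith
      · simp [hx]
    · rw [Finset.mul_sum]
      apply Finset.sum_le_sum
      intro x _
      by_cases hx : Bd x
      · simp [hx]
      · rw [if_neg hx, if_neg hx, ← sq_abs, sq]
        apply mul_le_mul_of_nonneg_right _ (abs_nonneg _)
        have := hgood x hx
        nlinarith
  -- size of the bad set
  have hBdcard : ((Finset.univ.filter Bd).card : ℝ) ≤ (∑ x, |g x|) / l := by
    rw [le_div_iff₀ hl]
    calc _ = ∑ x, if Bd x then l else 0 := by
          rw [← Finset.sum_filter, Finset.sum_const, nsmul_eq_mul]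
      _ ≤ ∑ x, (if Bd x then ((Q x).card : ℝ)⁻¹ * ∑ y ∈ Q x, |g y| else 0) := by
          apply Finset.sum_le_sum
          intro x _
          by_cases hx : Bd x
          · rw [if_pos hx, if_pos hx]
            have hc : 0 < ((Q x).card : ℝ) := cu_card_pos _ _
            rw [le_inv_mul_iff₀ hc, mul_comm]
            exact (hkP x hx).le
          · simp [hx]
      _ = ∑ x, if Bd x then |g x| else 0 := avg_id Bd Q hQself hQQ _
      _ ≤ _ := by
          apply Finset.sum_le_sum
          intro x _
          split_ifs
          · exact le_rfl
          · exact abs_nonneg _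
  -- the bad part vanishes outside
  have hvan : ∀ k ≤ M, ∀ x, ¬ Bd x → TT (m k) β x = 0 := by
    intro k hk x hx
    unfold TT
    apply mul_eq_zero_of_right
    have h1 : ∀ η, hat β η =
        ∑ z, (if Bd z then ((Q z).card : ℝ)⁻¹ * ∑ y ∈ Q z, (g y - γ y) * ww η y else 0) := by
      intro η
      rw [avg_id Bd Q hQself hQQ (fun y => (g y - γ y) * ww η y)]
      unfold hat
      apply Finset.sum_congr rfl
      intro y _
      simp only [hβ]
      split_ifs <;> simp
    simp_rw [h1, Finset.mul_sum, Finset.sum_mul]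
    rw [Finset.sum_comm]
    apply Finset.sum_eq_zero
    intro z _
    by_cases hz : Bd z
    · simp only [hz, if_true]
      have hxz : x ∉ cu (kk z) z := fun h => hx (hkeq z hz x h).1
      have h2 := bad_vanish (k := kk z) E (m k) (hm k hk (kk z)) z x hxz (fun y => g y - γ y) (by
        intro e he η hag
        obtain ⟨ρ, hρ, h3⟩ := hRc (kk z) e he
        have h4 : agree (kk z) η ρ := hag.symm.trans h3
        have h5 := ww_mul_dep h4
        have h6 : ∀ y ∈ cu (kk z) z, (g y - γ y) * ww η y =
            (ww η z * ww ρ z) * (g y * ww ρ y - proj (R (kk z)) (cu (kk z) z) g y * ww ρ y) := by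
          intro y hy
          rw [← hγQ z hz y hy]
          have h7 : ww η y * ww ρ y = ww η z * ww ρ z := h5 y z (mem_cu.1 hy)
          rw [← h7]
          have h8 := ww_mul_self ρ y
          linear_combination (-(g y - γ y) * ww η y) * h8
        rw [Finset.sum_congr rfl h6, ← Finset.mul_sum, Finset.sum_sub_distrib,
          proj_ip (hRd (kk z)) z g hρ, sub_self, mul_zero])
      have h3 : ∑ η, m k η * (((Q z).card : ℝ)⁻¹ * ∑ y ∈ Q z, (g y - γ y) * ww η y) * ww η x =
          ((Q z).card : ℝ)⁻¹ *
            ∑ η, m k η * (∑ y ∈ cu (kk z) z, (g y - γ y) * ww η y) * ww η x := by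
        rw [Finset.mul_sum]; apply Finset.sum_congr rfl; intros; ring
      rw [h2, mul_zero] at h3
      rw [← h3]
      apply Finset.sum_congr rfl
      intro η _
      rw [Finset.mul_sum, Finset.mul_sum, Finset.mul_sum]
    · simp [hz]
  have hsub : (Finset.univ.filter fun x => ∃ k ≤ M, t < |TT (m k) g x|) ⊆
      Finset.univ.filter Bd ∪ Finset.univ.filter fun x => ∃ k ≤ M, t < |TT (m k) γ x| := by
    intro x hx
    simp only [Finset.mem_filter, Finset.mem_univ, true_and, Finset.mem_union] at hx ⊢
    by_cases hb : Bd x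
    · exact Or.inl hb
    · right
      obtain ⟨k, hk, h⟩ := hx
      refine ⟨k, hk, ?_⟩
      rw [hsplit, TT_add, hvan k hk x hb, add_zero] at h
      exact h
  have hc := (Finset.card_le_card hsub).trans (Finset.card_union_le _ _)
  have hc' : ((Finset.univ.filter fun x => ∃ k ≤ M, t < |TT (m k) g x|).card : ℝ) ≤
      (Finset.univ.filter Bd).card +
        (Finset.univ.filter fun x => ∃ k ≤ M, t < |TT (m k) γ x|).card := by exact_mod_cast hc
  refine hc'.trans (add_le_add hBdcard ((cheb m hL2 γ ht).trans ?_))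
  apply div_le_div_of_nonneg_right _ (by positivity)
  have := mul_le_mul_of_nonneg_left hγ2 (sq_nonneg A)
  linarith

lemma weak (E : Finset (GG M)) (N : ℝ) (hN : 1 ≤ N) (hE : (E.card : ℝ) ≤ N) (m : ℕ → GG M → ℝ)
    (hm : ∀ k ≤ M, ∀ k0 η η', agree k0 η η' → (∀ e ∈ E, ¬ agree k0 e η) → m k η = m k η')
    {A : ℝ} (hA : 0 < A)
    (hL2 : ∀ g : GG M → ℝ, ∃ Mx : GG M → ℝ, (∀ x, ∀ k ≤ M, (TT (m k) g x) ^ 2 ≤ Mx x) ∧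
      ∑ x, Mx x ≤ A ^ 2 * ∑ x, g x ^ 2) (g : GG M → ℝ) {t : ℝ} (ht : 0 < t) :
    ((Finset.univ.filter fun x => ∃ k ≤ M, t < |TT (m k) g x|).card : ℝ) ≤
      3 * (A * √N) * (∑ x, |g x|) / t := by
  have hs : 0 < √N := Real.sqrt_pos.2 (by linarith)
  refine (cz E N hN hE m hm hL2 g ht (l := t / (A * √N)) (by positivity)).trans (le_of_eq ?_)
  have h2 : N = √N * √N := (Real.mul_self_sqrt (by linarith)).symm
  generalize (√N) = s at *
  subst h2
  field_simp
  ring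

end HI

namespace HI
variable {M : ℕ}

lemma geo_up {α : ℝ} (hα : 0 < α) {τ : ℝ} (hτ : 0 < τ) (n : ℕ) : ∀ v : ℝ, 0 < v →
    ∑ i ∈ Finset.range n, (if τ * 2 ^ i ≤ v then (τ * 2 ^ i) ^ α else 0) ≤
      (1 - (2:ℝ) ^ (-α))⁻¹ * v ^ α := by
  have h2 : (2:ℝ) ^ (-α) < 1 := Real.rpow_lt_one_of_one_lt_of_neg (by norm_num) (by linarith)
  have hC : 0 < 1 - (2:ℝ) ^ (-α) := by linarith
  induction n with
  | zero => intro v hv; simp; positivity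
  | succ n ih =>
    intro v hv
    rw [Finset.sum_range_succ]
    by_cases h : τ * 2 ^ n ≤ v
    · rw [if_pos h]
      have h0 : 0 < τ * 2 ^ n := by positivity
      have h3 : ∑ i ∈ Finset.range n, (if τ * 2 ^ i ≤ v then (τ * 2 ^ i) ^ α else 0) ≤
          ∑ i ∈ Finset.range n, (if τ * 2 ^ i ≤ τ * 2 ^ n / 2 then (τ * 2 ^ i) ^ α else 0) := by
        apply Finset.sum_le_sum
        intro i hi
        have hi' : i + 1 ≤ n := Finset.mem_range.1 hi
        have h4 : (2:ℝ) ^ (i + 1) ≤ 2 ^ n := pow_le_pow_right₀ (by norm_num) hi'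
        have h5 : τ * 2 ^ i ≤ τ * 2 ^ n / 2 := by
          rw [pow_succ] at h4; nlinarith
        rw [if_pos h5]
        split_ifs
        · exact le_rfl
        · positivity
      have h4 := ih (τ * 2 ^ n / 2) (by positivity)
      have h5 : (τ * 2 ^ n / 2) ^ α = (2:ℝ) ^ (-α) * (τ * 2 ^ n) ^ α := by
        rw [Real.div_rpow h0.le (by norm_num), Real.rpow_neg (by norm_num)]; ring
      rw [h5] at h4
      have h6 : (τ * 2 ^ n) ^ α ≤ v ^ α := Real.rpow_le_rpow h0.le h hα.le
      have h7 : (1 - (2:ℝ) ^ (-α))⁻¹ * ((2:ℝ) ^ (-α) * (τ * 2 ^ n) ^ α) + (τ * 2 ^ n) ^ α =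
          (1 - (2:ℝ) ^ (-α))⁻¹ * (τ * 2 ^ n) ^ α := by
        field_simp; ring
      calc _ ≤ (1 - (2:ℝ) ^ (-α))⁻¹ * ((2:ℝ) ^ (-α) * (τ * 2 ^ n) ^ α) + (τ * 2 ^ n) ^ α := by
            linarith
        _ = _ := h7
        _ ≤ _ := mul_le_mul_of_nonneg_left h6 (inv_nonneg.2 hC.le)
    · rw [if_neg h, add_zero]; exact ih v hv

lemma geo_dn {α : ℝ} (hα : 0 < α) (n : ℕ) : ∀ τ : ℝ, 0 < τ → ∀ v : ℝ, 0 < v →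
    ∑ i ∈ Finset.range n, (if v ≤ τ * 2 ^ i then (τ * 2 ^ i) ^ (-α) else 0) ≤
      (1 - (2:ℝ) ^ (-α))⁻¹ * v ^ (-α) := by
  have h2 : (2:ℝ) ^ (-α) < 1 := Real.rpow_lt_one_of_one_lt_of_neg (by norm_num) (by linarith)
  have hC : 0 < 1 - (2:ℝ) ^ (-α) := by linarith
  induction n with
  | zero => intro τ hτ v hv; simp; positivity
  | succ n ih =>
    intro τ hτ v hv
    rw [Finset.sum_range_succ']
    have e : ∀ i : ℕ, τ * 2 ^ (i + 1) = (2 * τ) * 2 ^ i := fun i => by ring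
    simp_rw [e]
    rw [pow_zero, mul_one]
    by_cases h : v ≤ τ
    · rw [if_pos h]
      have h3 : ∑ i ∈ Finset.range n, (if v ≤ (2 * τ) * 2 ^ i then ((2 * τ) * 2 ^ i) ^ (-α) else 0) ≤
          ∑ i ∈ Finset.range n,
            (if 2 * τ ≤ (2 * τ) * 2 ^ i then ((2 * τ) * 2 ^ i) ^ (-α) else 0) := by
        apply Finset.sum_le_sum
        intro i hi
        have h4 : (1:ℝ) ≤ 2 ^ i := one_le_pow₀ (by norm_num)
        rw [if_pos (by nlinarith : 2 * τ ≤ 2 * τ * 2 ^ i)]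
        split_ifs
        · exact le_rfl
        · positivity
      have h4 := ih (2 * τ) (by positivity) (2 * τ) (by positivity)
      have h5 : (2 * τ) ^ (-α) = (2:ℝ) ^ (-α) * τ ^ (-α) := by
        rw [Real.mul_rpow (by norm_num) hτ.le]
      rw [h5] at h4
      have h6 : τ ^ (-α) ≤ v ^ (-α) := Real.rpow_le_rpow_of_nonpos hv h (by linarith)
      have h7 : (1 - (2:ℝ) ^ (-α))⁻¹ * ((2:ℝ) ^ (-α) * τ ^ (-α)) + τ ^ (-α) =
          (1 - (2:ℝ) ^ (-α))⁻¹ * τ ^ (-α) := by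
        field_simp; ring
      calc _ ≤ (1 - (2:ℝ) ^ (-α))⁻¹ * ((2:ℝ) ^ (-α) * τ ^ (-α)) + τ ^ (-α) := by
            linarith
        _ = _ := h7
        _ ≤ _ := mul_le_mul_of_nonneg_left h6 (inv_nonneg.2 hC.le)
    · rw [if_neg h, add_zero]; exact ih (2 * τ) (by positivity) v hv

/-- dyadic layer cake -/
lemma layer {q : ℝ} (hq : 0 < q) (S : GG M → ℝ) (hS : ∀ x, 0 ≤ S x) :
    ∃ τ : ℝ, 0 < τ ∧ ∃ n : ℕ, ∑ x, S x ^ q ≤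
      2 ^ q * ∑ i ∈ Finset.range n, (τ * 2 ^ i) ^ q *
        ((Finset.univ.filter fun x => τ * 2 ^ i < S x).card : ℝ) := by
  obtain ⟨τ, hτ, hτ1⟩ : ∃ τ : ℝ, 0 < τ ∧ ∀ x, 0 < S x → τ < S x := by
    have : ∀ s : Finset (GG M), ∃ τ : ℝ, 0 < τ ∧ ∀ x ∈ s, 0 < S x → τ < S x := by
      intro s
      induction s using Finset.induction_on with
      | empty => exact ⟨1, one_pos, by simp⟩
      | insert a s ha ih =>
        obtain ⟨τ, h1, h2⟩ := ih
        by_cases h : 0 < S a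
        · refine ⟨min τ (S a / 2), by positivity, ?_⟩
          intro x hx hx0
          rcases Finset.mem_insert.1 hx with rfl | hx
          · exact (min_le_right _ _).trans_lt (by linarith)
          · exact (min_le_left _ _).trans_lt (h2 x hx hx0)
        · refine ⟨τ, h1, ?_⟩
          intro x hx hx0
          rcases Finset.mem_insert.1 hx with rfl | hx
          · exact absurd hx0 h
          · exact h2 x hx hx0
    obtain ⟨τ, h1, h2⟩ := this Finset.univ
    exact ⟨τ, h1, fun x => h2 x (Finset.mem_univ x)⟩
  obtain ⟨n, hn⟩ : ∃ n : ℕ, ∀ x, S x ≤ τ * 2 ^ n := by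
    obtain ⟨n, hn⟩ := pow_unbounded_of_one_lt ((∑ x, S x) / τ) (one_lt_two)
    refine ⟨n, fun x => ?_⟩
    have h1 : S x ≤ ∑ x, S x := Finset.single_le_sum (fun x _ => hS x) (Finset.mem_univ x)
    rw [div_lt_iff₀ hτ] at hn
    linarith
  refine ⟨τ, hτ, n, ?_⟩
  have h1 : ∀ i, (τ * 2 ^ i) ^ q * ((Finset.univ.filter fun x => τ * 2 ^ i < S x).card : ℝ) =
      ∑ x, if τ * 2 ^ i < S x then (τ * 2 ^ i) ^ q else 0 := by
    intro i
    rw [← Finset.sum_filter, Finset.sum_const, nsmul_eq_mul, mul_comm]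
  simp_rw [h1]
  rw [Finset.sum_comm, Finset.mul_sum]
  apply Finset.sum_le_sum
  intro x _
  have hnn : ∀ i ∈ Finset.range n, 0 ≤ (if τ * 2 ^ i < S x then (τ * 2 ^ i) ^ q else 0) := by
    intro i _; split_ifs <;> positivity
  by_cases hx : 0 < S x
  · have hne : ∃ i, S x ≤ τ * 2 ^ i := ⟨n, hn x⟩
    set j := Nat.find hne with hj
    have h2 : S x ≤ τ * 2 ^ j := Nat.find_spec hne
    have hj0 : j ≠ 0 := by
      intro h; rw [h] at h2; have := hτ1 x hx; simp at h2; linarith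
    obtain ⟨i, hi⟩ := Nat.exists_eq_succ_of_ne_zero hj0
    have hin : j ≤ n := Nat.find_min' hne (hn x)
    have h3 : τ * 2 ^ i < S x := by
      by_contra h
      exact Nat.find_min hne (show i < j by omega) (not_lt.1 h)
    have h4 := Finset.single_le_sum hnn (a := i) (Finset.mem_range.2 (by omega))
    rw [if_pos h3] at h4
    calc S x ^ q ≤ (τ * 2 ^ j) ^ q := Real.rpow_le_rpow hx.le h2 hq.le
      _ = 2 ^ q * (τ * 2 ^ i) ^ q := by
        rw [← Real.mul_rpow (by norm_num) (by positivity), hi, Nat.succ_eq_add_one, pow_succ]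
        congr 1; ring
      _ ≤ _ := mul_le_mul_of_nonneg_left h4 (by positivity)
  · have : S x = 0 := le_antisymm (not_lt.1 hx) (hS x)
    rw [this, Real.zero_rpow hq.ne']
    exact mul_nonneg (by positivity) (Finset.sum_nonneg (by rw [this] at hnn; exact hnn))

/-- constant in Marcinkiewicz -/
def Cq (q : ℝ) : ℝ := 2 ^ q * (6 * (1 - (2:ℝ) ^ (-(q - 1)))⁻¹ + 4 * (1 - (2:ℝ) ^ (-(2 - q)))⁻¹)

lemma marc {q : ℝ} (hq1 : 1 < q) (hq2 : q < 2)
    (E : Finset (GG M)) (N : ℝ) (hN : 1 ≤ N) (hE : (E.card : ℝ) ≤ N) (m : ℕ → GG M → ℝ)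
    (hm : ∀ k ≤ M, ∀ k0 η η', agree k0 η η' → (∀ e ∈ E, ¬ agree k0 e η) → m k η = m k η')
    {A : ℝ} (hA : 0 < A)
    (hL2 : ∀ g : GG M → ℝ, ∃ Mx : GG M → ℝ, (∀ x, ∀ k ≤ M, (TT (m k) g x) ^ 2 ≤ Mx x) ∧
      ∑ x, Mx x ≤ A ^ 2 * ∑ x, g x ^ 2) (g : GG M → ℝ) (S : GG M → ℝ) (hS : ∀ x, 0 ≤ S x)
    (hST : ∀ x, ∃ k ≤ M, S x ≤ |TT (m k) g x|) :
    ∑ x, S x ^ q ≤ Cq q * (A ^ q * N ^ (1 - q / 2)) * ∑ x, |g x| ^ q := by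
  obtain ⟨τ, hτ, n, h1⟩ := layer (by linarith : 0 < q) S hS
  refine h1.trans ?_
  have hsN : 0 < √N := Real.sqrt_pos.2 (by linarith)
  set c : ℝ := √N / A with hc
  have hc0 : 0 < c := by positivity
  -- estimate at one level
  have hlev : ∀ t : ℝ, 0 < t → t ^ q * ((Finset.univ.filter fun x => t < S x).card : ℝ) ≤
      ∑ y, (6 * (A * √N) * |g y| * (if t ≤ |g y| / c then t ^ (q - 1) else 0) +
        4 * A ^ 2 * g y ^ 2 * (if |g y| / c ≤ t then t ^ (-(2 - q)) else 0)) := by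
    intro t ht
    set g1 : GG M → ℝ := fun y => if t ≤ |g y| / c then g y else 0 with hg1
    set g2 : GG M → ℝ := fun y => if t ≤ |g y| / c then 0 else g y with hg2
    have hsp : g = fun y => g1 y + g2 y := by
      funext y; simp only [hg1, hg2]; split_ifs <;> simp
    have hw := weak E N hN hE m hm hA hL2 g1 (half_pos ht)
    have hch := cheb m hL2 g2 (half_pos ht)
    have hsub : (Finset.univ.filter fun x => t < S x) ⊆
        (Finset.univ.filter fun x => ∃ k ≤ M, t / 2 < |TT (m k) g1 x|) ∪
        (Finset.univ.filter fun x => ∃ k ≤ M, t / 2 < |TT (m k) g2 x|) := by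
      intro x hx
      simp only [Finset.mem_filter, Finset.mem_univ, true_and, Finset.mem_union] at hx ⊢
      obtain ⟨k, hk, h2⟩ := hST x
      by_contra hcon
      push Not at hcon
      have h3 := hcon.1 k hk
      have h4 := hcon.2 k hk
      rw [hsp, TT_add] at h2
      have := abs_add_le (TT (m k) g1 x) (TT (m k) g2 x)
      linarith
    have hcard := (Finset.card_le_card hsub).trans (Finset.card_union_le _ _)
    have hcard' : ((Finset.univ.filter fun x => t < S x).card : ℝ) ≤
        3 * (A * √N) * (∑ x, |g1 x|) / (t / 2) + A ^ 2 * (∑ x, g2 x ^ 2) / (t / 2) ^ 2 :=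
      le_trans (by exact_mod_cast hcard) (add_le_add hw hch)
    refine (mul_le_mul_of_nonneg_left hcard' (by positivity)).trans ?_
    have e1 : t ^ q = t * t ^ (q - 1) := by
      rw [← Real.rpow_one_add' ht.le (by linarith)]; congr 1; ring
    have e2 : t ^ q = t ^ 2 * t ^ (-(2 - q)) := by
      rw [← Real.rpow_natCast t 2, ← Real.rpow_add ht]; congr 1; push_cast; ring
    rw [mul_add, Finset.sum_add_distrib]
    apply add_le_add
    · rw [e1]
      have : t * t ^ (q - 1) * (3 * (A * √N) * (∑ x, |g1 x|) / (t / 2)) =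
          6 * (A * √N) * (t ^ (q - 1)) * ∑ x, |g1 x| := by
        field_simp; ring
      rw [this, Finset.mul_sum]
      apply Finset.sum_le_sum
      intro y _
      simp only [hg1]
      split_ifs
      · apply le_of_eq; ring
      · simp
    · rw [e2]
      have : t ^ 2 * t ^ (-(2 - q)) * (A ^ 2 * (∑ x, g2 x ^ 2) / (t / 2) ^ 2) =
          4 * A ^ 2 * (t ^ (-(2 - q))) * ∑ x, g2 x ^ 2 := by
        field_simp; ring
      rw [this, Finset.mul_sum]
      apply Finset.sum_le_sum
      intro y _
      simp only [hg2]
      split_ifs with h3 h4 h4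
      · simp; positivity
      · simp
      · apply le_of_eq; ring
      · exact absurd (not_le.1 h3).le h4
  calc _ ≤ 2 ^ q * ∑ i ∈ Finset.range n, ∑ y,
        (6 * (A * √N) * |g y| * (if τ * 2 ^ i ≤ |g y| / c then (τ * 2 ^ i) ^ (q - 1) else 0) +
        4 * A ^ 2 * g y ^ 2 * (if |g y| / c ≤ τ * 2 ^ i then (τ * 2 ^ i) ^ (-(2 - q)) else 0)) := by
        apply mul_le_mul_of_nonneg_left _ (by positivity)
        exact Finset.sum_le_sum fun i _ => hlev _ (by positivity)
    _ ≤ 2 ^ q * ∑ y, (6 * (1 - (2:ℝ) ^ (-(q - 1)))⁻¹ + 4 * (1 - (2:ℝ) ^ (-(2 - q)))⁻¹) *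
        (A ^ q * N ^ (1 - q / 2)) * |g y| ^ q := by
        apply mul_le_mul_of_nonneg_left _ (by positivity)
        rw [Finset.sum_comm]
        apply Finset.sum_le_sum
        intro y _
        rw [Finset.sum_add_distrib, ← Finset.mul_sum, ← Finset.mul_sum]
        by_cases hy : g y = 0
        · simp [hy]
          rw [Real.zero_rpow (by linarith)]; simp
        have hy0 : 0 < |g y| := abs_pos.2 hy
        have h2 := geo_up (by linarith : 0 < q - 1) hτ n (|g y| / c) (by positivity)
        have h3 := geo_dn (by linarith : 0 < 2 - q) n τ hτ (|g y| / c) (by positivity)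
        have f1 : 6 * (A * √N) * |g y| * ((1 - (2:ℝ) ^ (-(q - 1)))⁻¹ * (|g y| / c) ^ (q - 1)) =
            6 * (1 - (2:ℝ) ^ (-(q - 1)))⁻¹ * (A ^ q * N ^ (1 - q / 2)) * |g y| ^ q := by
          rw [Real.div_rpow hy0.le hc0.le, hc, Real.div_rpow hsN.le hA.le]
          have a1 : |g y| ^ q = |g y| * |g y| ^ (q - 1) := by
            rw [← Real.rpow_one_add' hy0.le (by linarith)]; congr 1; ring
          have a2 : A ^ q = A * A ^ (q - 1) := by
            rw [← Real.rpow_one_add' hA.le (by linarith)]; congr 1; ring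
          have a3 : N ^ (1 - q / 2) * (√N) ^ (q - 1) = √N := by
            rw [Real.sqrt_eq_rpow, ← Real.rpow_mul (by linarith), ← Real.rpow_add (by linarith)]
            congr 1; ring
          rw [a1, a2]
          have p1 : 0 < √N ^ (q - 1) := by positivity
          have p2 : 0 < A ^ (q - 1) := by positivity
          generalize √N ^ (q - 1) = s1 at *
          generalize A ^ (q - 1) = s2 at *
          generalize |g y| ^ (q - 1) = s3 at *
          generalize N ^ (1 - q / 2) = Z at *
          generalize (1 - (2:ℝ) ^ (-(q - 1)))⁻¹ = W at *
          rw [← a3]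
          have e1 : s3 / (s1 / s2) * s1 = s3 * s2 := by field_simp
          linear_combination (6 * A * Z * |g y| * W) * e1
        have f2 : 4 * A ^ 2 * g y ^ 2 * ((1 - (2:ℝ) ^ (-(2 - q)))⁻¹ * (|g y| / c) ^ (-(2 - q))) =
            4 * (1 - (2:ℝ) ^ (-(2 - q)))⁻¹ * (A ^ q * N ^ (1 - q / 2)) * |g y| ^ q := by
          rw [Real.div_rpow hy0.le hc0.le, hc, Real.div_rpow hsN.le hA.le]
          have a1 : |g y| ^ q = g y ^ 2 * |g y| ^ (-(2 - q)) := by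
            rw [← sq_abs, ← Real.rpow_natCast _ 2, ← Real.rpow_add hy0]; congr 1; push_cast; ring
          have a2 : A ^ q = A ^ 2 * A ^ (-(2 - q)) := by
            rw [← Real.rpow_natCast _ 2, ← Real.rpow_add hA]; congr 1; push_cast; ring
          have a3 : N ^ (1 - q / 2) * (√N) ^ (-(2 - q)) = 1 := by
            rw [Real.sqrt_eq_rpow, ← Real.rpow_mul (by linarith), ← Real.rpow_add (by linarith)]
            rw [show 1 - q / 2 + 1 / 2 * -(2 - q) = 0 by ring, Real.rpow_zero]
          rw [a1, a2]
          have p1 : 0 < √N ^ (-(2 - q)) := by positivity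
          have p2 : 0 < A ^ (-(2 - q)) := by positivity
          generalize √N ^ (-(2 - q)) = s1 at *
          generalize A ^ (-(2 - q)) = s2 at *
          generalize |g y| ^ (-(2 - q)) = s3 at *
          generalize N ^ (1 - q / 2) = Z at *
          generalize (1 - (2:ℝ) ^ (-(2 - q)))⁻¹ = W at *
          have e1 : s3 / (s1 / s2) = s3 * s2 * Z := by
            have e2 : Z = 1 / s1 := by rw [eq_div_iff p1.ne']; exact a3
            rw [e2]; field_simp
          linear_combination (4 * A ^ 2 * g y ^ 2 * W) * e1
        have p3 : 0 ≤ 6 * (A * √N) * |g y| := by positivity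
        have p4 : 0 ≤ 4 * A ^ 2 * g y ^ 2 := by positivity
        have h4 := mul_le_mul_of_nonneg_left h2 p3
        have h5 := mul_le_mul_of_nonneg_left h3 p4
        rw [f1] at h4
        rw [f2] at h5
        linarith
    _ = _ := by
      rw [← Finset.mul_sum, Cq]; ring

end HI

namespace HI
variable {M : ℕ}

def mm (a : ℕ → GG M → ℝ) (X : Finset (GG M)) (Bv : GG M → ℝ) (k : ℕ) (η : GG M) : ℝ :=
  (if ∃ ξ ∈ X, agree k ξ η then a k η else 0) * Bv η

lemma hat_plancherel (g : GG M → ℝ) : ∑ η, hat g η ^ 2 = 2 ^ M * ∑ y, g y ^ 2 := by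
  rw [← plancherel]
  apply Finset.sum_congr rfl
  intro η _
  unfold hat
  congr 1
  apply Finset.sum_congr rfl
  intro y _
  rw [ww_comm]

lemma mm_loc (a : ℕ → GG M → ℝ) (ha : ∀ k η ξ, agree k η ξ → a k η = a k ξ)
    (X E : Finset (GG M)) (hXE : X ⊆ E) (Bv : GG M → ℝ)
    (hB : ∀ k0 η η', agree k0 η η' → (∀ e ∈ E, ¬ agree k0 e η) → Bv η = Bv η')
    (k k0 : ℕ) (η η' : GG M) (h : agree k0 η η') (hE : ∀ e ∈ E, ¬ agree k0 e η) :
    mm a X Bv k η = mm a X Bv k η' := by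
  unfold mm
  rw [hB k0 η η' h hE]
  congr 1
  by_cases hk : k0 ≤ k
  · have h1 : agree k η η' := fun i hi => h i (hk.trans hi)
    have : (∃ ξ ∈ X, agree k ξ η) ↔ (∃ ξ ∈ X, agree k ξ η') := by
      constructor
      · rintro ⟨ξ, hξ, h2⟩; exact ⟨ξ, hξ, h2.trans h1⟩
      · rintro ⟨ξ, hξ, h2⟩; exact ⟨ξ, hξ, h2.trans h1.symm⟩
    simp only [this, ha k η η' h1]
  · push Not at hk
    rw [if_neg, if_neg]
    · rintro ⟨ξ, hξ, h2⟩
      have h3 : agree k0 ξ η' := fun i hi => h2 i (hk.le.trans hi)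
      exact hE ξ (hXE hξ) (h3.trans h.symm)
    · rintro ⟨ξ, hξ, h2⟩
      have h3 : agree k0 ξ η := fun i hi => h2 i (hk.le.trans hi)
      exact hE ξ (hXE hξ) h3

theorem finmain {q r : ℝ} (hq1 : 1 < q) (hq2 : q ≤ 2) (hr : 2 < r) :
    ∃ C : ℝ, 0 < C ∧ ∀ (M : ℕ) (V b : ℝ), 0 < V → 0 < b → ∀ (X E : Finset (GG M)), X ⊆ E →
    ∀ (N L0 : ℕ), 1 ≤ N → E.card ≤ N → N ≤ 2 ^ L0 →
    ∀ (a : ℕ → GG M → ℝ), (∀ k η ξ, agree k η ξ → a k η = a k ξ) →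
    (∀ ξ ∈ X, VarLe r V M (fun j => a (M - j) ξ)) →
    ∀ (Bv : GG M → ℝ), (∀ η, |Bv η| ≤ b) →
    (∀ k0 η η', agree k0 η η' → (∀ e ∈ E, ¬ agree k0 e η) → Bv η = Bv η') →
    ∀ (g S : GG M → ℝ), (∀ x, 0 ≤ S x) → (∀ x, ∃ k ≤ M, S x ≤ |TT (mm a X Bv k) g x|) →
    ∑ x, S x ^ q ≤ (C * ((L0 + 1) * (N : ℝ) ^ (1 / q - 1 / r) * V * b)) ^ q * ∑ y, |g y| ^ q := by
  refine ⟨(|Cq q| + 1) ^ (1 / q) * √2184, by positivity, ?_⟩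
  intro M V b hV hb X E hXE N L0 hN hEN hNL a ha hvar Bv hBv hB g S hS hST
  have hN' : (1:ℝ) ≤ N := by exact_mod_cast hN
  have hN0 : (0:ℝ) < N := by linarith
  obtain ⟨A, hA⟩ : ∃ A, A = √2184 * ((L0 + 1) * (N:ℝ) ^ (1 / 2 - 1 / r) * V * b) := ⟨_, rfl⟩
  have hA0 : 0 < A := by rw [hA]; positivity
  have hL2 : ∀ g : GG M → ℝ, ∃ Mx : GG M → ℝ, (∀ x, ∀ k ≤ M, (TT (mm a X Bv k) g x) ^ 2 ≤ Mx x) ∧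
      ∑ x, Mx x ≤ A ^ 2 * ∑ y, g y ^ 2 := by
    intro g
    obtain ⟨Mx, h1, h2⟩ := L2max hr hV X N L0 hN ((Finset.card_le_card hXE).trans hEN) hNL a ha hvar
      (fun η => Bv η * hat g η * ((2:ℝ) ^ M)⁻¹)
    refine ⟨Mx, ?_, h2.trans ?_⟩
    · intro x k hk
      convert h1 x k hk using 2
      unfold TT mm
      rw [Finset.mul_sum]
      apply Finset.sum_congr rfl
      intro η _
      ring
    · have e1 : (2:ℝ) ^ M * ∑ η, (Bv η * hat g η * ((2:ℝ) ^ M)⁻¹) ^ 2 ≤ b ^ 2 * ∑ y, g y ^ 2 := by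
        have e2 : ∑ η, (Bv η * hat g η * ((2:ℝ) ^ M)⁻¹) ^ 2 ≤
            ∑ η, b ^ 2 * (((2:ℝ) ^ M)⁻¹) ^ 2 * hat g η ^ 2 := by
          apply Finset.sum_le_sum
          intro η _
          have : Bv η ^ 2 ≤ b ^ 2 := by
            rw [← sq_abs]; exact pow_le_pow_left₀ (abs_nonneg _) (hBv η) 2
          calc _ = Bv η ^ 2 * ((((2:ℝ) ^ M)⁻¹) ^ 2 * hat g η ^ 2) := by ring
            _ ≤ b ^ 2 * ((((2:ℝ) ^ M)⁻¹) ^ 2 * hat g η ^ 2) :=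
              mul_le_mul_of_nonneg_right this (by positivity)
            _ = _ := by ring
        rw [← Finset.mul_sum, hat_plancherel] at e2
        have p : (0:ℝ) < 2 ^ M := by positivity
        calc _ ≤ (2:ℝ) ^ M * (b ^ 2 * (((2:ℝ) ^ M)⁻¹) ^ 2 * (2 ^ M * ∑ y, g y ^ 2)) :=
              mul_le_mul_of_nonneg_left e2 p.le
          _ = _ := by
            generalize (2:ℝ) ^ M = P at *
            field_simp
      have e3 : A ^ 2 = 2184 * ((L0:ℝ) + 1) ^ 2 * ((N:ℝ) ^ (1 - 2 / r) * V ^ 2) * b ^ 2 := by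
        have : (N:ℝ) ^ (1 - 2 / r) = ((N:ℝ) ^ (1 / 2 - 1 / r)) ^ 2 := by
          rw [← Real.rpow_natCast, ← Real.rpow_mul hN0.le]; congr 1; push_cast; ring
        rw [hA, this, mul_pow, Real.sq_sqrt (by norm_num)]; ring
      rw [e3]
      calc _ ≤ 2184 * ((L0:ℝ) + 1) ^ 2 * ((N:ℝ) ^ (1 - 2 / r) * V ^ 2) * (b ^ 2 * ∑ y, g y ^ 2) :=
            mul_le_mul_of_nonneg_left e1 (by positivity)
        _ = _ := by ring
  have hg0 : 0 ≤ ∑ y, |g y| ^ q := Finset.sum_nonneg fun y _ => by positivity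
  have e4 : A ^ q * (N:ℝ) ^ (1 - q / 2) =
      (√2184 * ((L0 + 1) * (N : ℝ) ^ (1 / q - 1 / r) * V * b)) ^ q := by
    have : (N:ℝ) ^ (1 - q / 2) = ((N:ℝ) ^ (1 / q - 1 / 2)) ^ q := by
      rw [← Real.rpow_mul hN0.le]; congr 1; field_simp
    rw [this, ← Real.mul_rpow hA0.le (by positivity), hA]
    congr 1
    rw [show (1 / q - 1 / r) = (1 / 2 - 1 / r) + (1 / q - 1 / 2) by ring, Real.rpow_add hN0]
    ring
  have e5 : ((|Cq q| + 1) ^ (1 / q) * √2184 * ((L0 + 1) * (N : ℝ) ^ (1 / q - 1 / r) * V * b)) ^ q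
      = (|Cq q| + 1) * (A ^ q * (N:ℝ) ^ (1 - q / 2)) := by
    rw [e4, mul_assoc, Real.mul_rpow (by positivity) (by positivity), ← Real.rpow_mul (by positivity),
      one_div_mul_cancel (by linarith), Real.rpow_one]
  rw [e5]
  rcases hq2.lt_or_eq with hlt | heq
  · have := marc hq1 hlt E N hN' (by exact_mod_cast hEN) (mm a X Bv)
      (fun k _ k0 η η' => mm_loc a ha X E hXE Bv hB k k0 η η') hA0 hL2 g S hS hST
    refine this.trans ?_
    apply mul_le_mul_of_nonneg_right _ hg0
    apply mul_le_mul_of_nonneg_right _ (by positivity)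
    linarith [le_abs_self (Cq q)]
  · subst heq
    obtain ⟨Mx, h1, h2⟩ := hL2 g
    have e6 : ∑ x, S x ^ (2:ℝ) ≤ A ^ 2 * ∑ y, g y ^ 2 := by
      refine le_trans ?_ h2
      apply Finset.sum_le_sum
      intro x _
      obtain ⟨k, hk, h3⟩ := hST x
      refine le_trans ?_ (h1 x k hk)
      rw [Real.rpow_two, ← sq_abs (TT _ _ _)]
      exact pow_le_pow_left₀ (hS x) h3 2
    have e7 : ∑ y, |g y| ^ (2:ℝ) = ∑ y, g y ^ 2 := by
      apply Finset.sum_congr rfl; intro y _; rw [Real.rpow_two, sq_abs]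
    rw [e7] at hg0 ⊢
    refine e6.trans ?_
    apply mul_le_mul_of_nonneg_right _ hg0
    rw [show (1:ℝ) - 2 / 2 = 0 by norm_num, Real.rpow_zero, Real.rpow_two, mul_one]
    have := abs_nonneg (Cq 2)
    nlinarith [sq_nonneg A, mul_nonneg this (sq_nonneg A)]

end HI

namespace HI

lemma floor_half (x : ℝ) (m : ℤ) : ⌊x / 2 ^ (m + 1)⌋ = ⌊x / 2 ^ m⌋ / 2 := by
  rw [zpow_add₀ (by norm_num), zpow_one, ← div_div]
  have := Int.floor_div_natCast (x / 2 ^ m) 2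
  simpa using this

lemma floor_pow (x : ℝ) (m : ℤ) (i : ℕ) : ⌊x / 2 ^ (m + i)⌋ = ⌊x / 2 ^ m⌋ / 2 ^ i := by
  rw [zpow_add₀ (by norm_num), ← div_div, zpow_natCast]
  have := Int.floor_div_natCast (x / 2 ^ m) (2 ^ i)
  simpa using this

lemma digit_cases (n : ℤ) (x : ℝ) : digit n x = 0 ∨ digit n x = 1 := by
  unfold digit; omega

lemma floor_succ' (x : ℝ) (m : ℤ) : ⌊x / 2 ^ m⌋ = 2 * ⌊x / 2 ^ (m + 1)⌋ + digit m x := by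
  rw [floor_half]; unfold digit; omega

lemma floor_zero {x : ℝ} {n : ℕ} (hx : 0 ≤ x) (hn : x < 2 ^ n) {m : ℤ} (hm : (n:ℤ) ≤ m) :
    ⌊x / 2 ^ m⌋ = 0 := by
  rw [Int.floor_eq_zero_iff]
  have hp : (0:ℝ) < 2 ^ m := by positivity
  refine ⟨by positivity, ?_⟩
  rw [div_lt_one hp]
  refine hn.trans_le ?_
  rw [← zpow_natCast]
  exact zpow_le_zpow_right₀ (by norm_num) hm

lemma digit_zero {x : ℝ} {n : ℕ} (hx : 0 ≤ x) (hn : x < 2 ^ n) {m : ℤ} (hm : (n:ℤ) ≤ m) :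
    digit m x = 0 := by
  unfold digit; rw [floor_zero hx hn hm]; rfl

lemma wMulDigit_eq (j : ℤ) (y x : ℝ) (s : Finset ℤ)
    (hs : ∀ m ∉ s, digit (j - m) y * digit m x = 0) :
    wMulDigit j y x = (∑ m ∈ s, digit (j - m) y * digit m x) % 2 := by
  unfold wMulDigit
  rw [tsum_eq_sum (s := s) (fun m hm => by rw [hs m hm]; simp), ← Int.cast_sum, Int.floor_intCast]

lemma wMulDigit_cases (j : ℤ) (y x : ℝ) : wMulDigit j y x = 0 ∨ wMulDigit j y x = 1 := by
  unfold wMulDigit; omega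

lemma wMulDigit_big {x y : ℝ} {n : ℕ} (hx : 0 ≤ x) (hxn : x < 2 ^ n) (hy : 0 ≤ y) (hyn : y < 2 ^ n)
    {j : ℤ} (hj : 2 * (n:ℤ) ≤ j) : wMulDigit j y x = 0 := by
  rw [wMulDigit_eq j y x ∅]
  · simp
  · intro m _
    by_cases h : (n:ℤ) ≤ m
    · rw [digit_zero hx hxn h, mul_zero]
    · rw [digit_zero hy hyn (by omega), zero_mul]

lemma digit_of_expansion (c : ℤ → ℤ) (hc : ∀ j, c j = 0 ∨ c j = 1) (n : ℕ)
    (hbig : ∀ j, 2 * (n:ℤ) ≤ j → c j = 0) (hsm : ∃ j ≤ -2, c j = 0) :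
    digit (-1) (∑' j : ℤ, (c j : ℝ) * 2 ^ j) = c (-1) := by
  obtain ⟨j0, hj0, hc0⟩ := hsm
  have hc01 : ∀ j, (0:ℝ) ≤ c j ∧ (c j : ℝ) ≤ 1 := by
    intro j; rcases hc j with h | h <;> rw [h] <;> norm_num
  -- negative part
  have hgeo : HasSum (fun i : ℕ => (2:ℝ) ^ (-2 - (i:ℤ))) (1/2) := by
    have h := (hasSum_geometric_of_lt_one (r := (1/2:ℝ)) (by norm_num) (by norm_num)).mul_left (1/4)
    have e1 : (fun i : ℕ => (2:ℝ) ^ (-2 - (i:ℤ))) = fun i : ℕ => 1 / 4 * (1 / 2) ^ i := by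
      funext i
      rw [zpow_sub₀ (by norm_num), zpow_natCast]
      rw [div_eq_mul_inv, one_div_pow]; norm_num
    have e2 : (1:ℝ) / 2 = 1 / 4 * (1 - 1 / 2)⁻¹ := by norm_num
    rw [← e2] at h; rw [e1]; exact h
  have hsN : Summable (fun i : ℕ => (c (-2 - (i:ℤ)) : ℝ) * 2 ^ (-2 - (i:ℤ))) := by
    apply Summable.of_nonneg_of_le _ _ hgeo.summable
    · intro i; exact mul_nonneg (hc01 _).1 (by positivity)
    · intro i
      exact mul_le_of_le_one_left (by positivity) (hc01 _).2
  obtain ⟨S, hS⟩ := hsN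
  have hS0 : 0 ≤ S := hS.nonneg fun i => mul_nonneg (hc01 _).1 (by positivity)
  have hS1 : S < 1 / 2 := by
    rw [← hS.tsum_eq, ← hgeo.tsum_eq]
    apply Summable.tsum_lt_tsum (i := (-2 - j0).toNat) _ _ hS.summable hgeo.summable
    · intro i
      exact mul_le_of_le_one_left (by positivity) (hc01 _).2
    · have : -2 - (((-2 - j0).toNat : ℕ) : ℤ) = j0 := by omega
      simp only [this, hc0]
      simp
      positivity
  have hneg : HasSum (fun j : ℤ => if j ≤ -2 then (c j : ℝ) * 2 ^ j else 0) S := by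
    have hinj : Function.Injective (fun i : ℕ => (-2 - (i:ℤ))) := by
      intro i i' h; simp at h; exact h
    rw [← hinj.hasSum_iff]
    · convert hS using 1
      funext i
      simp
    · intro j hj
      rw [if_neg]
      intro h
      exact hj ⟨(-2 - j).toNat, by simp; omega⟩
  have hpos : HasSum (fun j : ℤ => if j ≤ -2 then 0 else (c j : ℝ) * 2 ^ j)
      (∑ j ∈ Finset.Ico (-1) (2 * (n:ℤ)), (if j ≤ -2 then 0 else (c j : ℝ) * 2 ^ j)) := by
    apply hasSum_sum_of_ne_finset_zero
    intro j hj
    split_ifs with h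
    · rfl
    · rw [hbig j (by simp at hj; omega)]; simp
  have htot : ∑' j : ℤ, (c j : ℝ) * 2 ^ j =
      S + ∑ j ∈ Finset.Ico (-1) (2 * (n:ℤ)), (if j ≤ -2 then 0 else (c j : ℝ) * 2 ^ j) := by
    rw [← (hneg.add hpos).tsum_eq]
    congr 1; funext j; split_ifs <;> simp
  rw [htot]
  have hexInt : ∃ A : ℤ, ∑ j ∈ Finset.Ico (-1) (2 * (n:ℤ)), (if j ≤ -2 then 0 else (c j : ℝ) * 2 ^ j)
      = (c (-1) : ℝ) / 2 + A := by
    by_cases hn : n = 0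
    · subst hn
      have e : Finset.Ico (-1:ℤ) (2 * ((0:ℕ):ℤ)) = {-1} := by decide
      refine ⟨0, ?_⟩
      rw [e, Finset.sum_singleton]
      norm_num [zpow_neg]
      ring
    refine ⟨∑ j ∈ Finset.Ico (0:ℤ) (2 * (n:ℤ)), c j * 2 ^ j.toNat, ?_⟩
    have e : Finset.Ico (-1:ℤ) (2 * (n:ℤ)) = insert (-1) (Finset.Ico (0:ℤ) (2 * (n:ℤ))) := by
      ext j; simp only [Finset.mem_Ico, Finset.mem_insert]; omega
    rw [e, Finset.sum_insert (by simp)]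
    push_cast
    congr 1
    · norm_num [zpow_neg]; ring
    · apply Finset.sum_congr rfl
      intro j hj
      simp at hj
      rw [if_neg (by omega)]
      congr 1
      rw [← zpow_natCast, Int.toNat_of_nonneg hj.1]
  obtain ⟨A, hA⟩ := hexInt
  rw [hA]
  unfold digit
  have : ⌊(S + ((c (-1) : ℝ) / 2 + A)) / 2 ^ (-1:ℤ)⌋ = c (-1) + 2 * A := by
    rw [Int.floor_eq_iff]
    push_cast
    norm_num [zpow_neg]
    constructor <;> linarith
  rw [this]
  rcases hc (-1) with h | h <;> rw [h] <;> omega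

lemma walshe_wMul {x y : ℝ} {n : ℕ} (hx : 0 ≤ x) (hxn : x < 2 ^ n) (hy : 0 ≤ y) (hyn : y < 2 ^ n)
    (h : ∃ j ≤ -2, wMulDigit j y x = 0) :
    walshe (wMul y x) = (-1:ℝ) ^ (wMulDigit (-1) y x) := by
  unfold walshe wMul
  rw [digit_of_expansion (fun j => wMulDigit j y x) (fun j => wMulDigit_cases j y x) n
    (fun j hj => wMulDigit_big hx hxn hy hyn hj) h]

lemma eq_of_floors {x x' : ℝ} (p : ℤ) (h : ∀ i : ℕ, ⌊x / 2 ^ (p - i)⌋ = ⌊x' / 2 ^ (p - i)⌋) :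
    x = x' := by
  have h1 : ∀ i : ℕ, |x - x'| ≤ 2 ^ p * (1 / 2) ^ i := by
    intro i
    have hp : (0:ℝ) < 2 ^ (p - i) := by positivity
    have h2 := Int.abs_sub_lt_one_of_floor_eq_floor (h i)
    rw [← sub_div, abs_div, abs_of_pos hp, div_lt_one hp] at h2
    refine h2.le.trans (le_of_eq ?_)
    rw [zpow_sub₀ (by norm_num), zpow_natCast, div_eq_mul_inv, one_div_pow, one_div]
  have h2 : Tendsto (fun i : ℕ => (2:ℝ) ^ p * (1 / 2) ^ i) atTop (nhds (2 ^ p * 0)) :=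
    (tendsto_pow_atTop_nhds_zero_of_lt_one (by norm_num) (by norm_num)).const_mul _
  have h3 := ge_of_tendsto' h2 h1
  rw [mul_zero] at h3
  exact sub_eq_zero.1 (abs_nonpos_iff.1 h3)

lemma digit_eq_of_floor {x x' : ℝ} (p : ℤ) (h : ⌊x / 2 ^ p⌋ = ⌊x' / 2 ^ p⌋) {m : ℤ} (hm : p ≤ m) :
    digit m x = digit m x' := by
  unfold digit
  obtain ⟨i, hi⟩ := Int.le.dest hm
  rw [← hi, floor_pow, floor_pow, h]

/-- existence of the top digit -/
lemma top_digit {y : ℝ} (hy : 0 < y) : ∃ t : ℤ, digit t y = 1 ∧ ∀ m, t < m → digit m y = 0 := by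
  obtain ⟨t, h1, h2⟩ := exists_mem_Ico_zpow hy (by norm_num : (1:ℝ) < 2)
  have hp : (0:ℝ) < 2 ^ t := by positivity
  refine ⟨t, ?_, ?_⟩
  · have : ⌊y / 2 ^ t⌋ = 1 := by
      rw [Int.floor_eq_iff]
      rw [zpow_add₀ (by norm_num)] at h2
      constructor
      · rw [le_div_iff₀ hp]; simpa using h1
      · rw [div_lt_iff₀ hp]; push_cast; norm_num at h2 ⊢; linarith
    unfold digit; rw [this]; rfl
  · intro m hm
    have hpm : (0:ℝ) < 2 ^ m := by positivity
    have : ⌊y / 2 ^ m⌋ = 0 := by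
      rw [Int.floor_eq_zero_iff]
      refine ⟨by positivity, ?_⟩
      rw [div_lt_one hpm]
      exact h2.trans_le (zpow_le_zpow_right₀ (by norm_num) (by omega))
    unfold digit; rw [this]; rfl

lemma bad_countable (y : ℝ) (n : ℕ) (hy : 0 ≤ y) (hyn : y < 2 ^ n) :
    {x : ℝ | x ∈ Ico (0:ℝ) (2 ^ n) ∧ ∀ j ≤ -2, wMulDigit j y x = 1}.Countable := by
  rcases hy.eq_or_lt with h0 | hpos
  · convert Set.countable_empty
    ext x
    simp only [mem_ofPred_eq, mem_empty_iff_false, iff_false]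
    rintro ⟨_, h⟩
    have h1 := h (-2) le_rfl
    rw [wMulDigit_eq (-2) y x ∅ (by intro m _; rw [← h0]; simp [digit])] at h1
    simp at h1
  obtain ⟨t, ht1, ht2⟩ := top_digit hpos
  apply Set.MapsTo.countable_of_injOn (f := fun x => ⌊x / 2 ^ (-1 - t)⌋) (t := Set.univ)
    (fun _ _ => mem_univ _) _ (Set.countable_univ)
  intro x hx x' hx' hxx
  simp only at hxx
  apply eq_of_floors (-1 - t)
  intro i
  induction i with
  | zero => simpa using hxx
  | succ i ih =>
    have e1 : (-1 - t - ((i + 1 : ℕ):ℤ)) + 1 = -1 - t - i := by push_cast; ring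
    rw [floor_succ' x, floor_succ' x', e1, ih]
    congr 1
    obtain ⟨p, hp⟩ : ∃ p, p = -1 - t - ((i + 1 : ℕ):ℤ) := ⟨_, rfl⟩
    rw [← hp]
    have hd : ∀ m, p < m → digit m x = digit m x' := fun m hm =>
      digit_eq_of_floor _ ih (by omega)
    -- digit of product at index p + t
    have key : ∀ z ∈ Ico (0:ℝ) (2 ^ n), wMulDigit (p + t) y z =
        (digit p z + ∑ m ∈ Finset.Ioo p (n:ℤ), digit (p + t - m) y * digit m z) % 2 := by
      intro z hz
      rw [wMulDigit_eq (p + t) y z (insert p (Finset.Ioo p (n:ℤ))),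
        Finset.sum_insert (by simp)]
      · rw [show p + t - p = t by ring, ht1, one_mul]
      · intro m hm
        simp only [Finset.mem_insert, Finset.mem_Ioo, not_or, not_and, not_lt] at hm
        by_cases h : m < p
        · rw [ht2 _ (by omega), zero_mul]
        · rw [digit_zero hz.1 hz.2 (hm.2 (by omega)), mul_zero]
    have k1 := key x hx.1
    have k2 := key x' hx'.1
    rw [hx.2 _ (by omega)] at k1
    rw [hx'.2 _ (by omega)] at k2
    have k3 : ∑ m ∈ Finset.Ioo p (n:ℤ), digit (p + t - m) y * digit m x =
        ∑ m ∈ Finset.Ioo p (n:ℤ), digit (p + t - m) y * digit m x' := by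
      apply Finset.sum_congr rfl
      intro m hm
      rw [hd m (Finset.mem_Ioo.1 hm).1]
    rw [k3] at k1
    rcases digit_cases p x with h | h <;> rcases digit_cases p x' with h' | h' <;>
      rw [h] at k1 ⊢ <;> rw [h'] at k2 ⊢ <;> omega

/-- frequency bits -/
def cF (n : ℕ) (x : ℝ) : GG (2 * n) := fun i => decide (digit ((i:ℤ) - n) x = 1)

/-- reversal -/
def rv {M : ℕ} (η : GG M) : GG M := fun i => η i.rev

lemma rv_rv {M : ℕ} (η : GG M) : rv (rv η) = η := by funext i; simp [rv]

lemma ww_rv {M : ℕ} (η x : GG M) : ww (rv η) (rv x) = ww η x := by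
  unfold ww rv
  exact Equiv.prod_comp Fin.revPerm (fun i => sg (η i) (x i))

lemma wMulDigit_ww {x y : ℝ} {n : ℕ} (hx : 0 ≤ x) (hxn : x < 2 ^ n) (hy : 0 ≤ y) (hyn : y < 2 ^ n) :
    (-1:ℝ) ^ (wMulDigit (-1) y x) = ww (cF n y) (rv (cF n x)) := by
  have hs : wMulDigit (-1) y x = (∑ i : Fin (2 * n), digit ((i:ℤ) - n) y * digit (n - 1 - (i:ℤ)) x) % 2 := by
    rw [wMulDigit_eq (-1) y x (Finset.univ.image (fun i : Fin (2 * n) => (n:ℤ) - 1 - (i:ℤ)))]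
    · rw [Finset.sum_image]
      · congr 1
        apply Finset.sum_congr rfl
        intro i _
        congr 2; ring
      · intro i _ i' _ h
        simp only at h
        ext; omega
    · intro m hm
      by_cases h : (n:ℤ) ≤ m
      · rw [digit_zero hx hxn h, mul_zero]
      · by_cases h2 : m < -n
        · rw [digit_zero hy hyn (by omega), zero_mul]
        · exfalso
          apply hm
          simp only [Finset.mem_image, Finset.mem_univ, true_and]
          exact ⟨⟨(n - 1 - m).toNat, by omega⟩, by simp; omega⟩
  have hmod : ∀ z : ℤ, (-1:ℝ) ^ (z % 2) = (-1:ℝ) ^ z := by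
    intro z
    conv_rhs => rw [← Int.emod_add_mul_ediv z 2]
    rw [zpow_add₀ (by norm_num), zpow_mul]
    norm_num
  have hprod : ∀ (s : Finset (Fin (2 * n))) (F : Fin (2 * n) → ℤ),
      (-1:ℝ) ^ (∑ i ∈ s, F i) = ∏ i ∈ s, (-1:ℝ) ^ (F i) := by
    intro s F
    induction s using Finset.induction_on with
    | empty => simp
    | insert i s hi ih => rw [Finset.sum_insert hi, Finset.prod_insert hi, zpow_add₀ (by norm_num), ih]
  rw [hs, hmod, hprod]
  unfold ww
  apply Finset.prod_congr rfl
  intro i _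
  have e : ((i.rev : Fin (2 * n)) : ℤ) - n = n - 1 - (i:ℤ) := by
    have := i.2
    simp only [Fin.val_rev]
    omega
  simp only [rv, cF, e, sg]
  rcases digit_cases ((i:ℤ) - n) y with h | h <;> rcases digit_cases (n - 1 - (i:ℤ)) x with h' | h' <;>
    rw [h, h'] <;> simp

lemma kern (n : ℕ) {y : ℝ} (hy : 0 ≤ y) (hyn : y < 2 ^ n) :
    ∀ᵐ x ∂(volume : Measure ℝ), x ∈ Ico (0:ℝ) (2 ^ n) →
      walshe (wMul y x) = ww (cF n y) (rv (cF n x)) := by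
  have h := (bad_countable y n hy hyn).measure_zero volume
  have h1 : ∀ᵐ x ∂(volume : Measure ℝ), x ∉
      {x : ℝ | x ∈ Ico (0:ℝ) (2 ^ n) ∧ ∀ j ≤ -2, wMulDigit j y x = 1} := by
    exact compl_mem_ae_iff.2 h
  filter_upwards [h1] with x hx hxn
  rw [walshe_wMul hxn.1 hxn.2 hy hyn, wMulDigit_ww hxn.1 hxn.2 hy hyn]
  by_contra hcon
  apply hx
  refine ⟨hxn, ?_⟩
  intro j hj
  rcases wMulDigit_cases j y x with h2 | h2
  · exact absurd ⟨j, hj, h2⟩ hcon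
  · exact h2

end HI

namespace HI

lemma mem_Ico_floor (k j : ℤ) (z : ℝ) :
    z ∈ Ico ((j:ℝ) * 2 ^ k) (((j:ℝ) + 1) * 2 ^ k) ↔ ⌊z / 2 ^ k⌋ = j := by
  have hp : (0:ℝ) < 2 ^ k := by positivity
  rw [Int.floor_eq_iff, mem_Ico, le_div_iff₀ hp, div_lt_iff₀ hp]

def om (k : ℤ) (x : ℝ) : Set ℝ :=
  Ico ((⌊x / 2 ^ k⌋:ℝ) * 2 ^ k) (((⌊x / 2 ^ k⌋:ℝ) + 1) * 2 ^ k)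

lemma mem_om {k : ℤ} {x z : ℝ} : z ∈ om k x ↔ ⌊z / 2 ^ k⌋ = ⌊x / 2 ^ k⌋ := mem_Ico_floor _ _ _

lemma om_congr {k : ℤ} {x z : ℝ} (h : ⌊z / 2 ^ k⌋ = ⌊x / 2 ^ k⌋) : om k z = om k x := by
  unfold om; rw [h]

lemma isDyadic_om (k : ℤ) (x : ℝ) : IsDyadicLen k (om k x) := ⟨_, rfl⟩

lemma eq_om {k : ℤ} {x : ℝ} {ω : Set ℝ} (h : IsDyadicLen k ω) (hx : x ∈ ω) : ω = om k x := by
  obtain ⟨j, rfl⟩ := h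
  rw [mem_Ico_floor] at hx
  unfold om; rw [hx]

lemma dyadicSum_eq (a : Set ℝ → ℝ) (ξ : ℝ) (k : ℤ) : dyadicSum a ξ k = a (om k ξ) := by
  unfold dyadicSum
  rw [finsum_eq_single _ (om k ξ)]
  · rw [finsum_eq_if, if_pos (isDyadic_om k ξ), Set.indicator_of_mem (mem_om.2 rfl), mul_one]
  · intro ω hω
    rw [finsum_eq_if]
    split_ifs with h
    · rw [Set.indicator_of_notMem, mul_zero]
      intro h2; exact hω (eq_om h h2)
    · rfl

lemma Dk_eq (a : Set ℝ → ℝ) (Ξ : Set ℝ) (ξ : ℝ) (k : ℤ) :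
    Dk a Ξ k ξ = if (om k ξ ∩ Ξ).Nonempty then a (om k ξ) else 0 := by
  unfold Dk
  rw [finsum_eq_single _ (om k ξ)]
  · rw [finsum_eq_if, Set.indicator_of_mem (mem_om.2 rfl), mul_one]
    simp only [isDyadic_om k ξ, true_and]
  · intro ω hω
    rw [finsum_eq_if]
    split_ifs with h
    · rw [Set.indicator_of_notMem, mul_zero]
      intro h2; exact hω (eq_om h.1 h2)
    · rfl

lemma agree_iff {n : ℕ} {x x' : ℝ} (hx : x ∈ Ico (0:ℝ) (2 ^ n)) (hx' : x' ∈ Ico (0:ℝ) (2 ^ n)) (k : ℕ) :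
    agree k (cF n x) (cF n x') ↔ ⌊x / 2 ^ ((k:ℤ) - n)⌋ = ⌊x' / 2 ^ ((k:ℤ) - n)⌋ := by
  constructor
  · intro h
    have key : ∀ i : ℕ, (k:ℤ) - n ≤ n - i → ⌊x / 2 ^ ((n:ℤ) - i)⌋ = ⌊x' / 2 ^ ((n:ℤ) - i)⌋ := by
      intro i
      induction i with
      | zero => intro _; rw [floor_zero hx.1 hx.2 (by simp), floor_zero hx'.1 hx'.2 (by simp)]
      | succ i ih =>
        intro hi
        have e1 : ((n:ℤ) - ((i + 1 : ℕ):ℤ)) + 1 = n - i := by push_cast; ring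
        rw [floor_succ' x, floor_succ' x', e1, ih (by push_cast at hi; omega)]
        congr 1
        have h1 := h ⟨2 * n - (i + 1), by push_cast at hi; omega⟩ (by simp; push_cast at hi; omega)
        simp only [cF] at h1
        have e2 : ((2 * n - (i + 1) : ℕ) : ℤ) - n = n - ((i + 1 : ℕ) : ℤ) := by
          push_cast at hi ⊢; omega
        rw [e2] at h1
        rcases digit_cases ((n:ℤ) - ((i + 1 : ℕ) : ℤ)) x with h2 | h2 <;>
          rcases digit_cases ((n:ℤ) - ((i + 1 : ℕ) : ℤ)) x' with h3 | h3 <;>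
          rw [h2, h3] at h1 ⊢ <;> simp at h1
    by_cases hk : 2 * n ≤ k
    · rw [floor_zero hx.1 hx.2 (by omega), floor_zero hx'.1 hx'.2 (by omega)]
    · have := key (2 * n - k) (by omega)
      have e : (n:ℤ) - ((2 * n - k : ℕ) : ℤ) = k - n := by omega
      rwa [e] at this
  · intro h i hi
    unfold cF
    rw [digit_eq_of_floor _ h (by omega)]

lemma grid_mem {n : ℕ} (j : ℕ) (hj : j < 2 ^ (2 * n)) : (j:ℝ) * 2 ^ (-(n:ℤ)) ∈ Ico (0:ℝ) (2 ^ n) := by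
  refine ⟨by positivity, ?_⟩
  have h1 : (j:ℝ) < 2 ^ (2 * n) := by exact_mod_cast hj
  have hp : (0:ℝ) < 2 ^ (-(n:ℤ)) := by positivity
  calc (j:ℝ) * 2 ^ (-(n:ℤ)) < 2 ^ (2 * n) * 2 ^ (-(n:ℤ)) := mul_lt_mul_of_pos_right h1 hp
    _ = 2 ^ n := by
      rw [zpow_neg, zpow_natCast, two_mul, pow_add]; field_simp

lemma grid_floor {n : ℕ} (j : ℕ) : ⌊((j:ℝ) * 2 ^ (-(n:ℤ))) / 2 ^ (-(n:ℤ))⌋ = j := by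
  rw [mul_div_cancel_right₀ _ (by positivity)]; simp

lemma cF_surj (n : ℕ) (η : GG (2 * n)) : ∃ j : ℕ, j < 2 ^ (2 * n) ∧ cF n ((j:ℝ) * 2 ^ (-(n:ℤ))) = η := by
  have hinj : Function.Injective
      (fun j : Fin (2 ^ (2 * n)) => cF n (((j:ℕ):ℝ) * 2 ^ (-(n:ℤ)))) := by
    intro j j' h
    simp only at h
    have h1 : agree 0 (cF n (((j:ℕ):ℝ) * 2 ^ (-(n:ℤ)))) (cF n (((j':ℕ):ℝ) * 2 ^ (-(n:ℤ)))) := by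
      rw [h]; exact agree_refl _ _
    rw [agree_iff (grid_mem _ j.2) (grid_mem _ j'.2)] at h1
    rw [show ((0:ℕ):ℤ) - n = -(n:ℤ) by simp, grid_floor, grid_floor] at h1
    ext; exact_mod_cast h1
  have hb := (Fintype.bijective_iff_injective_and_card _).2 ⟨hinj, by simp [GG]⟩
  obtain ⟨j, hj⟩ := hb.2 η
  exact ⟨j, j.2, hj⟩

def cl (n : ℕ) (η : GG (2 * n)) : Set ℝ := {x | x ∈ Ico (0:ℝ) (2 ^ n) ∧ cF n x = η}

lemma cl_eq (n : ℕ) (η : GG (2 * n)) : ∃ j : ℕ, j < 2 ^ (2 * n) ∧ cF n ((j:ℝ) * 2 ^ (-(n:ℤ))) = η ∧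
    cl n η = Ico ((j:ℝ) * 2 ^ (-(n:ℤ))) (((j:ℝ) + 1) * 2 ^ (-(n:ℤ))) := by
  obtain ⟨j, hj, h⟩ := cF_surj n η
  refine ⟨j, hj, h, ?_⟩
  ext x
  have h1 := mem_Ico_floor (-(n:ℤ)) j x
  rw [Int.cast_natCast] at h1
  rw [h1]
  have e0 : ((0:ℕ):ℤ) - n = -(n:ℤ) := by simp
  constructor
  · rintro ⟨hx, h2⟩
    have h3 : agree 0 (cF n x) (cF n ((j:ℝ) * 2 ^ (-(n:ℤ)))) := by
      rw [h2, h]; exact agree_refl _ _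
    rw [agree_iff hx (grid_mem _ hj), e0, grid_floor] at h3
    exact h3
  · intro h2
    have hx : x ∈ Ico (0:ℝ) (2 ^ n) := by
      have h3 := h1.2 h2
      refine ⟨le_trans (by positivity) h3.1, h3.2.trans_le ?_⟩
      have h4 : ((j:ℝ) + 1) ≤ 2 ^ (2 * n) := by exact_mod_cast hj
      calc ((j:ℝ) + 1) * 2 ^ (-(n:ℤ)) ≤ 2 ^ (2 * n) * 2 ^ (-(n:ℤ)) :=
            mul_le_mul_of_nonneg_right h4 (by positivity)
        _ = 2 ^ n := by rw [zpow_neg, zpow_natCast, two_mul, pow_add]; field_simp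
    refine ⟨hx, ?_⟩
    rw [← h]
    apply agree_zero
    rw [agree_iff hx (grid_mem _ hj), e0, grid_floor, h2]

lemma cl_meas (n : ℕ) (η : GG (2 * n)) : MeasurableSet (cl n η) := by
  obtain ⟨j, _, _, h⟩ := cl_eq n η
  rw [h]; exact measurableSet_Ico

lemma cl_vol (n : ℕ) (η : GG (2 * n)) : volume (cl n η) = ENNReal.ofReal (2 ^ (-(n:ℤ))) := by
  obtain ⟨j, _, _, h⟩ := cl_eq n η
  rw [h, Real.volume_Ico]; congr 1; ring

def pt (n : ℕ) (η : GG (2 * n)) : ℝ := ((Classical.choose (cF_surj n η) : ℕ) : ℝ) * 2 ^ (-(n:ℤ))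

lemma pt_mem (n : ℕ) (η : GG (2 * n)) : pt n η ∈ Ico (0:ℝ) (2 ^ n) :=
  grid_mem _ (Classical.choose_spec (cF_surj n η)).1

lemma cF_pt (n : ℕ) (η : GG (2 * n)) : cF n (pt n η) = η := (Classical.choose_spec (cF_surj n η)).2

lemma cl_union (n : ℕ) : Ico (0:ℝ) (2 ^ n) = ⋃ η, cl n η := by
  ext x; simp [cl]

lemma cl_disj (n : ℕ) : Pairwise (Function.onFun Disjoint (cl n)) := by
  intro η η' h
  rw [Function.onFun, Set.disjoint_left]
  rintro x ⟨_, h1⟩ ⟨_, h2⟩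
  exact h (h1.symm.trans h2)

lemma setInt_cl (n : ℕ) (F : ℝ → ℝ) (hF : IntegrableOn F (Ico 0 (2 ^ n))) :
    ∫ x in Ico (0:ℝ) (2 ^ n), F x = ∑ η, ∫ x in cl n η, F x := by
  rw [cl_union]
  rw [cl_union] at hF
  exact integral_iUnion_fintype (cl_meas n) (cl_disj n) fun η => hF.mono_set (subset_iUnion _ η)

lemma lint_cl (n : ℕ) (F : ℝ → ℝ≥0∞) :
    ∫⁻ x in Ico (0:ℝ) (2 ^ n), F x = ∑ η, ∫⁻ x in cl n η, F x := by
  rw [cl_union, lintegral_iUnion (cl_meas n) (cl_disj n), tsum_fintype]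

end HI

namespace HI

lemma cell_int (n : ℕ) (φ : GG (2 * n) → ℝ) (h : ℝ → ℝ) (hh : IntegrableOn h (Ico 0 (2 ^ n))) :
    IntegrableOn (fun x => φ (cF n x) * h x) (Ico 0 (2 ^ n)) := by
  rw [cl_union] at hh ⊢
  rw [integrableOn_finite_iUnion] at hh ⊢
  intro η
  have h1 : IntegrableOn (fun x => φ η * h x) (cl n η) := (hh η).const_mul _
  exact h1.congr_fun (fun x hx => by simp only [hx.2]) (cl_meas n η)

lemma cell_sum (n : ℕ) (φ : GG (2 * n) → ℝ) (h : ℝ → ℝ) (hh : IntegrableOn h (Ico 0 (2 ^ n))) :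
    ∫ x in Ico (0:ℝ) (2 ^ n), φ (cF n x) * h x = ∑ η, φ η * ∫ x in cl n η, h x := by
  rw [setInt_cl n _ (cell_int n φ h hh)]
  apply Finset.sum_congr rfl
  intro η _
  rw [← integral_const_mul]
  apply setIntegral_congr_fun (cl_meas n η)
  intro x hx
  simp only [hx.2]

lemma KFT (n : ℕ) {y : ℝ} (hy : y ∈ Ico (0:ℝ) (2 ^ n)) (h : ℝ → ℝ)
    (hh : IntegrableOn h (Ico 0 (2 ^ n))) :
    ∫ x in Ico (0:ℝ) (2 ^ n), walshe (wMul y x) * h x =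
      ∑ η, ww (cF n y) (rv η) * ∫ x in cl n η, h x := by
  rw [← cell_sum n (fun η => ww (cF n y) (rv η)) h hh]
  apply setIntegral_congr_ae measurableSet_Ico
  filter_upwards [kern n hy.1 hy.2] with x hx hxn
  rw [hx hxn]

lemma FT_supp (n : ℕ) (f : ℝ → ℝ) (hf : ∀ x, 0 ≤ x → x ∉ Ico (0:ℝ) (2 ^ n) → f x = 0) (ξ : ℝ) :
    walshFT f ξ = ∫ x in Ico (0:ℝ) (2 ^ n), walshe (wMul ξ x) * f x := by
  unfold walshFT
  apply setIntegral_eq_of_subset_of_forall_sdiff_eq_zero measurableSet_Ici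
  · intro x hx; exact hx.1
  · intro x hx
    rw [hf x hx.1 hx.2, mul_zero]

def gb (n : ℕ) (g : ℝ → ℝ) (y : GG (2 * n)) : ℝ := 2 ^ n * ∫ x in cl n (rv y), g x

def Bb (n : ℕ) (B : ℝ → ℝ) (η : GG (2 * n)) : ℝ := 2 ^ n * ∫ x in cl n η, B x

def rvE (M : ℕ) : GG M ≃ GG M := ⟨rv, rv, rv_rv, rv_rv⟩

lemma FT_cell (n : ℕ) (g : ℝ → ℝ) (hg : IntegrableOn g (Ico 0 (2 ^ n))) {ξ : ℝ}
    (hξ : ξ ∈ Ico (0:ℝ) (2 ^ n)) :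
    walshFT (indicator (Ico 0 (2 ^ n)) g) ξ = ((2:ℝ) ^ n)⁻¹ * hat (gb n g) (cF n ξ) := by
  rw [FT_supp n _ (fun x _ hx => indicator_of_notMem hx _)]
  have e1 : ∫ x in Ico (0:ℝ) (2 ^ n), walshe (wMul ξ x) * indicator (Ico 0 (2 ^ n)) g x =
      ∫ x in Ico (0:ℝ) (2 ^ n), walshe (wMul ξ x) * g x := by
    apply setIntegral_congr_fun measurableSet_Ico
    intro x hx
    simp only [indicator_of_mem hx]
  rw [e1, KFT n hξ g hg]
  unfold hat gb
  rw [Finset.mul_sum]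
  rw [← (rvE (2 * n)).sum_comp]
  apply Finset.sum_congr rfl
  intro y _
  have hp : (2:ℝ) ^ n ≠ 0 := by positivity
  simp only [rvE, Equiv.coe_fn_mk, rv_rv]
  field_simp

def af (a : Set ℝ → ℝ) (n : ℕ) (k : ℕ) (η : GG (2 * n)) : ℝ := a (om ((k:ℤ) - n) (pt n η))

def XX (n : ℕ) (P : Finset ℝ) : Finset (GG (2 * n)) := P.image (cF n)

lemma om_pt {n : ℕ} {x : ℝ} (hx : x ∈ Ico (0:ℝ) (2 ^ n)) (k : ℕ) :
    om ((k:ℤ) - n) (pt n (cF n x)) = om ((k:ℤ) - n) x := by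
  apply om_congr
  rw [← agree_iff (pt_mem n _) hx, cF_pt]
  exact agree_refl _ _

lemma af_agree (a : Set ℝ → ℝ) (n k : ℕ) (η ξ : GG (2 * n)) (h : agree k η ξ) :
    af a n k η = af a n k ξ := by
  unfold af
  congr 1
  apply om_congr
  rw [← agree_iff (pt_mem n _) (pt_mem n _), cF_pt, cF_pt]
  exact h

lemma ex_agree {n : ℕ} (P : Finset ℝ) (hP : ∀ p ∈ P, p ∈ Ico (0:ℝ) (2 ^ n)) {x : ℝ}
    (hx : x ∈ Ico (0:ℝ) (2 ^ n)) (k : ℕ) :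
    (∃ ξ ∈ XX n P, agree k ξ (cF n x)) ↔ (om ((k:ℤ) - n) x ∩ P).Nonempty := by
  constructor
  · rintro ⟨ξ, hξ, h⟩
    obtain ⟨p, hp, rfl⟩ := Finset.mem_image.1 hξ
    rw [agree_iff (hP p hp) hx] at h
    exact ⟨p, mem_om.2 h, hp⟩
  · rintro ⟨p, hp1, hp2⟩
    refine ⟨cF n p, Finset.mem_image_of_mem _ hp2, ?_⟩
    rw [agree_iff (hP p hp2) hx]
    exact mem_om.1 hp1

lemma Dk_fin {n : ℕ} (a : Set ℝ → ℝ) (P : Finset ℝ) (hP : ∀ p ∈ P, p ∈ Ico (0:ℝ) (2 ^ n)) {x : ℝ}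
    (hx : x ∈ Ico (0:ℝ) (2 ^ n)) (k : ℕ) :
    Dk a P ((k:ℤ) - n) x = if ∃ ξ ∈ XX n P, agree k ξ (cF n x) then af a n k (cF n x) else 0 := by
  rw [Dk_eq]
  unfold af
  rw [om_pt hx]
  simp only [ex_agree P hP hx k]

lemma Dk_supp {n : ℕ} (a : Set ℝ → ℝ) (P : Finset ℝ) (hP : ∀ p ∈ P, p ∈ Ico (0:ℝ) (2 ^ n)) {x : ℝ}
    (hx0 : 0 ≤ x) (hx : x ∉ Ico (0:ℝ) (2 ^ n)) {k : ℤ} (hk : k ≤ n) : Dk a P k x = 0 := by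
  rw [Dk_eq, if_neg]
  rintro ⟨p, hp1, hp2⟩
  apply hx
  have h1 := mem_om.1 hp1
  refine ⟨hx0, ?_⟩
  have h2 : ⌊p / 2 ^ (n:ℤ)⌋ = ⌊x / 2 ^ (n:ℤ)⌋ := by
    obtain ⟨i, hi⟩ := Int.le.dest hk
    rw [← hi, floor_pow, floor_pow, h1]
  rw [floor_zero (hP p hp2).1 (hP p hp2).2 le_rfl] at h2
  have h3 := (Int.floor_eq_zero_iff.1 h2.symm).2
  rw [div_lt_one (by positivity), zpow_natCast] at h3
  exact h3

/-- the operators agree with finite model -/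
lemma T_cell (n : ℕ) (a : Set ℝ → ℝ) (P : Finset ℝ) (hP : ∀ p ∈ P, p ∈ Ico (0:ℝ) (2 ^ n))
    (B : ℝ → ℝ) (hB : IntegrableOn B (Ico 0 (2 ^ n)))
    (g : ℝ → ℝ) (hg : IntegrableOn g (Ico 0 (2 ^ n))) (k : ℕ) (hk : k ≤ 2 * n) {x : ℝ}
    (hx : x ∈ Ico (0:ℝ) (2 ^ n)) :
    walshFT (fun ξ => (Dk a P ((k:ℤ) - n) ξ * B ξ) * walshFT (indicator (Ico 0 (2 ^ n)) g) ξ) x =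
      TT (mm (af a n) (XX n P) (Bb n B) k) (gb n g) (rv (cF n x)) := by
  rw [FT_supp n _ (fun z hz0 hz => by rw [Dk_supp a P hP hz0 hz (by omega)]; simp)]
  obtain ⟨φ, hφ⟩ : ∃ φ : GG (2 * n) → ℝ, φ = fun η =>
    (if ∃ ξ ∈ XX n P, agree k ξ η then af a n k η else 0) * (((2:ℝ) ^ n)⁻¹ * hat (gb n g) η) := ⟨_, rfl⟩
  have e1 : ∫ z in Ico (0:ℝ) (2 ^ n), walshe (wMul x z) *
      ((Dk a P ((k:ℤ) - n) z * B z) * walshFT (indicator (Ico 0 (2 ^ n)) g) z) =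
      ∫ z in Ico (0:ℝ) (2 ^ n), walshe (wMul x z) * (φ (cF n z) * B z) := by
    apply setIntegral_congr_fun measurableSet_Ico
    intro z hz
    simp only
    rw [Dk_fin a P hP hz, FT_cell n g hg hz, hφ]
    ring
  rw [e1, KFT n hx _ (cell_int n φ B hB)]
  unfold TT
  rw [Finset.mul_sum]
  apply Finset.sum_congr rfl
  intro η _
  have e2 : ∫ z in cl n η, φ (cF n z) * B z = φ η * ∫ z in cl n η, B z := by
    rw [← integral_const_mul]
    apply setIntegral_congr_fun (cl_meas n η)
    intro z hz
    simp only [hz.2]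
  rw [e2, ← ww_rv (cF n x), rv_rv, ww_comm (rv (cF n x))]
  unfold mm Bb
  rw [hφ]
  simp only
  have h2n : (2:ℝ) ^ (2 * n) = 2 ^ n * 2 ^ n := by rw [two_mul n, pow_add]
  rw [h2n]
  have hp : (2:ℝ) ^ n ≠ 0 := by positivity
  generalize (if ∃ ξ ∈ XX n P, agree k ξ η then af a n k η else 0) = δ
  generalize (2:ℝ) ^ n = Q at hp ⊢
  field_simp

end HI

namespace HI

lemma dedupe (F : ℤ → ℤ → ℝ≥0∞) (hF : ∀ p, F p p = 0) (v : ℕ → ℤ) (hv : Antitone v) (n : ℕ) :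
    ∃ (N : ℕ) (w : Fin (N + 1) → ℤ), StrictMono w ∧ w 0 = v n ∧
      ∑ i ∈ Finset.range n, F (v i) (v (i + 1)) = ∑ i : Fin N, F (w i.succ) (w i.castSucc) := by
  induction n with
  | zero => exact ⟨0, fun _ => v 0, fun i j h => absurd h (by omega), rfl, by simp⟩
  | succ n ih =>
    obtain ⟨N, w, hw, hw0, hs⟩ := ih
    rcases (hv (Nat.le_succ n)).lt_or_eq with h | h
    · refine ⟨N + 1, Fin.cons (v (n + 1)) w, ?_, by simp, ?_⟩
      · rw [Fin.strictMono_iff_lt_succ]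
        intro i
        refine Fin.cases ?_ (fun i => ?_) i
        · simpa [hw0] using h
        · simp only [Fin.cons_succ, ← Fin.succ_castSucc]
          exact hw (Fin.castSucc_lt_succ)
      · rw [Finset.sum_range_succ, hs, Fin.sum_univ_succ, add_comm]
        congr 1
        simp [hw0]
    · refine ⟨N, w, hw, by rw [hw0]; exact h.symm, ?_⟩
      rw [Finset.sum_range_succ, hs]
      have h' : v (n + 1) = v n := h
      rw [h', hF, add_zero]

lemma var_of_vnorm {r V : ℝ} (hr : 2 < r) (hV : 0 ≤ V) (s : ℤ → ℝ)
    (h : vnorm r (Set.univ : Set ℤ) s ≤ ENNReal.ofReal V) :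
    (∀ k, |s k| ≤ V) ∧ ∀ (n : ℕ) (v : ℕ → ℤ), Antitone v →
      ∑ i ∈ Finset.range n, |s (v (i + 1)) - s (v i)| ^ r ≤ V ^ r := by
  unfold vnorm at h
  constructor
  · intro k
    have h1 : (‖s k‖₊ : ℝ≥0∞) ≤ ENNReal.ofReal V :=
      ((le_iSup₂ (f := fun ξ (_ : ξ ∈ (Set.univ : Set ℤ)) => (‖s ξ‖₊ : ℝ≥0∞)) k (mem_univ k)).trans
        le_self_add).trans h
    have h2 : ENNReal.ofReal |s k| ≤ ENNReal.ofReal V := by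
      convert h1 using 1
      rw [← Real.norm_eq_abs, ofReal_norm]; rfl
    exact (ENNReal.ofReal_le_ofReal_iff hV).1 h2
  · intro n v hv
    obtain ⟨N, w, hw, _, hs⟩ := dedupe (fun p p' => (‖s p - s p'‖₊ : ℝ≥0∞) ^ r)
      (fun p => by simp; linarith) v hv n
    have h1 : (∑ i : Fin N, (‖s (w i.succ) - s (w i.castSucc)‖₊ : ℝ≥0∞) ^ r) ^ (1 / r) ≤
        ENNReal.ofReal V := by
      refine le_trans ?_ (le_add_self.trans h)
      refine le_iSup_of_le N (le_iSup_of_le w (le_iSup_of_le hw (le_iSup_of_le (fun _ => mem_univ _) le_rfl)))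
    rw [← hs] at h1
    have h2 := ENNReal.rpow_le_rpow h1 (by linarith : 0 ≤ r)
    rw [← ENNReal.rpow_mul, one_div_mul_cancel (by linarith), ENNReal.rpow_one,
      ENNReal.ofReal_rpow_of_nonneg hV (by linarith)] at h2
    rw [← ENNReal.ofReal_le_ofReal_iff (by positivity)]
    refine le_trans (le_of_eq ?_) h2
    rw [ENNReal.ofReal_sum_of_nonneg (fun i _ => by positivity)]
    apply Finset.sum_congr rfl
    intro i _
    rw [← ENNReal.ofReal_rpow_of_nonneg (abs_nonneg _) (by linarith), abs_sub_comm, ← Real.norm_eq_abs,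
      ofReal_norm]
    rfl

lemma varle {r V : ℝ} (hr : 2 < r) (hV : 0 ≤ V) (a : Set ℝ → ℝ) (n : ℕ) {ξ : ℝ}
    (hξ : ξ ∈ Ico (0:ℝ) (2 ^ n)) (h : vnorm r (Set.univ : Set ℤ) (dyadicSum a ξ) ≤ ENNReal.ofReal V) :
    VarLe r V (2 * n) (fun j => af a n (2 * n - j) (cF n ξ)) := by
  obtain ⟨h1, h2⟩ := var_of_vnorm hr hV _ h
  have e : ∀ j ≤ 2 * n, af a n (2 * n - j) (cF n ξ) = dyadicSum a ξ ((n:ℤ) - j) := by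
    intro j hj
    rw [dyadicSum_eq]
    unfold af
    rw [om_pt hξ]
    congr 2
    omega
  refine ⟨?_, ?_⟩
  · intro j hj
    simp only
    rw [e j hj]; exact h1 _
  · intro m u hu huJ
    refine le_trans (le_of_eq ?_) (h2 m (fun i => (n:ℤ) - u i) ?_)
    · apply Finset.sum_congr rfl
      intro i _
      simp only
      rw [e _ (huJ _), e _ (huJ _)]
    · intro i j hij
      have := hu hij
      simp only
      omega

/-- coefficient function -/
def BB (Y : Set (Set ℝ)) (b : Set ℝ → ℝ) (ξ : ℝ) : ℝ :=
  ∑ᶠ v ∈ Y, b v * Set.indicator v (fun _ => (1 : ℝ)) ξ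

lemma BB_eq {Y : Set (Set ℝ)} (hY : Y.Finite) (b : Set ℝ → ℝ) (ξ : ℝ) :
    BB Y b ξ = ∑ v ∈ hY.toFinset, b v * Set.indicator v (fun _ => (1 : ℝ)) ξ := by
  unfold BB
  rw [finsum_mem_eq_finite_toFinset_sum _ hY]

lemma BB_meas {Y : Set (Set ℝ)} (hY : Y.Finite) (hO : ∀ v ∈ Y, v.OrdConnected) (b : Set ℝ → ℝ) :
    Measurable (BB Y b) := by
  have : BB Y b = fun ξ => ∑ v ∈ hY.toFinset, b v * Set.indicator v (fun _ => (1 : ℝ)) ξ := by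
    funext ξ; exact BB_eq hY b ξ
  rw [this]
  apply Finset.measurable_sum
  intro v hv
  apply Measurable.const_mul
  exact measurable_const.indicator (hO v (hY.mem_toFinset.1 hv)).measurableSet

lemma BB_bd {Y : Set (Set ℝ)} (hY : Y.Finite) (hD : Y.PairwiseDisjoint id) (b : Set ℝ → ℝ)
    {β : ℝ} (hβ : 0 ≤ β) (hb : ∀ v ∈ Y, |b v| ≤ β) (ξ : ℝ) : |BB Y b ξ| ≤ β := by
  rw [BB_eq hY]
  by_cases h : ∃ v ∈ Y, ξ ∈ v
  · obtain ⟨v, hv, hξ⟩ := h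
    rw [Finset.sum_eq_single_of_mem v (hY.mem_toFinset.2 hv)]
    · rw [indicator_of_mem hξ, mul_one]; exact hb v hv
    · intro w hw hwv
      rw [indicator_of_notMem, mul_zero]
      intro hξw
      exact Set.disjoint_left.1 (hD (hY.mem_toFinset.1 hw) hv hwv) hξw hξ
  · push Not at h
    rw [Finset.sum_eq_zero]
    · simpa using hβ
    · intro v hv
      rw [indicator_of_notMem (h v (hY.mem_toFinset.1 hv)), mul_zero]

lemma ordc_const {v ω : Set ℝ} (hv : v.OrdConnected) (hω : ω.OrdConnected)
    (h1 : sInf v ∉ ω) (h2 : sSup v ∉ ω) {p p' : ℝ} (hp : p ∈ ω) (hp' : p' ∈ ω) (hpv : p ∈ v) :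
    p' ∈ v := by
  by_contra hn
  rcases lt_trichotomy p p' with h | h | h
  · apply h2
    have hub : p' ∈ upperBounds v := by
      intro z hz
      by_contra hz'
      exact hn (hv.out hpv hz ⟨h.le, (not_le.1 hz').le⟩)
    exact hω.out hp hp' ⟨le_csSup ⟨p', hub⟩ hpv, csSup_le ⟨p, hpv⟩ hub⟩
  · exact hn (h ▸ hpv)
  · apply h1
    have hlb : p' ∈ lowerBounds v := by
      intro z hz
      by_contra hz'
      exact hn (hv.out hz hpv ⟨(not_le.1 hz').le, h.le⟩)
    exact hω.out hp' hp ⟨le_csInf ⟨p, hpv⟩ hlb, csInf_le ⟨p', hlb⟩ hpv⟩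

lemma BB_const {Y : Set (Set ℝ)} (hY : Y.Finite) (hO : ∀ v ∈ Y, v.OrdConnected) (b : Set ℝ → ℝ)
    {ω : Set ℝ} (hω : ω.OrdConnected) (h1 : ∀ v ∈ Y, sInf v ∉ ω) (h2 : ∀ v ∈ Y, sSup v ∉ ω)
    {p p' : ℝ} (hp : p ∈ ω) (hp' : p' ∈ ω) : BB Y b p = BB Y b p' := by
  rw [BB_eq hY, BB_eq hY]
  apply Finset.sum_congr rfl
  intro v hv
  have hv' := hY.mem_toFinset.1 hv
  by_cases h : p ∈ v
  · rw [indicator_of_mem h, indicator_of_mem (ordc_const (hO v hv') hω (h1 v hv') (h2 v hv') hp hp' h)]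
  · rw [indicator_of_notMem h, indicator_of_notMem
      (fun h' => h (ordc_const (hO v hv') hω (h1 v hv') (h2 v hv') hp' hp h'))]

lemma BB_int {Y : Set (Set ℝ)} (hY : Y.Finite) (hD : Y.PairwiseDisjoint id)
    (hO : ∀ v ∈ Y, v.OrdConnected) (b : Set ℝ → ℝ)
    {β : ℝ} (hβ : 0 ≤ β) (hb : ∀ v ∈ Y, |b v| ≤ β) (s : Set ℝ) (hs : volume s ≠ ⊤) :
    IntegrableOn (BB Y b) s := by
  apply Measure.integrableOn_of_bounded hs (BB_meas hY hO b).aestronglyMeasurable (M := β)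
  exact Eventually.of_forall fun x => BB_bd hY hD b hβ hb x

lemma cl_vol_real (n : ℕ) (η : GG (2 * n)) : (volume : Measure ℝ).real (cl n η) = ((2:ℝ) ^ n)⁻¹ := by
  rw [Measure.real, cl_vol, ENNReal.toReal_ofReal (by positivity), zpow_neg, zpow_natCast]

lemma Bb_bd {B : ℝ → ℝ} {β : ℝ} (h : ∀ x, |B x| ≤ β) (n : ℕ) (η : GG (2 * n)) : |Bb n B η| ≤ β := by
  unfold Bb
  have h1 : ‖∫ x in cl n η, B x‖ ≤ β * (volume : Measure ℝ).real (cl n η) :=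
    norm_setIntegral_le_of_norm_le_const (by rw [cl_vol]; exact ENNReal.ofReal_lt_top)
      (fun x _ => h x)
  rw [cl_vol_real, Real.norm_eq_abs] at h1
  have hp : (0:ℝ) < 2 ^ n := by positivity
  rw [abs_mul, abs_of_pos hp]
  calc 2 ^ n * |∫ x in cl n η, B x| ≤ 2 ^ n * (β * (2 ^ n)⁻¹) := mul_le_mul_of_nonneg_left h1 hp.le
    _ = β := by field_simp

lemma Bb_const {B : ℝ → ℝ} {c : ℝ} (n : ℕ) (η : GG (2 * n)) (h : ∀ x ∈ cl n η, B x = c) :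
    Bb n B η = c := by
  unfold Bb
  rw [setIntegral_congr_fun (g := fun _ => c) (cl_meas n η) h, setIntegral_const, cl_vol_real, smul_eq_mul]
  have hp : (0:ℝ) < 2 ^ n := by positivity
  field_simp

lemma Bb_loc {Y : Set (Set ℝ)} (hY : Y.Finite) (hO : ∀ v ∈ Y, v.OrdConnected) (b : Set ℝ → ℝ)
    (n : ℕ) (P : Finset ℝ) (hP : ∀ p ∈ P, p ∈ Ico (0:ℝ) (2 ^ n))
    (h1 : ∀ v ∈ Y, sInf v ∈ P) (h2 : ∀ v ∈ Y, sSup v ∈ P) (k0 : ℕ) (η η' : GG (2 * n))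
    (hag : agree k0 η η') (hE : ∀ e ∈ XX n P, ¬ agree k0 e η) :
    Bb n (BB Y b) η = Bb n (BB Y b) η' := by
  have hno : ∀ p ∈ P, p ∉ om ((k0:ℤ) - n) (pt n η) := by
    intro p hp hmem
    apply hE (cF n p) (Finset.mem_image_of_mem _ hp)
    rw [← cF_pt n η, agree_iff (hP p hp) (pt_mem n η)]
    exact mem_om.1 hmem
  have hsub : ∀ ζ, agree k0 ζ η → ∀ x ∈ cl n ζ, x ∈ om ((k0:ℤ) - n) (pt n η) := by
    intro ζ hζ x hx
    rw [mem_om, ← agree_iff hx.1 (pt_mem n η), cF_pt, hx.2]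
    exact hζ
  have hc : ∀ ζ, agree k0 ζ η → Bb n (BB Y b) ζ = BB Y b (pt n η) := by
    intro ζ hζ
    apply Bb_const
    intro x hx
    exact BB_const hY hO b ordConnected_Ico (fun v hv => hno _ (h1 v hv)) (fun v hv => hno _ (h2 v hv))
      (hsub ζ hζ x hx) (mem_om.2 rfl)
  rw [hc η (agree_refl _ _), hc η' hag.symm]

end HI

namespace HI

lemma jensen_cell {q : ℝ} (hq : 1 < q) (n : ℕ) (g : ℝ → ℝ) (y : GG (2 * n))
    (hg : IntegrableOn g (cl n (rv y))) :
    ENNReal.ofReal (2 ^ (-(n:ℤ))) * ENNReal.ofReal (|gb n g y| ^ q) ≤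
      ∫⁻ x in cl n (rv y), ‖g x‖ₑ ^ q := by
  have hq0 : 0 < q := by linarith
  have h1 := eLpNorm'_le_eLpNorm'_mul_rpow_measure_univ (p := 1) (q := q) one_pos hq.le
    hg.aestronglyMeasurable
  simp only [eLpNorm', ENNReal.rpow_one, div_one, Measure.restrict_apply_univ, cl_vol] at h1
  have h2 : ‖∫ x in cl n (rv y), g x‖ₑ ≤ ∫⁻ x in cl n (rv y), ‖g x‖ₑ := enorm_integral_le_lintegral_enorm _
  have h3 := ENNReal.rpow_le_rpow (h2.trans h1) hq0.le
  rw [ENNReal.mul_rpow_of_nonneg _ _ hq0.le, ← ENNReal.rpow_mul, ← ENNReal.rpow_mul,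
    one_div_mul_cancel hq0.ne', ENNReal.rpow_one] at h3
  have e0 : (1 - 1 / q) * q = q - 1 := by field_simp
  rw [e0] at h3
  have e1 : ENNReal.ofReal (|gb n g y| ^ q) =
      ((ENNReal.ofReal (2 ^ (-(n:ℤ))))⁻¹) ^ q * ‖∫ x in cl n (rv y), g x‖ₑ ^ q := by
    unfold gb
    rw [← ENNReal.ofReal_rpow_of_nonneg (abs_nonneg _) hq0.le, abs_mul, ENNReal.ofReal_mul (abs_nonneg _),
      ENNReal.mul_rpow_of_nonneg _ _ hq0.le]
    congr 2
    · rw [← ENNReal.ofReal_inv_of_pos (by positivity), abs_of_pos (by positivity)]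
      congr 1; rw [zpow_neg, inv_inv, zpow_natCast]
    · rw [← Real.norm_eq_abs, ofReal_norm]
  rw [e1]
  have d0 : ENNReal.ofReal (2 ^ (-(n:ℤ))) ≠ 0 := by
    rw [Ne, ENNReal.ofReal_eq_zero, not_le]; positivity
  have d1 : ENNReal.ofReal (2 ^ (-(n:ℤ))) ≠ ⊤ := ENNReal.ofReal_ne_top
  generalize ENNReal.ofReal (2 ^ (-(n:ℤ))) = δ at *
  have e2 : δ * (δ⁻¹ ^ q * δ ^ (q - 1)) = 1 := by
    have : δ * δ ^ (q - 1) = δ ^ q := by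
      conv_lhs => rw [← ENNReal.rpow_one δ, ← ENNReal.rpow_mul, one_mul]
      rw [← ENNReal.rpow_add _ _ d0 d1]; congr 1; ring
    rw [mul_left_comm, this, ENNReal.inv_rpow, ENNReal.inv_mul_cancel]
    · simp [d0, d1]
    · exact ENNReal.rpow_ne_top_of_nonneg hq0.le d1
  calc δ * (δ⁻¹ ^ q * ‖∫ x in cl n (rv y), g x‖ₑ ^ q)
      ≤ δ * (δ⁻¹ ^ q * ((∫⁻ x in cl n (rv y), ‖g x‖ₑ ^ q) * δ ^ (q - 1))) := by gcongr
    _ = (δ * (δ⁻¹ ^ q * δ ^ (q - 1))) * (∫⁻ x in cl n (rv y), ‖g x‖ₑ ^ q) := by ring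
    _ = _ := by rw [e2, one_mul]

def FN (n : ℕ) (S : GG (2 * n) → ℝ) (x : ℝ) : ℝ≥0∞ :=
  indicator (Ico (0:ℝ) (2 ^ n)) (fun x => ENNReal.ofReal (S (rv (cF n x)))) x

lemma FN_meas (n : ℕ) (S : GG (2 * n) → ℝ) : Measurable (FN n S) := by
  have : FN n S = fun x => ∑ η, indicator (cl n η) (fun _ => ENNReal.ofReal (S (rv η))) x := by
    funext x
    unfold FN
    by_cases hx : x ∈ Ico (0:ℝ) (2 ^ n)
    · have hm : x ∈ cl n (cF n x) := ⟨hx, rfl⟩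
      rw [indicator_of_mem hx, Finset.sum_eq_single_of_mem (cF n x) (Finset.mem_univ _),
        indicator_of_mem hm]
      intro η _ hη
      exact indicator_of_notMem (fun h => hη h.2.symm) _
    · rw [indicator_of_notMem hx, Finset.sum_eq_zero]
      intro η _
      exact indicator_of_notMem (fun h => hx h.1) _
  rw [this]
  apply Finset.measurable_sum
  intro η _
  exact measurable_const.indicator (cl_meas n η)

lemma FN_int {q : ℝ} (hq : 1 < q) (n : ℕ) (g : ℝ → ℝ) (hg : IntegrableOn g (Ico 0 (2 ^ n)))
    (S : GG (2 * n) → ℝ) (hS : ∀ x, 0 ≤ S x) {K : ℝ} (hK : 0 ≤ K)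
    (h : ∑ x, S x ^ q ≤ K ^ q * ∑ y, |gb n g y| ^ q) :
    ∫⁻ x in Ici (0:ℝ), FN n S x ^ q ≤ ENNReal.ofReal K ^ q * ∫⁻ x in Ici (0:ℝ), ‖g x‖ₑ ^ q := by
  have hq0 : 0 < q := by linarith
  have e1 : ∫⁻ x in Ici (0:ℝ), FN n S x ^ q =
      ∫⁻ x in Ico (0:ℝ) (2 ^ n), ENNReal.ofReal (S (rv (cF n x)) ^ q) := by
    have : ∀ x, FN n S x ^ q =
        indicator (Ico (0:ℝ) (2 ^ n)) (fun x => ENNReal.ofReal (S (rv (cF n x)) ^ q)) x := by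
      intro x
      unfold FN
      by_cases hx : x ∈ Ico (0:ℝ) (2 ^ n)
      · rw [indicator_of_mem hx, indicator_of_mem hx, ENNReal.ofReal_rpow_of_nonneg (hS _) hq0.le]
      · rw [indicator_of_notMem hx, indicator_of_notMem hx, ENNReal.zero_rpow_of_pos hq0]
    simp_rw [this]
    rw [lintegral_indicator measurableSet_Ico, Measure.restrict_restrict measurableSet_Ico,
      inter_eq_left.2 (fun x hx => hx.1)]
  rw [e1, lint_cl]
  have e2 : ∀ η, ∫⁻ x in cl n η, ENNReal.ofReal (S (rv (cF n x)) ^ q) =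
      ENNReal.ofReal (2 ^ (-(n:ℤ))) * ENNReal.ofReal (S (rv η) ^ q) := by
    intro η
    rw [setLIntegral_congr_fun (g := fun _ => ENNReal.ofReal (S (rv η) ^ q)) (cl_meas n η)
      (fun x hx => by simp only [hx.2]), setLIntegral_const, cl_vol, mul_comm]
  simp_rw [e2]
  have e3 : ∑ i, ENNReal.ofReal (S (rv i) ^ q) = ∑ i, ENNReal.ofReal (S i ^ q) :=
    (rvE (2 * n)).sum_comp (fun η => ENNReal.ofReal (S η ^ q))
  rw [← Finset.mul_sum, e3,
    ← ENNReal.ofReal_sum_of_nonneg (fun i _ => by have := hS i; positivity)]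
  calc ENNReal.ofReal (2 ^ (-(n:ℤ))) * ENNReal.ofReal (∑ i, S i ^ q)
      ≤ ENNReal.ofReal (2 ^ (-(n:ℤ))) * ENNReal.ofReal (K ^ q * ∑ y, |gb n g y| ^ q) := by gcongr
    _ = ENNReal.ofReal K ^ q * ∑ y, ENNReal.ofReal (2 ^ (-(n:ℤ))) * ENNReal.ofReal (|gb n g y| ^ q) := by
      rw [ENNReal.ofReal_mul (by positivity), ENNReal.ofReal_sum_of_nonneg (fun i _ => by positivity),
        ← Finset.mul_sum, ENNReal.ofReal_rpow_of_nonneg hK hq0.le]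
      ring
    _ ≤ ENNReal.ofReal K ^ q * ∑ y, ∫⁻ x in cl n (rv y), ‖g x‖ₑ ^ q := by
      gcongr with y
      exact jensen_cell hq n g y (hg.mono_set fun x hx => hx.1)
    _ = ENNReal.ofReal K ^ q * ∫⁻ x in Ico (0:ℝ) (2 ^ n), ‖g x‖ₑ ^ q := by
      have e4 : ∑ y, ∫⁻ x in cl n (rv y), ‖g x‖ₑ ^ q = ∑ y, ∫⁻ x in cl n y, ‖g x‖ₑ ^ q :=
        (rvE (2 * n)).sum_comp (fun η => ∫⁻ x in cl n η, ‖g x‖ₑ ^ q)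
      rw [lint_cl, e4]
    _ ≤ _ := by
      gcongr
      exact fun x hx => hx.1

lemma abs_walshe (z : ℝ) : |walshe z| = 1 := by
  unfold walshe; rw [abs_zpow]; simp

lemma cF_aesm (n : ℕ) (φ : GG (2 * n) → ℝ) :
    AEStronglyMeasurable (fun x => φ (cF n x)) (volume.restrict (Ico (0:ℝ) (2 ^ n))) := by
  have h := cell_int n φ (fun _ => 1) (integrableOn_const (by simp) (by simp))
  simpa using h.aestronglyMeasurable

lemma exists_pow_gt (x : ℝ) : ∃ n : ℕ, x < 2 ^ n := pow_unbounded_of_one_lt x (by norm_num)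

lemma Ici_union (n0 : ℕ) : Ici (0:ℝ) = ⋃ n : ℕ, Ico (0:ℝ) (2 ^ (n + n0)) := by
  ext x
  simp only [mem_Ici, mem_iUnion, mem_Ico]
  constructor
  · intro h
    obtain ⟨n, hn⟩ := exists_pow_gt x
    exact ⟨n, h, hn.trans_le (pow_le_pow_right₀ (by norm_num) (by omega))⟩
  · rintro ⟨n, h, _⟩; exact h

lemma K_aesm {ξ : ℝ} (hξ : 0 ≤ ξ) :
    AEStronglyMeasurable (fun x => walshe (wMul ξ x)) (volume.restrict (Ici (0:ℝ))) := by
  obtain ⟨n0, hn0⟩ := exists_pow_gt ξ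
  rw [Ici_union n0, aestronglyMeasurable_iUnion_iff]
  intro n
  have h1 := cF_aesm (n + n0) (fun η => ww (cF (n + n0) ξ) (rv η))
  refine h1.congr ?_
  have h2 : ξ < 2 ^ (n + n0) := hn0.trans_le (pow_le_pow_right₀ (by norm_num) (by omega))
  have h3 := kern (n + n0) hξ h2
  rw [EventuallyEq, ae_restrict_iff' measurableSet_Ico]
  filter_upwards [h3] with x hx hxn
  exact (hx hxn).symm

lemma FT_nonint (g : ℝ → ℝ) (hg : ¬ IntegrableOn g (Ici 0)) {ξ : ℝ} (hξ : 0 ≤ ξ) : walshFT g ξ = 0 := by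
  unfold walshFT
  apply integral_undef
  intro h
  apply hg
  have h1 := h.bdd_mul (c := 1) (K_aesm hξ) (Eventually.of_forall fun x => by
    rw [Real.norm_eq_abs, abs_walshe])
  refine h1.congr (Eventually.of_forall fun x => ?_)
  have h2 : walshe (wMul ξ x) * walshe (wMul ξ x) = 1 := by
    rw [← abs_mul_abs_self, abs_walshe, one_mul]
  simp only
  rw [← mul_assoc, h2, one_mul]

lemma FT_lim (g : ℝ → ℝ) (hg : IntegrableOn g (Ici 0)) {ξ : ℝ} (hξ : 0 ≤ ξ) :
    Tendsto (fun n : ℕ => walshFT (indicator (Ico 0 (2 ^ n)) g) ξ) atTop (nhds (walshFT g ξ)) := by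
  unfold walshFT
  apply tendsto_integral_filter_of_dominated_convergence (fun x => ‖g x‖)
  · apply Eventually.of_forall
    intro n
    exact (K_aesm hξ).mul (hg.aestronglyMeasurable.indicator measurableSet_Ico)
  · apply Eventually.of_forall
    intro n
    apply Eventually.of_forall
    intro x
    rw [norm_mul, Real.norm_eq_abs, abs_walshe, one_mul]
    exact norm_indicator_le_norm_self _ _
  · exact hg.norm
  · rw [ae_restrict_iff' measurableSet_Ici]
    apply Eventually.of_forall
    intro x hx
    apply tendsto_const_nhds.congr'
    obtain ⟨n0, hn0⟩ := exists_pow_gt x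
    filter_upwards [eventually_ge_atTop n0] with n hn
    have hm : x ∈ Ico (0:ℝ) (2 ^ n) := ⟨hx, hn0.trans_le (pow_le_pow_right₀ (by norm_num) hn)⟩
    rw [indicator_of_mem hm]

lemma FT_bd (g : ℝ → ℝ) (hg : IntegrableOn g (Ici 0)) (n : ℕ) (ξ : ℝ) :
    ‖walshFT (indicator (Ico 0 (2 ^ n)) g) ξ‖ ≤ ∫ x in Ici (0:ℝ), ‖g x‖ := by
  unfold walshFT
  apply norm_integral_le_of_norm_le hg.norm
  apply Eventually.of_forall
  intro x
  rw [norm_mul, Real.norm_eq_abs, abs_walshe, one_mul]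
  exact norm_indicator_le_norm_self _ _

lemma T_lim (a : Set ℝ → ℝ) (P : Finset ℝ) (n0 : ℕ) (hP : ∀ p ∈ P, p ∈ Ico (0:ℝ) (2 ^ n0))
    (B : ℝ → ℝ) (hB : ∀ n : ℕ, IntegrableOn B (Ico 0 (2 ^ n)))
    (g : ℝ → ℝ) (hg : IntegrableOn g (Ici 0)) (k : ℤ) {x : ℝ} (hx : 0 ≤ x) :
    Tendsto (fun n : ℕ => walshFT (fun ξ => (Dk a P k ξ * B ξ) *
      walshFT (indicator (Ico 0 (2 ^ n)) g) ξ) x) atTop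
      (nhds (walshFT (fun ξ => (Dk a P k ξ * B ξ) * walshFT g ξ) x)) := by
  obtain ⟨m, hm⟩ : ∃ m, m = n0 + k.natAbs := ⟨_, rfl⟩
  have hP' : ∀ p ∈ P, p ∈ Ico (0:ℝ) (2 ^ m) := fun p hp =>
    ⟨(hP p hp).1, (hP p hp).2.trans_le (pow_le_pow_right₀ (by norm_num) (by omega))⟩
  have hs : ∀ f : ℝ → ℝ, walshFT (fun ξ => (Dk a P k ξ * B ξ) * f ξ) x =
      ∫ ξ in Ico (0:ℝ) (2 ^ m), walshe (wMul x ξ) * ((Dk a P k ξ * B ξ) * f ξ) := by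
    intro f
    exact FT_supp m _ (fun z hz0 hz => by rw [Dk_supp a P hP' hz0 hz (by omega)]; simp) x
  simp_rw [hs]
  have hmint : IntegrableOn (fun ξ => Dk a P k ξ * B ξ) (Ico 0 (2 ^ m)) := by
    have h1 := cell_int m (fun η => if ∃ ξ ∈ XX m P, agree (k + m).toNat ξ η
      then af a m (k + m).toNat η else 0) B (hB m)
    refine h1.congr_fun ?_ measurableSet_Ico
    intro z hz
    simp only
    rw [← Dk_fin a P hP' hz]
    congr 2
    omega
  apply tendsto_integral_filter_of_dominated_convergence
    (fun ξ => ‖Dk a P k ξ * B ξ‖ * ∫ x in Ici (0:ℝ), ‖g x‖)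
  · filter_upwards [eventually_ge_atTop m] with n hn
    apply ((K_aesm hx).mono_measure (Measure.restrict_mono (fun z hz => hz.1) le_rfl)).mul
    apply hmint.aestronglyMeasurable.mul
    have hsub : Ico (0:ℝ) (2 ^ m) ⊆ Ico 0 (2 ^ n) :=
      Ico_subset_Ico_right (pow_le_pow_right₀ (by norm_num) hn)
    have h1 := (cF_aesm n (fun η => ((2:ℝ) ^ n)⁻¹ * hat (gb n g) η)).mono_measure
      (Measure.restrict_mono hsub le_rfl)
    refine h1.congr ?_
    rw [EventuallyEq, ae_restrict_iff' measurableSet_Ico]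
    apply Eventually.of_forall
    intro z hz
    exact (FT_cell n g (hg.mono_set fun z hz => hz.1) (hsub hz)).symm
  · apply Eventually.of_forall
    intro n
    apply Eventually.of_forall
    intro z
    rw [norm_mul, Real.norm_eq_abs (walshe _), abs_walshe, one_mul, norm_mul (Dk a P k z * B z)]
    exact mul_le_mul_of_nonneg_left (FT_bd g hg n z) (norm_nonneg _)
  · exact hmint.norm.mul_const _
  · rw [ae_restrict_iff' measurableSet_Ico]
    apply Eventually.of_forall
    intro z hz
    exact ((FT_lim g hg hz.1).const_mul _).const_mul _

end HI

namespace HI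

lemma exS (M : ℕ) (T : ℕ → GG M → ℝ) : ∃ S : GG M → ℝ, (∀ y, 0 ≤ S y) ∧
    (∀ y, ∃ k ≤ M, S y ≤ |T k y|) ∧ (∀ y, ∀ k ≤ M, |T k y| ≤ S y) := by
  have h : ∀ y, ∃ k ∈ Finset.range (M + 1), ∀ k' ∈ Finset.range (M + 1), |T k' y| ≤ |T k y| :=
    fun y => Finset.exists_max_image _ _ ⟨0, by simp⟩
  choose κ h1 h2 using h
  refine ⟨fun y => |T (κ y) y|, fun y => abs_nonneg _, fun y => ⟨κ y, ?_, le_rfl⟩, fun y k hk => ?_⟩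
  · have := h1 y
    rw [Finset.mem_range] at this; omega
  · exact h2 y k (by rw [Finset.mem_range]; omega)

theorem core {q r : ℝ} (hq1 : 1 < q) (hq2 : q ≤ 2) (hr : 2 < r) :
    ∃ C : ℝ, 0 < C ∧ ∀ (X0 : Finset ℝ), (∀ x ∈ X0, 0 ≤ x) → ∀ a : Set ℝ → ℝ,
    ∀ Y : Set (Set ℝ), Y.Finite → Y.PairwiseDisjoint id →
    (∀ v ∈ Y, v ⊆ Ici 0 ∧ v.OrdConnected) → ∀ b : Set ℝ → ℝ, ∀ V β : ℝ, 0 < V → 0 < β →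
    (∀ ξ ∈ X0, vnorm r (Set.univ : Set ℤ) (dyadicSum a ξ) ≤ ENNReal.ofReal V) →
    (∀ v ∈ Y, |b v| ≤ β) → ∀ N L0 : ℕ, 1 ≤ N → X0.card + 2 * Y.ncard ≤ N → N ≤ 2 ^ L0 →
    ∀ g : ℝ → ℝ, eLpNorm g (ENNReal.ofReal q) μplus = 1 →
    lpNormE q μplus (fun x => ⨆ k : ℤ,
      (‖walshFT (fun ξ => (Dk a X0 k ξ * BB Y b ξ) * walshFT g ξ) x‖₊ : ℝ≥0∞)) ≤
      ENNReal.ofReal (C * ((L0 + 1) * (N : ℝ) ^ (1 / q - 1 / r) * V * β)) := by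
  obtain ⟨C, hC, hmain⟩ := finmain hq1 hq2 hr
  refine ⟨C, hC, ?_⟩
  intro X0 hX0 a Y hY hYD hYO b V β hV hβ hvar hb N L0 hN1 hcard hNL g hg1
  have hq0 : 0 < q := by linarith
  have hO : ∀ v ∈ Y, v.OrdConnected := fun v hv => (hYO v hv).2
  obtain ⟨K, hK⟩ : ∃ K, K = C * ((L0 + 1) * (N : ℝ) ^ (1 / q - 1 / r) * V * β) := ⟨_, rfl⟩
  have hK0 : 0 ≤ K := by rw [hK]; positivity
  rw [← hK]
  by_cases hg : IntegrableOn g (Ici 0)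
  swap
  · have hz : ∀ x k, walshFT (fun ξ => (Dk a X0 k ξ * BB Y b ξ) * walshFT g ξ) x = 0 := by
      intro x k
      unfold walshFT
      apply setIntegral_eq_zero_of_forall_eq_zero
      intro ξ hξ
      have := FT_nonint g hg hξ
      unfold walshFT at this
      simp only [this, mul_zero]
    simp only [hz, lpNormE]
    simp [hq0]
  have hgn : ∀ n : ℕ, IntegrableOn g (Ico 0 (2 ^ n)) := fun n => hg.mono_set fun z hz => hz.1
  have hgq : ∫⁻ x in Ici (0:ℝ), ‖g x‖ₑ ^ q = 1 := by
    rw [eLpNorm_eq_lintegral_rpow_enorm_toReal (by simpa using hq0) ENNReal.ofReal_ne_top,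
      ENNReal.toReal_ofReal hq0.le] at hg1
    have h2 := congrArg (fun t => t ^ q) hg1
    simp only [ENNReal.one_rpow] at h2
    rwa [← ENNReal.rpow_mul, one_div_mul_cancel hq0.ne', ENNReal.rpow_one] at h2
  obtain ⟨P, hPdef⟩ : ∃ P : Finset ℝ, P = X0 ∪ (hY.toFinset.image sInf ∪ hY.toFinset.image sSup) := ⟨_, rfl⟩
  have hXP : X0 ⊆ P := by rw [hPdef]; exact Finset.subset_union_left
  have hPi : ∀ v ∈ Y, sInf v ∈ P := by
    intro v hv; rw [hPdef]
    exact Finset.mem_union_right _ (Finset.mem_union_left _ (Finset.mem_image_of_mem _ (hY.mem_toFinset.2 hv)))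
  have hPs : ∀ v ∈ Y, sSup v ∈ P := by
    intro v hv; rw [hPdef]
    exact Finset.mem_union_right _ (Finset.mem_union_right _ (Finset.mem_image_of_mem _ (hY.mem_toFinset.2 hv)))
  have hP0 : ∀ p ∈ P, 0 ≤ p := by
    intro p hp
    rw [hPdef, Finset.mem_union, Finset.mem_union, Finset.mem_image, Finset.mem_image] at hp
    rcases hp with hp | ⟨v, hv, rfl⟩ | ⟨v, hv, rfl⟩
    · exact hX0 p hp
    · exact Real.sInf_nonneg fun z hz => (hYO v (hY.mem_toFinset.1 hv)).1 hz
    · exact Real.sSup_nonneg fun z hz => (hYO v (hY.mem_toFinset.1 hv)).1 hz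
  have hPc : P.card ≤ N := by
    have c1 : P.card ≤ X0.card + (hY.toFinset.card + hY.toFinset.card) := by
      rw [hPdef]
      refine (Finset.card_union_le _ _).trans (Nat.add_le_add_left ?_ _)
      exact (Finset.card_union_le _ _).trans (Nat.add_le_add Finset.card_image_le Finset.card_image_le)
    rw [← ncard_eq_toFinset_card Y hY] at c1
    omega
  obtain ⟨n0, hn0⟩ : ∃ n0 : ℕ, ∀ p ∈ P, p ∈ Ico (0:ℝ) (2 ^ n0) := by
    obtain ⟨n0, h⟩ := exists_pow_gt (∑ p ∈ P, p)
    refine ⟨n0, fun p hp => ⟨hP0 p hp, lt_of_le_of_lt ?_ h⟩⟩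
    exact Finset.single_le_sum (f := fun p => p) (fun i hi => hP0 i hi) hp
  have hBint : ∀ n : ℕ, IntegrableOn (BB Y b) (Ico 0 (2 ^ n)) := fun n =>
    BB_int hY hYD hO b hβ.le hb _ (by simp)
  have hF : ∀ n : ℕ, ∃ F : ℝ → ℝ≥0∞, Measurable F ∧
      (∫⁻ x in Ici (0:ℝ), F x ^ q ≤ ENNReal.ofReal K ^ q) ∧
      (n0 ≤ n → ∀ x ∈ Ico (0:ℝ) (2 ^ n), ∀ k : ℤ, k.natAbs ≤ n →
        ‖walshFT (fun ξ => (Dk a X0 k ξ * BB Y b ξ) *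
          walshFT (indicator (Ico 0 (2 ^ n)) g) ξ) x‖ₑ ≤ F x) := by
    intro n
    by_cases hn : n0 ≤ n
    swap
    · exact ⟨fun _ => 0, measurable_const, by simp [hq0], fun h => absurd h hn⟩
    have hPn : ∀ p ∈ P, p ∈ Ico (0:ℝ) (2 ^ n) := fun p hp =>
      ⟨(hn0 p hp).1, (hn0 p hp).2.trans_le (pow_le_pow_right₀ (by norm_num) hn)⟩
    have hXn : ∀ p ∈ X0, p ∈ Ico (0:ℝ) (2 ^ n) := fun p hp => hPn p (hXP hp)
    obtain ⟨S, hS0, hS1, hS2⟩ := exS (2 * n)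
      (fun k y => TT (mm (af a n) (XX n X0) (Bb n (BB Y b)) k) (gb n g) y)
    have h1 := hmain (2 * n) V β hV hβ (XX n X0) (XX n P) (Finset.image_subset_image hXP) N L0 hN1
      (Finset.card_image_le.trans hPc) hNL (af a n) (af_agree a n)
      (by
        intro ξ hξ
        unfold XX at hξ
        rw [Finset.mem_image] at hξ
        obtain ⟨p, hp, rfl⟩ := hξ
        exact varle hr hV.le a n (hXn p hp) (hvar p hp))
      (Bb n (BB Y b)) (Bb_bd (BB_bd hY hYD b hβ.le hb) n)
      (fun k0 η η' hag hE => Bb_loc hY hO b n P hPn hPi hPs k0 η η' hag hE)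
      (gb n g) S hS0 hS1
    rw [← hK] at h1
    have h2 := FN_int hq1 n g (hgn n) S hS0 hK0 h1
    rw [hgq, mul_one] at h2
    refine ⟨FN n S, FN_meas n S, h2, fun _ x hx k hk => ?_⟩
    obtain ⟨j, hj⟩ : ∃ j : ℕ, (j:ℤ) = k + n := ⟨(k + n).toNat, by omega⟩
    have hkj : k = (j:ℤ) - n := by omega
    have h3 := T_cell n a X0 hXn (BB Y b) (hBint n) g (hgn n) j (by omega) hx
    rw [hkj, h3]
    unfold FN
    rw [indicator_of_mem hx, ← ofReal_norm, Real.norm_eq_abs]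
    exact ENNReal.ofReal_le_ofReal (hS2 _ j (by omega))
  choose F hFm hFi hFb using hF
  have hpt : ∀ x ∈ Ici (0:ℝ), (⨆ k : ℤ,
      (‖walshFT (fun ξ => (Dk a X0 k ξ * BB Y b ξ) * walshFT g ξ) x‖₊ : ℝ≥0∞)) ^ q ≤
      liminf (fun n => F n x ^ q) atTop := by
    intro x hx
    have h1 : (⨆ k : ℤ, (‖walshFT (fun ξ => (Dk a X0 k ξ * BB Y b ξ) * walshFT g ξ) x‖₊ : ℝ≥0∞)) ^ q =
        ⨆ k : ℤ, (‖walshFT (fun ξ => (Dk a X0 k ξ * BB Y b ξ) * walshFT g ξ) x‖₊ : ℝ≥0∞) ^ q :=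
      (ENNReal.orderIsoRpow q hq0).map_iSup _
    rw [h1]
    apply iSup_le
    intro k
    have hl := T_lim a X0 n0 (fun p hp => hn0 p (hXP hp)) (BB Y b) hBint g hg k hx
    have hl2 := (ENNReal.continuous_rpow_const (y := q)).continuousAt.tendsto.comp (hl.enorm)
    have h3 := hl2.liminf_eq
    refine le_of_eq_of_le h3.symm ?_
    obtain ⟨n1, hn1⟩ := exists_pow_gt x
    refine liminf_le_liminf ?_
    filter_upwards [eventually_ge_atTop (n0 + n1 + k.natAbs)] with n hn
    simp only [Function.comp]
    apply ENNReal.rpow_le_rpow _ hq0.le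
    exact hFb n (by omega) x ⟨hx, hn1.trans_le (pow_le_pow_right₀ (by norm_num) (by omega))⟩ k (by omega)
  unfold lpNormE μplus
  have hfin : ∫⁻ x in Ici (0:ℝ), (⨆ k : ℤ,
      (‖walshFT (fun ξ => (Dk a X0 k ξ * BB Y b ξ) * walshFT g ξ) x‖₊ : ℝ≥0∞)) ^ q ≤
      ENNReal.ofReal K ^ q := by
    calc _ ≤ ∫⁻ x in Ici (0:ℝ), liminf (fun n => F n x ^ q) atTop :=
          setLIntegral_mono' measurableSet_Ici hpt
      _ ≤ liminf (fun n => ∫⁻ x in Ici (0:ℝ), F n x ^ q) atTop :=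
          lintegral_liminf_le (fun n => (hFm n).pow_const q)
      _ ≤ liminf (fun _ : ℕ => ENNReal.ofReal K ^ q) atTop :=
          liminf_le_liminf (Eventually.of_forall hFi)
      _ = _ := liminf_const _
  calc _ ≤ (ENNReal.ofReal K ^ q) ^ (1 / q) := ENNReal.rpow_le_rpow hfin (by positivity)
    _ = _ := by rw [← ENNReal.rpow_mul, mul_one_div_cancel hq0.ne', ENNReal.rpow_one]

lemma logbd (s : ℕ) (hs : 1 ≤ s) : ∃ L0 : ℕ, 2 * s ≤ 2 ^ L0 ∧ (L0 + 1 : ℝ) ≤ 3 * (1 + Real.log s) := by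
  have h1 : s ≤ 2 ^ (Nat.log 2 s + 1) := (Nat.lt_pow_succ_log_self (by norm_num) s).le
  have h2 : 2 ^ (Nat.log 2 s) ≤ s := Nat.pow_log_le_self 2 (by omega)
  have hl : 0 ≤ Real.log s := Real.log_nonneg (by exact_mod_cast hs)
  have h3 : (Nat.log 2 s : ℝ) * Real.log 2 ≤ Real.log s := by
    rw [← Real.log_pow]
    apply Real.log_le_log (by positivity)
    exact_mod_cast h2
  have h4 := Real.log_two_gt_d9
  by_cases hs1 : s = 1
  · exact ⟨1, by omega, by rw [hs1]; norm_num⟩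
  refine ⟨Nat.log 2 s + 2, by rw [pow_succ]; omega, ?_⟩
  have h5 : (Nat.log 2 s : ℝ) ≤ 2 * Real.log s := by
    have : (0:ℝ) ≤ Nat.log 2 s := by positivity
    nlinarith
  push_cast
  linarith

theorem final (q r : ℝ) (hq1 : 1 < q) (hq2 : q ≤ 2) (hr : 2 < r) :
    ∃ C : ℝ, 0 < C ∧ ∀ Ξ : Set ℝ, Ξ.Finite → Ξ ⊆ Set.Ici 0 → ∀ a : Set ℝ → ℝ,
    ∀ Y : Set (Set ℝ), Y.Finite → Y.PairwiseDisjoint id →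
    (∀ v ∈ Y, v ⊆ Ici 0 ∧ v.OrdConnected) → ∀ b : Set ℝ → ℝ,
    Mqstar q (fun k ξ => Dk a Ξ k ξ * BB Y b ξ) ≤
    ENNReal.ofReal C * ENNReal.ofReal (1 + Real.log ((Ξ.ncard + Y.ncard : ℕ) : ℝ)) *
      ((Ξ.ncard + Y.ncard : ℕ) : ℝ≥0∞) ^ (1 / q - 1 / r) *
      (⨆ ξ ∈ Ξ, vnorm r (Set.univ : Set ℤ) (dyadicSum a ξ)) * ⨆ v ∈ Y, (‖b v‖₊ : ℝ≥0∞) := by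
  obtain ⟨C, hC, hcore⟩ := core hq1 hq2 hr
  refine ⟨6 * C, by positivity, ?_⟩
  intro Ξ hΞ hΞ0 a Y hY hYD hYO b
  have hq0 : 0 < q := by linarith
  have hzero : (∀ k ξ, Dk a Ξ k ξ * BB Y b ξ = 0) →
      Mqstar q (fun k ξ => Dk a Ξ k ξ * BB Y b ξ) = 0 := by
    intro h
    unfold Mqstar
    simp only [h, zero_mul, lpNormE]
    have : ∀ x, walshFT (fun _ => 0) x = 0 := by intro x; unfold walshFT; simp
    simp [this, hq0]
  obtain ⟨Vs, hVs⟩ : ∃ Vs, Vs = ⨆ ξ ∈ Ξ, vnorm r (Set.univ : Set ℤ) (dyadicSum a ξ) := ⟨_, rfl⟩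
  obtain ⟨Bs, hBs⟩ : ∃ Bs, Bs = ⨆ v ∈ Y, (‖b v‖₊ : ℝ≥0∞) := ⟨_, rfl⟩
  have hVle : ∀ ξ ∈ Ξ, vnorm r (Set.univ : Set ℤ) (dyadicSum a ξ) ≤ Vs := fun ξ hξ => by
    rw [hVs]; exact le_iSup₂ (f := fun ξ (_ : ξ ∈ Ξ) => vnorm r (Set.univ : Set ℤ) (dyadicSum a ξ)) ξ hξ
  have hBle : ∀ v ∈ Y, (‖b v‖₊ : ℝ≥0∞) ≤ Bs := fun v hv => by
    rw [hBs]; exact le_iSup₂ (f := fun v (_ : v ∈ Y) => (‖b v‖₊ : ℝ≥0∞)) v hv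
  rw [← hVs, ← hBs]
  by_cases hB0 : Bs = 0
  · rw [hzero]
    · exact zero_le
    intro k ξ
    have : |BB Y b ξ| ≤ 0 := by
      apply BB_bd hY hYD b le_rfl
      intro v hv
      have := hBle v hv
      rw [hB0] at this
      simpa using this
    rw [abs_nonpos_iff.1 this, mul_zero]
  by_cases hV0 : Vs = 0
  · rw [hzero]
    · exact zero_le
    intro k ξ
    rw [Dk_eq]
    split_ifs with h
    · obtain ⟨p, hp1, hp2⟩ := h
      have h1 := hVle p hp2
      rw [hV0] at h1
      have h2 : (‖dyadicSum a p k‖₊ : ℝ≥0∞) ≤ 0 := by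
        refine le_trans ?_ h1
        unfold vnorm
        refine le_trans ?_ le_self_add
        exact le_iSup₂ (f := fun ξ (_ : ξ ∈ (Set.univ : Set ℤ)) => (‖dyadicSum a p ξ‖₊ : ℝ≥0∞)) k (mem_univ k)
      have h3 : dyadicSum a p k = 0 := by simpa using h2
      rw [dyadicSum_eq] at h3
      have : om k p = om k ξ := om_congr (mem_om.1 hp1)
      rw [← this, h3, zero_mul]
    · rw [zero_mul]
  have hΞne : Ξ.Nonempty := by
    by_contra h
    rw [not_nonempty_iff_eq_empty] at h
    apply hV0; rw [hVs, h]; simp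
  obtain ⟨s, hs⟩ : ∃ s, s = Ξ.ncard + Y.ncard := ⟨_, rfl⟩
  have hs1 : 1 ≤ s := by
    have := (ncard_pos hΞ).2 hΞne
    omega
  rw [← hs]
  have hs1' : (1:ℝ) ≤ s := by exact_mod_cast hs1
  have hlog : 0 ≤ Real.log s := Real.log_nonneg hs1'
  have he0 : 0 ≤ 1 / q - 1 / r := by
    rw [sub_nonneg]; apply one_div_le_one_div_of_le hq0; linarith
  have he1 : 1 / q - 1 / r ≤ 1 := by
    have h1 : 1 / q ≤ 1 := by rw [div_le_one hq0]; exact hq1.le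
    have h2 : 0 ≤ 1 / r := by positivity
    linarith
  have hsr : (s : ℝ≥0∞) ^ (1 / q - 1 / r) = ENNReal.ofReal ((s:ℝ) ^ (1 / q - 1 / r)) := by
    rw [← ENNReal.ofReal_rpow_of_nonneg (by positivity) he0, ENNReal.ofReal_natCast]
  rw [hsr]
  have hA : ENNReal.ofReal (6 * C) * ENNReal.ofReal (1 + Real.log s) *
      ENNReal.ofReal ((s:ℝ) ^ (1 / q - 1 / r)) =
      ENNReal.ofReal (6 * C * (1 + Real.log s) * (s:ℝ) ^ (1 / q - 1 / r)) := by
    rw [← ENNReal.ofReal_mul (by positivity), ← ENNReal.ofReal_mul (by positivity)]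
  rw [hA]
  have hApos : 0 < 6 * C * (1 + Real.log s) * (s:ℝ) ^ (1 / q - 1 / r) := by positivity
  by_cases hVt : Vs = ⊤
  · rw [hVt, ENNReal.mul_top (by simpa using hApos), ENNReal.top_mul hB0]
    exact le_top
  have hBt : Bs ≠ ⊤ := by
    have : Bs ≤ ∑ v ∈ hY.toFinset, (‖b v‖₊ : ℝ≥0∞) := by
      rw [hBs]
      apply iSup₂_le
      intro v hv
      exact Finset.single_le_sum (f := fun v => (‖b v‖₊ : ℝ≥0∞)) (fun _ _ => zero_le) (hY.mem_toFinset.2 hv)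
    exact ne_top_of_le_ne_top (by simp [ENNReal.sum_eq_top]) this
  have eV := ENNReal.ofReal_toReal hVt
  have eB := ENNReal.ofReal_toReal hBt
  have pV := ENNReal.toReal_pos hV0 hVt
  have pB := ENNReal.toReal_pos hB0 hBt
  obtain ⟨L0, hL1, hL2⟩ := logbd s hs1
  have hΞc : (hΞ.toFinset : Set ℝ) = Ξ := hΞ.coe_toFinset
  have hb : ∀ v ∈ Y, |b v| ≤ Bs.toReal := by
    intro v hv
    have := ENNReal.toReal_mono hBt (hBle v hv)
    simpa using this
  unfold Mqstar
  apply iSup₂_le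
  intro g hg
  have hc := hcore hΞ.toFinset (fun x hx => hΞ0 (hΞ.mem_toFinset.1 hx)) a Y hY hYD hYO b Vs.toReal
    Bs.toReal pV pB (fun ξ hξ => by rw [eV]; exact hVle ξ (hΞ.mem_toFinset.1 hξ)) hb
    (2 * s) L0 (by omega) (by rw [← ncard_eq_toFinset_card Ξ hΞ]; omega) hL1 g hg
  rw [hΞc] at hc
  refine hc.trans ?_
  rw [← eV, ← eB, ← ENNReal.ofReal_mul (by positivity), ← ENNReal.ofReal_mul (by positivity),
    ENNReal.toReal_ofReal pV.le, ENNReal.toReal_ofReal pB.le]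
  apply ENNReal.ofReal_le_ofReal
  have h2s : ((2 * s : ℕ) : ℝ) ^ (1 / q - 1 / r) ≤ 2 * (s:ℝ) ^ (1 / q - 1 / r) := by
    push_cast
    rw [Real.mul_rpow (by norm_num) (by positivity)]
    gcongr
    calc (2:ℝ) ^ (1 / q - 1 / r) ≤ 2 ^ (1:ℝ) := Real.rpow_le_rpow_of_exponent_le (by norm_num) he1
      _ = 2 := by norm_num
  calc C * ((L0 + 1) * ((2 * s : ℕ) : ℝ) ^ (1 / q - 1 / r) * Vs.toReal * Bs.toReal)
      ≤ C * ((3 * (1 + Real.log s)) * (2 * (s:ℝ) ^ (1 / q - 1 / r)) * Vs.toReal * Bs.toReal) := by gcongr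
    _ = _ := by ring

end HI

/-- Lemma 3.7 (hybrid interval estimate): for `1 < q ≤ 2`, `r > 2`,
`‖𝒟_k Σ_υ b_υ 1_υ‖_{M^{q,*}} ≤ C_{q,r} (1 + log(|Ξ| + |Υ|)) (|Ξ| + |Υ|)^{1/q - 1/r}
  sup_{ξ ∈ Ξ} ‖Σ_{|ω| = 2^k} a_ω 1_ω(ξ)‖_{V^r_k} sup_υ |b_υ|`. -/
theorem hybrid_interval_estimate (q r : ℝ) (hq1 : 1 < q) (hq2 : q ≤ 2) (hr : 2 < r) :
    ∃ C : ℝ, 0 < C ∧ ∀ Ξ : Set ℝ, Ξ.Finite → Ξ ⊆ Set.Ici 0 → ∀ a : Set ℝ → ℝ,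
      ∀ Y : Set (Set ℝ), Y.Finite → Y.PairwiseDisjoint id →
      (∀ v ∈ Y, v ⊆ Set.Ici 0 ∧ v.OrdConnected) → ∀ b : Set ℝ → ℝ,
        Mqstar q (fun k ξ =>
            Dk a Ξ k ξ * ∑ᶠ v ∈ Y, b v * Set.indicator v (fun _ => (1 : ℝ)) ξ) ≤
          ENNReal.ofReal C *
            ENNReal.ofReal (1 + Real.log ((Ξ.ncard + Y.ncard : ℕ))) *
            ((Ξ.ncard + Y.ncard : ℕ) : ℝ≥0∞) ^ (1 / q - 1 / r) *
            (⨆ ξ ∈ Ξ, vnorm r (Set.univ : Set ℤ) (dyadicSum a ξ)) *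
            ⨆ v ∈ Y, (‖b v‖₊ : ℝ≥0∞) := by
  exact HI.final q r hq1 hq2 hr

end
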